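/- arXiv:2311.11746 — 3 statements merged into one kernel-verified Lean document; each statement's English description precedes it below -/
import Mathlib

section
/- Let A be a simple σ-unital C*-algebra with stable rank one, and let α : G → Aut(A) be an action of a finite group G on A with the tracial Rokhlin property. Then the fixed point algebra A^α = {a ∈ A : α_g(a) = a for all g ∈ G} has stable rank one. -/
open Filter Topology

/-- Cuntz subequivalence `a ≾ b` in a C*-algebra. -/
def CuntzSubeq {A : Type*} [NonUnitalCStarAlgebra A] (a b : A) : Prop :=
  ∃ v : ℕ → A, Tendsto (fun n => ‖a - v n * b * star (v n)‖) atTop (nhds 0)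

/-- A projection in a C*-algebra: a self-adjoint idempotent. -/
def IsProjection {A : Type*} [NonUnitalCStarAlgebra A] (p : A) : Prop :=
  IsSelfAdjoint p ∧ p * p = p

/-- A C*-algebra is simple if it is nonzero and its only closed two-sided ideals
are `⊥` and `⊤`. -/
def IsSimpleCStarAlgebra (A : Type*) [NonUnitalCStarAlgebra A] : Prop :=
  (∃ a : A, a ≠ 0) ∧ ∀ I : TwoSidedIdeal A, IsClosed (I : Set A) → I = ⊥ ∨ I = ⊤

/-- `(c - ε)₊`, via the (non-unital) continuous functional calculus. -/
noncomputable def cutPos {A : Type*} [NonUnitalCStarAlgebra A] (c : A) (ε : ℝ) : A :=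
  cfcₙ (fun t : ℝ => max (t - ε) 0) c

/-- The tracial Rokhlin property for an action of a finite group `G` on a C*-algebra `A`. -/
def TracialRokhlinProperty {A : Type*} [NonUnitalCStarAlgebra A] [PartialOrder A]
    [StarOrderedRing A] {G : Type*} [Group G] [Fintype G]
    (α : G → A ≃⋆ₐ[ℂ] A) : Prop :=
  ∀ (F : Finset A) (ε : ℝ), 0 < ε → ∀ x y : A, 0 ≤ x → 0 ≤ y → ‖x‖ = 1 →
    ∃ p : G → A,
      (∀ g, IsProjection (p g)) ∧
      (∀ g h, g ≠ h → p g * p h = 0) ∧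
      (∀ a ∈ F, ∀ g, ‖p g * a - a * p g‖ < ε) ∧
      (∀ g h, ‖α g (p h) - p (g * h)‖ < ε) ∧
      CuntzSubeq (cutPos (y * y - y * (∑ g, p g) * y) ε) x ∧
      ‖(∑ g, p g) * x * (∑ g, p g)‖ > 1 - ε

/-- A C*-algebra is σ-unital if it has a strictly positive element `h`, i.e. a positive `h`
with `closure (h A h) = A`. -/
def SigmaUnital (A : Type*) [NonUnitalCStarAlgebra A] [PartialOrder A] [StarOrderedRing A] :
    Prop :=
  ∃ h : A, 0 ≤ h ∧ closure {x : A | ∃ a : A, x = h * a * h} = Set.univ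

/-- A C*-algebra `B` has stable rank one if the invertible elements of its minimal unitization
are dense in the unitization. -/
def StableRankOne (B : Type*) [NonUnitalCStarAlgebra B] : Prop :=
  ∀ x : Unitization ℂ B, ∀ ε : ℝ, 0 < ε →
    ∃ y : Unitization ℂ B, IsUnit y ∧ ‖x - y‖ < ε

/-- The fixed point algebra `A^α` of a family of *-automorphisms, as a non-unital star
subalgebra of `A`. -/
def fixedPointAlgebra {A : Type*} [NonUnitalCStarAlgebra A] {G : Type*}
    (α : G → A ≃⋆ₐ[ℂ] A) : NonUnitalStarSubalgebra ℂ A where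
  carrier := {a : A | ∀ g : G, α g a = a}
  add_mem' := fun {a b} ha hb g => by rw [map_add, ha g, hb g]
  zero_mem' := fun g => map_zero (α g)
  mul_mem' := fun {a b} ha hb g => by rw [map_mul, ha g, hb g]
  smul_mem' := fun c a ha g => by rw [map_smul, ha g]
  star_mem' := fun {a} ha g => by rw [map_star, ha g]

instance fixedPointAlgebra_isClosed {A : Type*} [NonUnitalCStarAlgebra A] {G : Type*}
    (α : G → A ≃⋆ₐ[ℂ] A) : IsClosed ((fixedPointAlgebra α : NonUnitalStarSubalgebra ℂ A) : Set A) := by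
  have h : ((fixedPointAlgebra α : NonUnitalStarSubalgebra ℂ A) : Set A) =
      ⋂ g : G, {a : A | α g a = a} := by
    ext a
    simp [fixedPointAlgebra, Set.mem_iInter]
    rfl
  rw [h]
  exact isClosed_iInter fun g =>
    isClosed_eq ((NonUnitalStarAlgHom.isometry (α g) (α g).injective).continuous) continuous_id

section Algebra

variable {Q G : Type*} [Ring Q] [Fintype G]

/-- Products of block sums along an orthogonal family of idempotents commuting with the blocks. -/
theorem sum_block_mul_sum_block {p U V : G → Q}
    (hp : ∀ g, p g * p g = p g) (hpo : ∀ g h, g ≠ h → p g * p h = 0)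
    (hU : ∀ g h, p g * U h = U h * p g) :
    (∑ g, p g * U g) * (∑ g, p g * V g) = ∑ g, p g * (U g * V g) := by
  classical
  rw [Finset.sum_mul_sum]
  refine Finset.sum_congr rfl fun g _ => ?_
  rw [Finset.sum_eq_single g]
  · rw [hU, mul_assoc, ← mul_assoc (p g), hp, ← mul_assoc, ← hU, mul_assoc]
  · intro h _ hh
    rw [hU, mul_assoc, ← mul_assoc (p g), hpo g h hh.symm, zero_mul, mul_zero]
  · simp

theorem sum_mul_self_of_orthogonal {p : G → Q}
    (hp : ∀ g, p g * p g = p g) (hpo : ∀ g h, g ≠ h → p g * p h = 0) :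
    (∑ g, p g) * (∑ g, p g) = ∑ g, p g := by
  simpa using sum_block_mul_sum_block (U := 1) (V := 1) hp hpo (by simp)

/-- The three-block sum `E' + F'(1-P) + (1-R)(1-P)` is a left inverse of the analogous sum of the
`E`, `F` when `E'E = P` and `F'F = R`. -/
theorem three_block_left_inverse {E E' F F' P R : Q} (hP : P * P = P) (hR : R * R = R)
    (hPR : P * R = R * P) (hE : E' * E = P) (hF : F' * F = R) (hPE : P * E = E)
    (hEP : E' * P = E') (hPF : P * F = F * P) (hRF : R * F = F) (hFR : F' * R = F') :
    (E' + F' * (1 - P) + (1 - R) * (1 - P)) * (E + F * (1 - P) + (1 - R) * (1 - P)) = 1 := by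
  have hS : (1 - P) * (1 - P) = 1 - P := by
    rw [mul_sub, sub_mul, sub_mul, hP]; simp
  have hT : (1 - R) * (1 - R) = 1 - R := by
    rw [mul_sub, sub_mul, sub_mul, hR]; simp
  have hST : (1 - P) * (1 - R) = (1 - R) * (1 - P) := by
    simp only [mul_sub, sub_mul, hPR]; simp only [one_mul, mul_one]; abel
  have hES : E' * (1 - P) = 0 := by rw [mul_sub, hEP]; simp
  have hSE : (1 - P) * E = 0 := by rw [sub_mul, hPE]; simp
  have hSF : (1 - P) * F = F * (1 - P) := by rw [sub_mul, mul_sub, hPF]; simp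
  have hTF : (1 - R) * F = 0 := by rw [sub_mul, hRF]; simp
  have hFT : F' * (1 - R) = 0 := by rw [mul_sub, hFR]; simp
  generalize hSd : 1 - P = S at *
  generalize hTd : 1 - R = T at *
  have h1 : E' * (F * S) = 0 := by rw [← hSF, ← mul_assoc, hES, zero_mul]
  have h2 : E' * (T * S) = 0 := by rw [← hST, ← mul_assoc, hES, zero_mul]
  have h3 : F' * S * E = 0 := by rw [mul_assoc, hSE, mul_zero]
  have h4 : F' * S * (F * S) = R * S := by
    rw [mul_assoc, ← mul_assoc S, hSF, mul_assoc F, hS, ← mul_assoc, hF]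
  have h5 : F' * S * (T * S) = 0 := by
    rw [mul_assoc, ← mul_assoc S, hST, mul_assoc T, hS, ← mul_assoc, hFT, zero_mul]
  have h6 : T * S * E = 0 := by rw [mul_assoc, hSE, mul_zero]
  have h7 : T * S * (F * S) = 0 := by
    rw [mul_assoc, ← mul_assoc S, hSF, mul_assoc F, hS, ← mul_assoc, hTF, zero_mul]
  have h8 : T * S * (T * S) = T * S := by
    rw [mul_assoc, ← mul_assoc S, hST, mul_assoc T, hS, ← mul_assoc, hT]
  rw [add_mul, add_mul, mul_add, mul_add, mul_add, mul_add, mul_add, mul_add, hE, h1, h2, h3, h4,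
    h5, h6, h7, h8]
  rw [← hTd, ← hSd]
  noncomm_ring

end Algebra

/-- Algebraic data of a pair of (exactly) equivariant Rokhlin towers `p`, `r`, with a
subequivalence `v` of the complement of `r` into `p 1`. -/
structure TwoTower {Q G : Type*} [Ring Q] [Group G] [Fintype G] (β : G → Q →+* Q)
    (p r U U' : G → Q) (X h y v v' : Q) : Prop where
  p_idem : ∀ g, p g * p g = p g
  p_orth : ∀ g h, g ≠ h → p g * p h = 0
  r_idem : ∀ g, r g * r g = r g
  r_orth : ∀ g h, g ≠ h → r g * r h = 0
  map_p : ∀ g h, β g (p h) = p (g * h)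
  map_r : ∀ g h, β g (r h) = r (g * h)
  map_y : ∀ g, β g y = y
  map_h : ∀ g, β g h = h
  p_r : ∀ g h, p g * r h = r h * p g
  p_U : ∀ g h, p g * U h = U h * p g
  r_U : ∀ g h, r g * U h = U h * r g
  p_X : ∀ g, p g * X = X * p g
  r_X : ∀ g, r g * X = X * r g
  p_h : ∀ g, p g * h = h * p g
  r_h : ∀ g, r g * h = h * r g
  p_y : ∀ g, p g * y = y * p g
  r_y : ∀ g, r g * y = y * r g
  left_inv : ∀ g, U' g * U g = 1
  right_inv : ∀ g, U g * U' g = 1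
  p_v : p 1 * v = v
  v_p : v' * p 1 = v'
  v_h : v' * h = 0
  v_v : v' * v = y * (1 - ∑ g, r g) * y

namespace TwoTower

variable {Q G : Type*} [Ring Q] [Group G] [Fintype G] {β : G → Q →+* Q}
  {p r U U' : G → Q} {X h y v v' : Q}

theorem commute_inv (T : TwoTower β p r U U' X h y v v') (g k : G) :
    p g * U' k = U' k * p g ∧ r g * U' k = U' k * r g := by
  constructor
  · calc p g * U' k = U' k * (U k * p g) * U' k := by
          rw [← mul_assoc, T.left_inv, one_mul]
      _ = U' k * p g := by
          rw [← T.p_U, mul_assoc, mul_assoc, T.right_inv, mul_one]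
  · calc r g * U' k = U' k * (U k * r g) * U' k := by
          rw [← mul_assoc, T.left_inv, one_mul]
      _ = U' k * r g := by
          rw [← T.r_U, mul_assoc, mul_assoc, T.right_inv, mul_one]

theorem P_idem (T : TwoTower β p r U U' X h y v v') : (∑ g, p g) * (∑ g, p g) = ∑ g, p g :=
  sum_mul_self_of_orthogonal T.p_idem T.p_orth

theorem R_idem (T : TwoTower β p r U U' X h y v v') : (∑ g, r g) * (∑ g, r g) = ∑ g, r g :=
  sum_mul_self_of_orthogonal T.r_idem T.r_orth

theorem P_R (T : TwoTower β p r U U' X h y v v') :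
    (∑ g, p g) * (∑ g, r g) = (∑ g, r g) * (∑ g, p g) := by
  rw [Finset.sum_mul_sum, Finset.sum_mul_sum, Finset.sum_comm]
  simp only [T.p_r]

theorem P_r (T : TwoTower β p r U U' X h y v v') (g : G) :
    (∑ g, p g) * r g = r g * (∑ g, p g) := by
  rw [Finset.sum_mul, Finset.mul_sum]
  simp only [T.p_r]

theorem left_inverse (T : TwoTower β p r U U' X h y v v') :
    ((∑ g, p g * U' g) + (∑ g, r g * U' g) * (1 - ∑ g, p g) +
        (1 - ∑ g, r g) * (1 - ∑ g, p g)) *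
      ((∑ g, p g * U g) + (∑ g, r g * U g) * (1 - ∑ g, p g) +
        (1 - ∑ g, r g) * (1 - ∑ g, p g)) = 1 := by
  refine three_block_left_inverse T.P_idem T.R_idem T.P_R ?_ ?_ ?_ ?_ ?_ ?_ ?_
  · rw [sum_block_mul_sum_block T.p_idem T.p_orth fun g k => (T.commute_inv g k).1]
    simp [T.left_inv]
  · rw [sum_block_mul_sum_block T.r_idem T.r_orth fun g k => (T.commute_inv g k).2]
    simp [T.left_inv]
  · simpa using sum_block_mul_sum_block (U := 1) (V := U) T.p_idem T.p_orth (by simp)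
  · simpa using sum_block_mul_sum_block (U := U') (V := 1) T.p_idem T.p_orth
      fun g k => (T.commute_inv g k).1
  · rw [Finset.mul_sum, Finset.sum_mul]
    refine Finset.sum_congr rfl fun g _ => ?_
    rw [← mul_assoc, T.P_r, mul_assoc, mul_assoc, Finset.sum_mul, Finset.mul_sum]
    simp only [T.p_U, Finset.mul_sum]
  · simpa using sum_block_mul_sum_block (U := 1) (V := U) T.r_idem T.r_orth (by simp)
  · simpa using sum_block_mul_sum_block (U := U') (V := 1) T.r_idem T.r_orth
      fun g k => (T.commute_inv g k).2

theorem p_map_v (T : TwoTower β p r U U' X h y v v') (g : G) : p g * β g v = β g v := by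
  conv_rhs => rw [← T.p_v, map_mul, T.map_p, mul_one]

theorem map_v_p (T : TwoTower β p r U U' X h y v v') (g : G) : β g v' * p g = β g v' := by
  conv_rhs => rw [← T.v_p, map_mul, T.map_p, mul_one]

theorem map_v_P (T : TwoTower β p r U U' X h y v v') (g : G) :
    β g v' * (∑ k, p k) = β g v' := by
  classical
  rw [← T.map_v_p g, Finset.mul_sum, Finset.sum_eq_single g]
  · rw [mul_assoc, T.p_idem]
  · intro k _ hk
    rw [mul_assoc, T.p_orth g k hk.symm, mul_zero]
  · simp

theorem map_R (T : TwoTower β p r U U' X h y v v') (g : G) :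
    β g (∑ k, r k) = ∑ k, r k := by
  rw [map_sum]
  simp only [T.map_r]
  exact Fintype.sum_equiv (Equiv.mulLeft g) _ _ fun k => rfl

theorem sum_map_v_mul (T : TwoTower β p r U U' X h y v v') :
    (∑ g, β g v') * (∑ g, β g v) = Fintype.card G • (y * (1 - ∑ g, r g) * y) := by
  classical
  have key : ∀ g, β g v' * (∑ k, β k v) = y * (1 - ∑ g, r g) * y := by
    intro g
    rw [Finset.mul_sum, Finset.sum_eq_single g]
    · rw [← map_mul, T.v_v]
      simp [T.map_y, T.map_R]
    · intro k _ hk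
      rw [← T.map_v_p, ← T.p_map_v k, mul_assoc, ← mul_assoc (p g), T.p_orth g k hk.symm,
        zero_mul, mul_zero]
    · simp
  rw [Finset.sum_mul]
  simp [key]

/-- The compressed corner identity: multiplying the perturbed block operator by `1 + s w*` makes
it diagonal plus skew. -/
theorem corner_identity (T : TwoTower β p r U U' X h y v v') [Algebra ℂ Q] (δ δ₁ s : ℂ) :
    (1 + s • ((1 - ∑ g, p g) * ∑ g, β g v')) *
      ((h + δ₁ • 1) * (1 - (1 - ∑ g, r g) * (1 - ∑ g, p g)) +
        (1 - ∑ g, r g) * (1 - ∑ g, p g) * X +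
        δ • ((∑ g, β g v) * (1 - ∑ g, p g)) -
        (δ + s * δ₁) • ((1 - ∑ g, p g) * ∑ g, β g v')) =
      (h + δ₁ • 1) * (1 - (1 - ∑ g, r g) * (1 - ∑ g, p g)) +
        (1 - ∑ g, r g) * (1 - ∑ g, p g) * (X + (s * δ * Fintype.card G) • (y * y)) +
        δ • ((∑ g, β g v) * (1 - ∑ g, p g) - (1 - ∑ g, p g) * ∑ g, β g v') := by
  have hPy : (∑ g, p g) * y = y * ∑ g, p g := by
    rw [Finset.sum_mul, Finset.mul_sum]; simp only [T.p_y]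
  have hRy : (∑ g, r g) * y = y * ∑ g, r g := by
    rw [Finset.sum_mul, Finset.mul_sum]; simp only [T.r_y]
  have hvv := T.sum_map_v_mul
  have hvP : (∑ g, β g v') * (∑ g, p g) = ∑ g, β g v' := by
    rw [Finset.sum_mul]; simp only [T.map_v_P]
  have hvh : (∑ g, β g v') * h = 0 := by
    rw [Finset.sum_mul]
    refine Finset.sum_eq_zero fun g _ => ?_
    rw [← T.map_h g, ← map_mul, T.v_h, map_zero]
  have hP := T.P_idem
  have hPR := T.P_R
  generalize (∑ g, p g) = P at *
  generalize (∑ g, r g) = R at *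
  generalize (∑ g, β g v') = W' at *
  generalize (∑ g, β g v) = W at *
  have hSS : (1 - P) * (1 - P) = 1 - P := by
    rw [mul_sub, sub_mul, sub_mul, hP]; simp
  have hSR : (1 - P) * (1 - R) = (1 - R) * (1 - P) := by
    simp only [mul_sub, sub_mul, hPR]; simp only [one_mul, mul_one]; abel
  have hSy : (1 - P) * y = y * (1 - P) := by rw [sub_mul, mul_sub, hPy]; simp
  have hTy : (1 - R) * y = y * (1 - R) := by rw [sub_mul, mul_sub, hRy]; simp
  have hWS : W' * (1 - P) = 0 := by rw [mul_sub, hvP]; simp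
  generalize hS : 1 - P = S at *
  generalize hT : 1 - R = T' at *
  have hWq : W' * (T' * S) = 0 := by rw [← hSR, ← mul_assoc, hWS, zero_mul]
  have h1 : S * W' * ((h + δ₁ • 1) * (1 - T' * S)) = δ₁ • (S * W') := by
    rw [mul_assoc, ← mul_assoc W', mul_add, hvh, zero_add, mul_smul_comm, mul_one, smul_mul_assoc,
      mul_sub, hWq, mul_one, sub_zero, mul_smul_comm]
  have h2 : S * W' * (T' * S * X) = 0 := by
    rw [mul_assoc, ← mul_assoc W', hWq, zero_mul, mul_zero]
  have h3 : S * W' * (W * S) = Fintype.card G • (T' * S * (y * y)) := by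
    rw [mul_assoc, ← mul_assoc W', hvv, smul_mul_assoc, mul_smul_comm]
    congr 1
    calc S * (y * T' * y * S) = S * y * T' * (y * S) := by simp only [mul_assoc]
      _ = y * (S * T' * S) * y := by rw [hSy]; simp only [mul_assoc]; rw [← hSy]
      _ = y * T' * (S * y) := by rw [hSR, mul_assoc T', hSS]; simp only [mul_assoc]
      _ = T' * S * (y * y) := by
        rw [← hTy, hSy, mul_assoc, ← mul_assoc y, mul_assoc y, ← hSy, ← mul_assoc y, ← hSy]
        simp only [mul_assoc]
  have h4 : S * W' * (S * W') = 0 := by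
    rw [mul_assoc, ← mul_assoc W', hWS, zero_mul, mul_zero]
  generalize (h + δ₁ • 1) * (1 - T' * S) = Z at *
  rw [add_mul, one_mul, smul_mul_assoc, mul_sub, mul_add, mul_add, h1, h2, mul_smul_comm,
    mul_smul_comm, h3, h4, ← Nat.cast_smul_eq_nsmul ℂ, mul_add, mul_smul_comm]
  simp only [smul_zero, sub_zero, add_zero, smul_add, smul_sub, smul_smul, add_smul]
  rw [show s * δ * (Fintype.card G : ℂ) = s * (δ * Fintype.card G) by ring]
  abel

theorem error_identity (T : TwoTower β p r U U' X h y v v') :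
    ((∑ g, p g * U g) + (∑ g, r g * U g) * (1 - ∑ g, p g) +
        (1 - ∑ g, r g) * (1 - ∑ g, p g)) *
      (h * (1 - (1 - ∑ g, r g) * (1 - ∑ g, p g)) +
        (1 - ∑ g, r g) * (1 - ∑ g, p g) * X) =
      X + (∑ g, p g * (U g * h - X)) + (∑ g, r g * (U g * h - X)) * (1 - ∑ g, p g) := by
  have hPh : (∑ g, p g) * h = h * ∑ g, p g := by
    rw [Finset.sum_mul, Finset.mul_sum]; simp only [T.p_h]
  have hRh : (∑ g, r g) * h = h * ∑ g, r g := by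
    rw [Finset.sum_mul, Finset.mul_sum]; simp only [T.r_h]
  have hPX : (∑ g, p g) * X = X * ∑ g, p g := by
    rw [Finset.sum_mul, Finset.mul_sum]; simp only [T.p_X]
  have hEP : (∑ g, p g * U g) * (∑ g, p g) = ∑ g, p g * U g := by
    simpa using sum_block_mul_sum_block (U := U) (V := 1) T.p_idem T.p_orth T.p_U
  have hFR : (∑ g, r g * U g) * (∑ g, r g) = ∑ g, r g * U g := by
    simpa using sum_block_mul_sum_block (U := U) (V := 1) T.r_idem T.r_orth T.r_U
  have e1 : ∑ g, p g * (U g * h - X) = (∑ g, p g * U g) * h - (∑ g, p g) * X := by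
    simp only [mul_sub, Finset.sum_sub_distrib, Finset.sum_mul, mul_assoc]
  have e2 : ∑ g, r g * (U g * h - X) = (∑ g, r g * U g) * h - (∑ g, r g) * X := by
    simp only [mul_sub, Finset.sum_sub_distrib, Finset.sum_mul, mul_assoc]
  have hP := T.P_idem
  have hR := T.R_idem
  have hPR := T.P_R
  rw [e1, e2]
  generalize (∑ g, p g * U g) = E at *
  generalize (∑ g, r g * U g) = F at *
  generalize (∑ g, p g) = P at *
  generalize (∑ g, r g) = R at *
  have hqE : E * ((1 - R) * (1 - P)) = 0 := by
    rw [← hEP]; simp only [mul_sub, sub_mul, one_mul, mul_one, mul_assoc]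
    rw [← hPR, ← mul_assoc P P, hP]; simp
  have hqF : F * (1 - P) * ((1 - R) * (1 - P)) = 0 := by
    have : (1 - P) * ((1 - R) * (1 - P)) = (1 - R) * (1 - P) := by
      simp only [mul_sub, sub_mul, one_mul, mul_one]
      rw [← mul_assoc, hPR, mul_assoc, hP]; abel
    rw [mul_assoc, this, ← mul_assoc, mul_sub F, hFR]; simp
  have hqq : (1 - R) * (1 - P) * ((1 - R) * (1 - P)) = (1 - R) * (1 - P) := by
    have a1 : (1 - P) * (1 - R) = (1 - R) * (1 - P) := by
      simp only [mul_sub, sub_mul, hPR]; simp only [one_mul, mul_one]; abel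
    have a2 : (1 - P) * (1 - P) = 1 - P := by simp [mul_sub, sub_mul, hP]
    have a3 : (1 - R) * (1 - R) = 1 - R := by simp [mul_sub, sub_mul, hR]
    rw [mul_assoc, ← mul_assoc (1 - P), a1, mul_assoc, a2, ← mul_assoc, a3]
  have hqh : h * (1 - (1 - R) * (1 - P)) = (1 - (1 - R) * (1 - P)) * h := by
    simp only [mul_sub, sub_mul, one_mul, mul_one, mul_assoc, ← hPh, ← hRh]
    rw [hPh, ← mul_assoc R h P, hRh, mul_assoc]
  have hS : (1 - P) * h = h * (1 - P) := by rw [mul_sub, sub_mul, hPh]; simp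
  have hS' : (1 - P) * X = X * (1 - P) := by rw [mul_sub, sub_mul, hPX]; simp
  rw [hqh, mul_add]
  generalize hq : (1 - R) * (1 - P) = q at *
  have hVq : (E + F * (1 - P) + q) * q = q := by rw [add_mul, add_mul, hqE, hqF, hqq]; simp
  have hV : (E + F * (1 - P) + q) * (1 - q) = E + F * (1 - P) := by
    rw [mul_sub, hVq, mul_one, add_sub_cancel_right]
  rw [← mul_assoc, ← mul_assoc, hV, hVq, add_mul, mul_assoc F, hS, ← mul_assoc, ← hq,
    sub_mul (F * h), mul_assoc R X, ← hS', mul_assoc (1 - R), hS']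
  simp only [mul_sub, sub_mul, one_mul, mul_one, mul_assoc, hPX]
  abel

end TwoTower

section NullSequences

open BoundedContinuousFunction

/-- The ideal of sequences converging to zero in the algebra of bounded sequences. -/
def nullSeqIdeal (D : Type*) [CStarAlgebra D] : Ideal (ℕ →ᵇ D) where
  carrier := {f | Tendsto (fun k => ‖f k‖) atTop (𝓝 0)}
  add_mem' {f g} hf hg := by
    have := Tendsto.add hf hg
    rw [add_zero] at this
    exact squeeze_zero (fun k => norm_nonneg _) (fun k => norm_add_le (f k) (g k)) this
  zero_mem' := by simp
  smul_mem' c f hf := by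
    have := Tendsto.const_mul ‖c‖ hf
    rw [mul_zero] at this
    refine squeeze_zero (fun k => norm_nonneg _) (fun k => ?_) this
    refine (norm_mul_le (c k) (f k)).trans ?_
    gcongr
    exact c.norm_coe_le_norm k

instance (D : Type*) [CStarAlgebra D] : (nullSeqIdeal D).IsTwoSided where
  mul_mem_of_left {f} c hf := by
    have := Tendsto.mul_const ‖c‖ hf
    rw [zero_mul] at this
    refine squeeze_zero (fun k => norm_nonneg _) (fun k => ?_) this
    refine (norm_mul_le (f k) (c k)).trans ?_
    gcongr
    exact c.norm_coe_le_norm k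

variable {D : Type*} [CStarAlgebra D]

/-- The quotient map from bounded sequences to bounded sequences modulo null sequences. -/
noncomputable abbrev seqMk (D : Type*) [CStarAlgebra D] :
    (ℕ →ᵇ D) →ₐ[ℂ] (ℕ →ᵇ D) ⧸ nullSeqIdeal D :=
  Ideal.Quotient.mkₐ ℂ (nullSeqIdeal D)

theorem seqMk_eq_iff {f g : ℕ →ᵇ D} :
    seqMk D f = seqMk D g ↔ Tendsto (fun k => ‖f k - g k‖) atTop (𝓝 0) :=
  Ideal.Quotient.eq

theorem seqMk_eq_of_le {f g : ℕ →ᵇ D} (h : ∀ k : ℕ, ‖f k - g k‖ ≤ 1 / ((k : ℝ) + 1)) :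
    seqMk D f = seqMk D g :=
  seqMk_eq_iff.2 (squeeze_zero (fun _ => norm_nonneg _) h tendsto_one_div_add_atTop_nhds_zero_nat)

theorem seqMk_star_congr {f g : ℕ →ᵇ D} (h : seqMk D f = seqMk D g) :
    seqMk D (star f) = seqMk D (star g) := by
  rw [seqMk_eq_iff] at h ⊢
  simpa [← star_sub] using h

/-- A bounded sequence from a pointwise bound. -/
noncomputable abbrev seqOf (f : ℕ → D) (C : ℝ) (h : ∀ k, ‖f k‖ ≤ C) : ℕ →ᵇ D :=
  ofNormedAddCommGroupDiscrete f C h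

/-- Termwise application of a star homomorphism to bounded sequences. -/
noncomputable def seqMap (φ : D →⋆ₐ[ℂ] D) : (ℕ →ᵇ D) →⋆ₐ[ℂ] (ℕ →ᵇ D) where
  toFun f := seqOf (fun k => φ (f k)) ‖f‖ fun k =>
    (NonUnitalStarAlgHom.norm_apply_le φ (f k)).trans (f.norm_coe_le_norm k)
  map_one' := by ext; simp
  map_mul' f g := by ext; simp
  map_zero' := by ext; simp
  map_add' f g := by ext; simp
  commutes' r := by
    ext k
    exact AlgHomClass.commutes φ r
  map_star' f := by ext; simp [map_star]

@[simp]
theorem seqMap_apply (φ : D →⋆ₐ[ℂ] D) (f : ℕ →ᵇ D) (k : ℕ) : seqMap φ f k = φ (f k) := rfl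

@[simp]
theorem seqMap_const (φ : D →⋆ₐ[ℂ] D) (a : D) : seqMap φ (const ℕ a) = const ℕ (φ a) := rfl

/-- The homomorphism induced on bounded sequences modulo null sequences. -/
noncomputable def seqQuotMap (φ : D →⋆ₐ[ℂ] D) :
    (ℕ →ᵇ D) ⧸ nullSeqIdeal D →+* (ℕ →ᵇ D) ⧸ nullSeqIdeal D :=
  Ideal.Quotient.lift (nullSeqIdeal D)
    ((seqMk D : (ℕ →ᵇ D) →+* _).comp (seqMap φ : (ℕ →ᵇ D) →+* (ℕ →ᵇ D))) fun f hf => by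
      refine Ideal.Quotient.eq_zero_iff_mem.2 ?_
      exact squeeze_zero (fun k => norm_nonneg _)
        (fun k => NonUnitalStarAlgHom.norm_apply_le φ (f k)) hf

@[simp]
theorem seqQuotMap_mk (φ : D →⋆ₐ[ℂ] D) (f : ℕ →ᵇ D) :
    seqQuotMap φ (seqMk D f) = seqMk D (seqMap φ f) := rfl

end NullSequences

section Invertibility

variable {D : Type*} [CStarAlgebra D]

/-- If the invertibles are dense, an element bounded below as a left multiplier is invertible. -/
theorem isUnit_of_mul_boundedBelow (hD : ∀ x : D, ∀ ε : ℝ, 0 < ε → ∃ y, IsUnit y ∧ ‖x - y‖ < ε)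
    {Y : D} {c : ℝ} (hc : 0 < c) (h : ∀ a, c * ‖a‖ ≤ ‖Y * a‖) : IsUnit Y := by
  nontriviality D
  obtain ⟨_, ⟨z, rfl⟩, hz⟩ := hD Y (c / 2) (by positivity)
  have hpos : 0 < ‖(↑z⁻¹ : D)‖ := norm_pos_iff.2 z⁻¹.ne_zero
  refine ⟨Units.ofNearby z Y ?_, rfl⟩
  have h1 : c * ‖(↑z⁻¹ : D)‖ ≤ c / 2 * ‖(↑z⁻¹ : D)‖ + 1 := calc
    c * ‖(↑z⁻¹ : D)‖ ≤ ‖Y * ↑z⁻¹‖ := h _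
    _ = ‖(Y - z) * ↑z⁻¹ + 1‖ := by rw [sub_mul, Units.mul_inv, sub_add_cancel]
    _ ≤ ‖(Y - z) * ↑z⁻¹‖ + ‖(1 : D)‖ := norm_add_le _ _
    _ ≤ c / 2 * ‖(↑z⁻¹ : D)‖ + 1 := by
      rw [CStarRing.norm_one]
      gcongr
      exact (norm_mul_le _ _).trans (by gcongr)
  refine hz.trans_le ?_
  rw [← one_div, le_div_iff₀ hpos]
  linarith

/-- An element whose real part is approximately at least `r` is bounded below. -/
theorem boundedBelow_of_realPart [PartialOrder D] [StarOrderedRing D] {N Z : D} {r : ℝ}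
    (hr : 0 ≤ r) (hZ : 0 ≤ Z) (h : ‖N + star N - ((2 * r : ℝ) : ℂ) • (1 : D) - Z‖ ≤ r) (a : D) :
    r / 2 * ‖a‖ ≤ ‖N * a‖ := by
  have hsa : IsSelfAdjoint (N + star N - ((2 * r : ℝ) : ℂ) • (1 : D) - Z) := by
    refine ((IsSelfAdjoint.add_star_self N).sub ?_).sub (IsSelfAdjoint.of_nonneg hZ)
    simp [IsSelfAdjoint]
  have h1 : -(algebraMap ℝ D r) ≤ N + star N - ((2 * r : ℝ) : ℂ) • (1 : D) - Z := by
    refine le_trans ?_ hsa.neg_algebraMap_norm_le_self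
    rw [neg_le_neg_iff]
    exact algebraMap_mono D h
  have h2 : algebraMap ℝ D r ≤ N + star N := by
    have h3 : ((2 * r : ℝ) : ℂ) • (1 : D) = algebraMap ℝ D r + algebraMap ℝ D r := by
      rw [← map_add, ← two_mul, Algebra.algebraMap_eq_smul_one]
      exact (RCLike.real_smul_eq_coe_smul (K := ℂ) _ _).symm
    rw [h3] at h1
    calc algebraMap ℝ D r ≤ algebraMap ℝ D r + Z := le_add_of_nonneg_right hZ
      _ = -(algebraMap ℝ D r) + (algebraMap ℝ D r + algebraMap ℝ D r + Z) := by abel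
      _ ≤ (N + star N - (algebraMap ℝ D r + algebraMap ℝ D r) - Z) +
          (algebraMap ℝ D r + algebraMap ℝ D r + Z) := by gcongr
      _ = N + star N := by abel
  have h4 : star a * algebraMap ℝ D r * a ≤ star a * (N + star N) * a :=
    star_left_conjugate_le_conjugate h2 a
  have h5 : ‖star a * algebraMap ℝ D r * a‖ = r * ‖a‖ * ‖a‖ := by
    rw [Algebra.algebraMap_eq_smul_one, mul_smul_comm, mul_one, smul_mul_assoc, norm_smul,
      CStarRing.norm_star_mul_self, Real.norm_of_nonneg hr, mul_assoc]
  have h6 := CStarAlgebra.norm_le_norm_of_nonneg_of_le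
    (star_left_conjugate_nonneg (by
      rw [Algebra.algebraMap_eq_smul_one]; exact smul_nonneg hr zero_le_one) a) h4
  have h7 : star a * (N + star N) * a = star a * (N * a) + star (N * a) * a := by
    rw [star_mul]; noncomm_ring
  rw [h5, h7] at h6
  have h8 : ‖star a * (N * a) + star (N * a) * a‖ ≤ 2 * ‖N * a‖ * ‖a‖ := by
    refine (norm_add_le _ _).trans ?_
    have := norm_mul_le (star a) (N * a)
    have := norm_mul_le (star (N * a)) a
    rw [norm_star] at *
    linarith
  rcases (norm_nonneg a).eq_or_lt with ha | ha
  · rw [← ha]; simp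
  · have := le_of_mul_le_mul_right (h6.trans h8) ha
    linarith

end Invertibility

section Tower

open BoundedContinuousFunction

variable {D G : Type*} [CStarAlgebra D] [Fintype G]

/-- The sum of a bounded sequence over the orbit of a finite group action. -/
noncomputable def orbitSum (β : G → D →⋆ₐ[ℂ] D) (x : ℕ →ᵇ D) : ℕ →ᵇ D := ∑ g, seqMap (β g) x

theorem star_orbitSum (β : G → D →⋆ₐ[ℂ] D) (x : ℕ →ᵇ D) :
    star (orbitSum β x) = orbitSum β (star x) := by
  simp [orbitSum, star_sum, map_star]

theorem seqMk_orbitSum (β : G → D →⋆ₐ[ℂ] D) (x : ℕ →ᵇ D) :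
    seqMk D (orbitSum β x) = ∑ g, seqQuotMap (β g) (seqMk D x) := by
  simp only [orbitSum, map_sum, seqQuotMap_mk]

theorem norm_orbitSum_le (β : G → D →⋆ₐ[ℂ] D) (x : ℕ →ᵇ D) :
    ‖orbitSum β x‖ ≤ Fintype.card G * ‖x‖ := by
  refine (norm_sum_le _ _).trans ((Finset.sum_le_card_nsmul _ _ ‖x‖ fun g _ => ?_).trans ?_)
  · exact NonUnitalStarAlgHom.norm_apply_le (seqMap (β g)) x
  · simp

theorem eventually_norm_sub_lt_of_seqMk_eq {f g : ℕ →ᵇ D} (h : seqMk D f = seqMk D g) {ε : ℝ}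
    (hε : 0 < ε) : ∀ᶠ k in atTop, ‖f k - g k‖ < ε :=
  (seqMk_eq_iff.1 h).eventually_lt_const hε

variable [Group G]

theorem seqMap_orbitSum {β : G → D →⋆ₐ[ℂ] D} (hβ : ∀ g h a, β (g * h) a = β g (β h a))
    (x : ℕ →ᵇ D) (g : G) : seqMap (β g) (orbitSum β x) = orbitSum β x := by
  rw [orbitSum, map_sum]
  refine Fintype.sum_equiv (Equiv.mulLeft g) _ _ fun k => ?_
  ext n
  simp [hβ]

/-- A pair of approximately equivariant, approximately central towers `e`, `f` of projections,
with an element `v` approximately implementing a subequivalence of `y (1 - ∑ f) y` into the corner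
of `e 1` and the hereditary subalgebra of `d`. -/
structure ApproxTower (β : G → D →⋆ₐ[ℂ] D) (S : Set D) (d y : D) (C τ : ℝ) (e f : G → D)
    (m v : D) : Prop where
  e_proj : ∀ g, IsStarProjection (e g)
  f_proj : ∀ g, IsStarProjection (f g)
  e_orth : ∀ g h, g ≠ h → e g * e h = 0
  f_orth : ∀ g h, g ≠ h → f g * f h = 0
  map_e : ∀ g h, ‖β g (e h) - e (g * h)‖ ≤ τ
  map_f : ∀ g h, ‖β g (f h) - f (g * h)‖ ≤ τ
  e_comm : ∀ g, ∀ a ∈ S, ‖e g * a - a * e g‖ ≤ τ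
  f_comm : ∀ g, ∀ a ∈ S, ‖f g * a - a * f g‖ ≤ τ
  e_f : ∀ g h, ‖e g * f h - f h * e g‖ ≤ τ
  m_le : ‖m‖ ≤ C
  v_le : ‖v‖ ≤ C
  v_eq : v = d * e 1 * d * m * v
  v_v : ‖star v * v - y * (1 - ∑ g, f g) * y‖ ≤ τ

theorem twoTower_of_approxTower {β : G → D →⋆ₐ[ℂ] D} {S : Set D} {h d y X : D} {C : ℝ} {u : Dˣ}
    (hβy : ∀ g, β g y = y) (hβh : ∀ g, β g h = h) (hd : star d = d) (hdh : d * h = 0)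
    (hX : X ∈ S) (hhS : h ∈ S) (hyS : y ∈ S) (hdS : d ∈ S) (huS : ∀ g, β g u ∈ S)
    {e f : G → ℕ →ᵇ D} {m v : ℕ →ᵇ D}
    (hT : ∀ k : ℕ, ApproxTower β S d y C (1 / ((k : ℝ) + 1)) (fun g => e g k) (fun g => f g k)
      (m k) (v k)) :
    TwoTower (fun g => seqQuotMap (β g)) (fun g => seqMk D (e g)) (fun g => seqMk D (f g))
      (fun g => seqMk D (const ℕ (β g u))) (fun g => seqMk D (const ℕ (β g ↑u⁻¹)))
      (seqMk D (const ℕ X)) (seqMk D (const ℕ h)) (seqMk D (const ℕ y))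
      (seqMk D v) (seqMk D (star v)) := by
  have comm : ∀ {p : ℕ →ᵇ D} {a : D}, (∀ k : ℕ, ‖p k * a - a * p k‖ ≤ 1 / ((k : ℝ) + 1)) →
      seqMk D p * seqMk D (const ℕ a) = seqMk D (const ℕ a) * seqMk D p := by
    intro p a hp
    rw [← map_mul, ← map_mul]
    exact seqMk_eq_of_le hp
  have idem : ∀ g, seqMk D (e g) * seqMk D (e g) = seqMk D (e g) := fun g => by
    rw [← map_mul]
    exact congrArg _ (by ext k; exact ((hT k).e_proj g).isIdempotentElem)
  have hev : seqMk D (e 1) * seqMk D v = seqMk D v := by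
    have hv : seqMk D v = seqMk D (const ℕ d) * seqMk D (e 1) * seqMk D (const ℕ d) *
        seqMk D m * seqMk D v := by
      simp only [← map_mul]
      exact congrArg _ (by ext k; exact (hT k).v_eq)
    have hc := comm (p := e 1) (a := d) fun k => (hT k).e_comm 1 d hdS
    conv_rhs => rw [hv]
    conv_lhs => rw [hv]
    rw [← hc]
    simp only [← mul_assoc]
    rw [idem]
  have hes : star (e 1) = e 1 := by
    ext k; exact ((hT k).e_proj 1).isSelfAdjoint
  refine
    { p_idem := idem
      p_orth := fun g k hgk => ?_
      r_idem := fun g => ?_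
      r_orth := fun g k hgk => ?_
      map_p := fun g k => seqMk_eq_of_le fun n => (hT n).map_e g k
      map_r := fun g k => seqMk_eq_of_le fun n => (hT n).map_f g k
      map_y := fun g => ?_
      map_h := fun g => ?_
      p_r := fun g k => ?_
      p_U := fun g k => comm fun n => (hT n).e_comm g _ (huS k)
      r_U := fun g k => comm fun n => (hT n).f_comm g _ (huS k)
      p_X := fun g => comm fun n => (hT n).e_comm g _ hX
      r_X := fun g => comm fun n => (hT n).f_comm g _ hX
      p_h := fun g => comm fun n => (hT n).e_comm g _ hhS
      r_h := fun g => comm fun n => (hT n).f_comm g _ hhS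
      p_y := fun g => comm fun n => (hT n).e_comm g _ hyS
      r_y := fun g => comm fun n => (hT n).f_comm g _ hyS
      left_inv := fun g => ?_
      right_inv := fun g => ?_
      p_v := hev
      v_p := ?_
      v_h := ?_
      v_v := ?_ }
  · rw [← map_mul, ← map_zero (seqMk D)]
    exact congrArg _ (by ext n; exact (hT n).e_orth g k hgk)
  · rw [← map_mul]
    exact congrArg _ (by ext n; exact ((hT n).f_proj g).isIdempotentElem)
  · rw [← map_mul, ← map_zero (seqMk D)]
    exact congrArg _ (by ext n; exact (hT n).f_orth g k hgk)
  · rw [seqQuotMap_mk, seqMap_const, hβy]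
  · rw [seqQuotMap_mk, seqMap_const, hβh]
  · rw [← map_mul, ← map_mul]
    exact seqMk_eq_of_le fun n => (hT n).e_f g k
  · rw [← map_mul, ← map_one (seqMk D)]
    exact congrArg _ (by ext n; simp [← map_mul])
  · rw [← map_mul, ← map_one (seqMk D)]
    exact congrArg _ (by ext n; simp [← map_mul])
  · have := seqMk_star_congr ((map_mul (seqMk D) _ _).trans hev)
    rwa [star_mul, hes, map_mul] at this
  · rw [← map_mul, ← map_zero (seqMk D)]
    refine congrArg _ ?_
    ext n
    change star (v n) * h = 0
    rw [(hT n).v_eq]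
    simp only [star_mul, mul_assoc, hd, hdh, mul_zero]
  · simp only [← map_mul, ← map_sum, ← map_one (seqMk D), ← map_sub]
    refine seqMk_eq_of_le fun n => ?_
    simpa using (hT n).v_v

end Tower

section Perturbation

open BoundedContinuousFunction

theorem block_realPart_identity {Q : Type*} [Ring Q] [Algebra ℂ Q] {q h X X' z B : Q} (t : ℂ)
    (hq : q * q = q) (hqh : q * h = h * q) (hqX : q * X = X * q) (hqX' : q * X' = X' * q)
    (hqz : q * z = z * q) :
    (h + t • 1) * (1 - q) + q * (X + z) + B + ((1 - q) * (h + t • 1) + (X' + z) * q - B) =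
      (1 - q) * (h + h) * (1 - q) + q * (X + X' + (z + z) - (t • 1 + t • 1)) * q +
        (t • 1 + t • 1) := by
  have h1 : ∀ a, a * q * q = a * q := fun a => by rw [mul_assoc, hq]
  have hqt : q * (t • 1) = t • 1 * q := by simp
  simp only [mul_add, add_mul, mul_sub, sub_mul, one_mul, mul_one, h1, hqh, hqX, hqX', hqz, hqt]
  abel

variable {D G : Type*} [CStarAlgebra D] [PartialOrder D] [StarOrderedRing D] [Group G] [Fintype G]

theorem one_add_conjugate_realPart_nonneg {b y : D} (hy : star y = y) {K t : ℝ} (hK : ‖b‖ ≤ K)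
    (ht : t ≤ 1) :
    0 ≤ (1 + y * b * y) + star (1 + y * b * y) + ((K : ℂ) • (y * y) + (K : ℂ) • (y * y)) -
      ((t : ℂ) • (1 : D) + (t : ℂ) • (1 : D)) := by
  have hsa : IsSelfAdjoint (b + star b) := IsSelfAdjoint.add_star_self b
  have hb : 0 ≤ b + star b + algebraMap ℝ D (K + K) := by
    have h1 := hsa.neg_algebraMap_norm_le_self
    have h2 : ‖b + star b‖ ≤ K + K := (norm_add_le _ _).trans (by rw [norm_star]; gcongr)
    have h3 : algebraMap ℝ D ‖b + star b‖ ≤ algebraMap ℝ D (K + K) := algebraMap_mono D h2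
    have h4 := (neg_le_neg h3).trans h1
    rwa [neg_le_iff_add_nonneg] at h4
  have h1 : 0 ≤ algebraMap ℝ D (1 - t + (1 - t)) := algebraMap_nonneg D (by linarith)
  have h2 := add_nonneg h1 (star_left_conjugate_nonneg hb y)
  convert h2 using 1
  simp only [star_add, star_mul, star_one, hy, Algebra.algebraMap_eq_smul_one, add_smul, sub_smul,
    one_smul, mul_add, add_mul, mul_smul_comm, smul_mul_assoc, mul_one, mul_assoc,
    ← Complex.coe_smul]
  abel

set_option maxHeartbeats 1000000 in
/-- An invariant element `1 + y b y` admitting an approximate factorisation `u h` with `u`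
invertible is within a controlled distance of the invariant invertible elements. -/
theorem exists_isUnit_of_approxTower
    (hD : ∀ x : D, ∀ ε : ℝ, 0 < ε → ∃ y, IsUnit y ∧ ‖x - y‖ < ε)
    {β : G → D →⋆ₐ[ℂ] D} (hβ : ∀ g h a, β (g * h) a = β g (β h a))
    {S : Set D} {b h d y X : D} {C : ℝ} {u : Dˣ} (hXb : X = 1 + y * b * y)
    (hy : star y = y) (hh : 0 ≤ h) (hβX : ∀ g, β g X = X)
    (hβy : ∀ g, β g y = y) (hβh : ∀ g, β g h = h) (hd : star d = d) (hdh : d * h = 0)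
    (hX : X ∈ S) (hhS : h ∈ S) (hyS : y ∈ S) (hdS : d ∈ S) (huS : ∀ g, β g u ∈ S)
    (hT : ∀ τ : ℝ, 0 < τ → ∃ e f m v, ApproxTower β S d y C τ e f m v)
    {ε : ℝ} (hε : (Fintype.card G : ℝ) * (Fintype.card G + 2) * ‖u * h - X‖ < ε) :
    ∃ Y, IsUnit Y ∧ (∀ g, β g Y = Y) ∧ ‖X - Y‖ < ε := by
  have hT' : ∀ k : ℕ, ∃ e f m v, ApproxTower β S d y C (1 / ((k : ℝ) + 1)) e f m v :=
    fun k => hT _ (by positivity)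
  choose e' f' m' v' hT' using hT'
  let e : G → ℕ →ᵇ D := fun g => seqOf (fun k => e' k g) 1 fun k => ((hT' k).e_proj g).norm_le
  let f : G → ℕ →ᵇ D := fun g => seqOf (fun k => f' k g) 1 fun k => ((hT' k).f_proj g).norm_le
  let m : ℕ →ᵇ D := seqOf m' C fun k => (hT' k).m_le
  let v : ℕ →ᵇ D := seqOf v' C fun k => (hT' k).v_le
  have hT2 : ∀ k : ℕ, ApproxTower β S d y C (1 / ((k : ℝ) + 1)) (fun g => e g k)
      (fun g => f g k) (m k) (v k) := hT'
  have T := twoTower_of_approxTower hβy hβh hd hdh hX hhS hyS hdS huS hT2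
  have hes : star (e 1) = e 1 := by
    ext k; exact ((hT2 k).e_proj 1).isSelfAdjoint
  have hfs : star (f 1) = f 1 := by
    ext k; exact ((hT2 k).f_proj 1).isSelfAdjoint
  have he1 : ‖e 1‖ ≤ 1 := (norm_le zero_le_one).2 fun k => ((hT' k).e_proj 1).norm_le
  have hf1 : ‖f 1‖ ≤ 1 := (norm_le zero_le_one).2 fun k => ((hT' k).f_proj 1).norm_le
  clear_value e f m v
  clear hT' hT2
  -- lifts of the tower sums
  obtain ⟨P, hPdef⟩ : ∃ P, P = orbitSum β (e 1) := ⟨_, rfl⟩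
  obtain ⟨R, hRdef⟩ : ∃ R, R = orbitSum β (f 1) := ⟨_, rfl⟩
  have hPs : star P = P := by rw [hPdef, star_orbitSum, hes]
  have hRs : star R = R := by rw [hRdef, star_orbitSum, hfs]
  have hPi : ∀ g, seqMap (β g) P = P := fun g => by rw [hPdef, seqMap_orbitSum hβ]
  have hRi : ∀ g, seqMap (β g) R = R := fun g => by rw [hRdef, seqMap_orbitSum hβ]
  have hPn : ‖1 - P‖ ≤ 1 + Fintype.card G := by
    refine (norm_sub_le _ _).trans (add_le_add (IsStarProjection.one _).norm_le ?_)
    rw [hPdef]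
    exact (norm_orbitSum_le β _).trans (mul_le_of_le_one_right (by positivity) he1)
  have hPq : seqMk D P = ∑ g, seqMk D (e g) := by
    rw [hPdef, seqMk_orbitSum]; simp only [T.map_p, mul_one]
  have hRq : seqMk D R = ∑ g, seqMk D (f g) := by
    rw [hRdef, seqMk_orbitSum]; simp only [T.map_r, mul_one]
  have hblock : ∀ a, seqMk D (orbitSum β (e 1 * const ℕ a)) =
      ∑ g, seqMk D (e g) * seqMk D (const ℕ (β g a)) := fun a => by
    rw [seqMk_orbitSum]; simp only [map_mul, T.map_p, mul_one, seqQuotMap_mk, seqMap_const]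
  have hblock' : ∀ a, seqMk D (orbitSum β (f 1 * const ℕ a)) =
      ∑ g, seqMk D (f g) * seqMk D (const ℕ (β g a)) := fun a => by
    rw [seqMk_orbitSum]; simp only [map_mul, T.map_r, mul_one, seqQuotMap_mk, seqMap_const]
  obtain ⟨V, hV⟩ : ∃ V, V = orbitSum β (e 1 * const ℕ (u : D)) +
    orbitSum β (f 1 * const ℕ (u : D)) * (1 - P) + (1 - R) * (1 - P) := ⟨_, rfl⟩
  have hVi : ∀ g, seqMap (β g) V = V := fun g => by
    simp only [hV, map_add, map_mul, map_sub, map_one, seqMap_orbitSum hβ, hPi, hRi]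
  have hVq : seqMk D V = (∑ g, seqMk D (e g) * seqMk D (const ℕ (β g u))) +
      (∑ g, seqMk D (f g) * seqMk D (const ℕ (β g u))) * (1 - ∑ g, seqMk D (e g)) +
      (1 - ∑ g, seqMk D (f g)) * (1 - ∑ g, seqMk D (e g)) := by
    simp only [hV, map_add, map_mul, map_sub, map_one, hblock, hblock', hPq, hRq]
  obtain ⟨V', hV'q⟩ := Ideal.Quotient.mkₐ_surjective ℂ (nullSeqIdeal D)
    ((∑ g, seqMk D (e g) * seqMk D (const ℕ (β g ↑u⁻¹))) +
      (∑ g, seqMk D (f g) * seqMk D (const ℕ (β g ↑u⁻¹))) * (1 - ∑ g, seqMk D (e g)) +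
      (1 - ∑ g, seqMk D (f g)) * (1 - ∑ g, seqMk D (e g)))
  have hV'V : seqMk D V' * seqMk D V = 1 := by
    rw [hVq]; erw [hV'q]; exact T.left_inverse
  obtain ⟨w, hw⟩ : ∃ w, w = orbitSum β v * (1 - P) := ⟨_, rfl⟩
  have hwi : ∀ g, seqMap (β g) w = w := fun g => by
    simp only [hw, map_mul, map_sub, map_one, seqMap_orbitSum hβ, hPi]
  have hsw : star w = (1 - P) * orbitSum β (star v) := by
    simp [hw, star_orbitSum, hPs]
  have hwq : seqMk D w = (∑ g, seqQuotMap (β g) (seqMk D v)) * (1 - ∑ g, seqMk D (e g)) := by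
    simp only [hw, map_mul, map_sub, map_one, hPq, seqMk_orbitSum]
  have hswq : seqMk D (star w) =
      (1 - ∑ g, seqMk D (e g)) * ∑ g, seqQuotMap (β g) (seqMk D (star v)) := by
    simp only [hsw, map_mul, map_sub, map_one, hPq, seqMk_orbitSum]
  obtain ⟨q, hq⟩ : ∃ q, q = (1 - R) * (1 - P) := ⟨_, rfl⟩
  have hqi : ∀ g, seqMap (β g) q = q := fun g => by
    simp only [hq, map_mul, map_sub, map_one, hPi, hRi]
  have hqq : seqMk D q = (1 - ∑ g, seqMk D (f g)) * (1 - ∑ g, seqMk D (e g)) := by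
    simp only [hq, map_mul, map_sub, map_one, hPq, hRq]
  have hsq : seqMk D (star q) = seqMk D q := by
    rw [hqq, hq, star_mul, star_sub, star_sub, star_one, hPs, hRs]
    simp only [map_mul, map_sub, map_one, hPq, hRq]
    exact (((Commute.one_left _).sub_left (Commute.sub_right (Commute.one_right _) T.P_R)).eq)
  have hqidem : seqMk D q * seqMk D q = seqMk D q := by
    rw [hqq]
    have hc : Commute (∑ g, seqMk D (f g)) (∑ g, seqMk D (e g)) := T.P_R.symm
    exact IsIdempotentElem.mul_of_commute
      ((Commute.one_left _).sub_left ((Commute.one_right _).sub_right hc))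
      (IsIdempotentElem.one_sub T.R_idem) (IsIdempotentElem.one_sub T.P_idem)
  have hqcomm : ∀ a, (∀ g, seqMk D (e g) * a = a * seqMk D (e g)) →
      (∀ g, seqMk D (f g) * a = a * seqMk D (f g)) → seqMk D q * a = a * seqMk D q := by
    intro a ha hb
    rw [hqq]
    exact ((((Commute.one_left a).sub_left (Commute.sum_left _ _ _ fun g _ => hb g))).mul_left
      ((Commute.one_left a).sub_left (Commute.sum_left _ _ _ fun g _ => ha g))).eq
  -- choice of the parameters
  obtain ⟨K, hbK, hK⟩ : ∃ K, ‖b‖ ≤ K ∧ 0 < K := ⟨‖b‖ + 1, by linarith, by positivity⟩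
  have hn : (0 : ℝ) < Fintype.card G := by exact_mod_cast Fintype.card_pos
  set n : ℝ := (Fintype.card G : ℝ) with hndef
  obtain ⟨δ, ⟨hδ0, hδ1⟩, hδ⟩ : ∃ δ : ℝ, (0 < δ ∧ δ ≤ 1) ∧
      ‖V * ((((δ ^ 2 : ℝ) : ℂ) • (1 - q)) + (δ : ℂ) • w -
        ((δ + K / n * δ : ℝ) : ℂ) • star w)‖ < ε - n * (n + 2) * ‖u * h - X‖ := by
    have hcont : Continuous fun δ : ℝ => ‖V * ((((δ ^ 2 : ℝ) : ℂ) • (1 - q)) + (δ : ℂ) • w -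
        ((δ + K / n * δ : ℝ) : ℂ) • star w)‖ := by fun_prop
    have hlim := (hcont.tendsto 0).mono_left (nhdsWithin_le_nhds (s := Set.Ioi 0))
    have hpos : 0 < ε - n * (n + 2) * ‖u * h - X‖ := by linarith
    have h1 := hlim.eventually_lt_const (u := ε - n * (n + 2) * ‖u * h - X‖) (by simpa using hpos)
    obtain ⟨δ, h2, h3⟩ := (h1.and (Ioc_mem_nhdsGT zero_lt_one)).exists
    exact ⟨δ, h3, h2⟩
  obtain ⟨s, hs⟩ : ∃ s : ℝ, s = K / (δ * n) := ⟨_, rfl⟩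
  obtain ⟨M, hM⟩ : ∃ M, M = (const ℕ h + ((δ ^ 2 : ℝ) : ℂ) • 1) * (1 - q) + q * const ℕ X +
    (δ : ℂ) • w - ((δ : ℂ) + (s : ℂ) * ((δ ^ 2 : ℝ) : ℂ)) • star w := ⟨_, rfl⟩
  have hMi : ∀ g, seqMap (β g) M = M := fun g => by
    simp only [hM, map_add, map_sub, map_mul, map_smul, map_one, map_star, hqi, hwi, seqMap_const,
      hβX, hβh]
  -- the product is bounded below
  have hlow : ∀ᶠ k in atTop, IsUnit (V k * M k) := by
    have hsK : (s : ℂ) * (δ : ℂ) * (Fintype.card G : ℂ) = (K : ℂ) := by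
      have : s * δ * n = K := by rw [hs]; field_simp
      rw [← this, hndef]; push_cast; ring
    obtain ⟨L, hL⟩ : ∃ L, L = (1 + (s : ℂ) • star w) * V' := ⟨_, rfl⟩
    obtain ⟨B, hB⟩ : ∃ B, B = (δ : ℂ) • (w - star w) := ⟨_, rfl⟩
    have hBs : star B = -B := by
      rw [hB, star_smul, star_sub, star_star, ← smul_neg, neg_sub]
      simp
    obtain ⟨t, ht⟩ : ∃ t : ℝ, t = δ ^ 2 := ⟨_, rfl⟩
    have ht0 : 0 < t := by rw [ht]; positivity
    have ht1 : t ≤ 1 := by rw [ht]; exact pow_le_one₀ hδ0.le hδ1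
    rw [← ht] at hM
    have hNq : seqMk D (L * (V * M)) = seqMk D ((const ℕ h + (t : ℂ) • 1) * (1 - q) +
        q * (const ℕ X + (K : ℂ) • (const ℕ y * const ℕ y)) + B) := by
      have hc := T.corner_identity (δ : ℂ) (t : ℂ) (s : ℂ)
      rw [← hqq, ← hwq, ← hswq, hsK] at hc
      have h1 : seqMk D (L * (V * M)) = (1 + (s : ℂ) • seqMk D (star w)) * seqMk D M := by
        rw [hL, map_mul, map_mul, map_mul, mul_assoc, ← mul_assoc (seqMk D V'), hV'V, one_mul,
          map_add, map_smul, map_one]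
      rw [h1, hM, hB]
      simpa only [map_add, map_sub, map_mul, map_smul, map_one] using hc
    have hNsq := seqMk_star_congr hNq
    have hstar : star ((const ℕ h + (t : ℂ) • 1) * (1 - q) +
        q * (const ℕ X + (K : ℂ) • (const ℕ y * const ℕ y)) + B) =
        (1 - star q) * (const ℕ h + (t : ℂ) • 1) +
        (const ℕ (star X) + (K : ℂ) • (const ℕ y * const ℕ y)) * star q - B := by
      have e1 : star (const ℕ h) = const ℕ h := by ext; exact (IsSelfAdjoint.of_nonneg hh)
      have e2 : star (const ℕ y) = const ℕ y := by ext; exact hy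
      have e3 : star (const ℕ X) = const ℕ (star X) := rfl
      simp only [star_add, star_mul, star_one, star_smul, hBs, e1, e2, e3,
        RCLike.star_def, Complex.conj_ofReal, sub_eq_add_neg, star_neg]
    rw [hstar] at hNsq
    have hqX := hqcomm _ T.p_X T.r_X
    have hqX' : seqMk D q * seqMk D (const ℕ (star X)) =
        seqMk D (const ℕ (star X)) * seqMk D q := by
      have := seqMk_star_congr (((map_mul (seqMk D) _ _).trans hqX).trans
        (map_mul (seqMk D) _ _).symm)
      rw [star_mul, star_mul, map_mul, map_mul, hsq] at this
      exact this.symm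
    have hqy := hqcomm _ T.p_y T.r_y
    have hqz : seqMk D q * ((K : ℂ) • (seqMk D (const ℕ y) * seqMk D (const ℕ y))) =
        ((K : ℂ) • (seqMk D (const ℕ y) * seqMk D (const ℕ y))) * seqMk D q := by
      rw [mul_smul_comm, smul_mul_assoc, ← mul_assoc, hqy, mul_assoc, hqy, mul_assoc]
    have hre := block_realPart_identity (B := seqMk D B) (t : ℂ) hqidem (hqcomm _ T.p_h T.r_h)
      hqX hqX' hqz
    obtain ⟨Z, hZ⟩ : ∃ Z, Z = star (1 - q) * (const ℕ h + const ℕ h) * (1 - q) +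
      star q * (const ℕ X + const ℕ (star X) + ((K : ℂ) • (const ℕ y * const ℕ y) +
        (K : ℂ) • (const ℕ y * const ℕ y)) - ((t : ℂ) • 1 + (t : ℂ) • 1)) * q := ⟨_, rfl⟩
    have hZ0 : ∀ k, 0 ≤ Z k := fun k => by
      rw [hZ]
      refine add_nonneg (star_left_conjugate_nonneg (add_nonneg hh hh) ((1 - q) k))
        (star_left_conjugate_nonneg ?_ (q k))
      have := one_add_conjugate_realPart_nonneg (b := b) hy hbK ht1
      rwa [← hXb] at this
    have hNN : seqMk D (L * (V * M) + star (L * (V * M))) =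
        seqMk D (Z + ((t : ℂ) • 1 + (t : ℂ) • 1)) := by
      rw [map_add, hNq, hNsq, hZ]
      simp only [star_sub, star_one, map_add, map_sub, map_mul, map_smul, map_one, hsq]
      exact hre
    filter_upwards [eventually_norm_sub_lt_of_seqMk_eq hNN ht0] with k hk
    refine isUnit_of_mul_boundedBelow hD (c := t / 2 / (‖L‖ + 1)) (by positivity) fun a => ?_
    have h1 : t / 2 * ‖a‖ ≤ ‖L k * (V k * M k) * a‖ := by
      refine boundedBelow_of_realPart ht0.le (hZ0 k) (le_of_eq_of_le ?_ hk.le) a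
      congr 1
      have e1 : (Z + ((t : ℂ) • (1 : ℕ →ᵇ D) + (t : ℂ) • 1)) k =
        Z k + ((t : ℂ) • 1 + (t : ℂ) • 1) := rfl
      rw [e1]
      push_cast
      rw [two_mul, add_smul]
      simp only [coe_add, coe_mul, Pi.add_apply, Pi.mul_apply, coe_star, Pi.star_apply]
      abel
    have h2 : ‖L k * (V k * M k) * a‖ ≤ (‖L‖ + 1) * ‖V k * M k * a‖ := by
      rw [mul_assoc]
      refine (norm_mul_le _ _).trans ?_
      gcongr
      exact (L.norm_coe_le_norm k).trans (by linarith)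
    rw [div_mul_eq_mul_div, div_le_iff₀ (by positivity), mul_comm _ (‖L‖ + 1)]
    exact h1.trans h2
  -- and close to `X`
  have hclose : ∀ᶠ k in atTop, ‖X - V k * M k‖ < ε := by
    obtain ⟨E, hE⟩ : ∃ E, E = orbitSum β (e 1 * const ℕ (u * h - X)) +
      orbitSum β (f 1 * const ℕ (u * h - X)) * (1 - P) := ⟨_, rfl⟩
    obtain ⟨J, hJ⟩ : ∃ J, J = V * ((((δ ^ 2 : ℝ) : ℂ) • (1 - q)) + (δ : ℂ) • w -
        ((δ + K / n * δ : ℝ) : ℂ) • star w) := ⟨_, rfl⟩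
    rw [← hJ] at hδ
    have hcoef : (δ : ℂ) + (s : ℂ) * ((δ ^ 2 : ℝ) : ℂ) = ((δ + K / n * δ : ℝ) : ℂ) := by
      have : s * δ ^ 2 = K / n * δ := by rw [hs]; field_simp
      rw [← this]; push_cast; ring
    have hq1 : seqMk D (V * M) = seqMk D (const ℕ X + E + J) := by
      have herr := T.error_identity
      rw [← hVq, ← hqq] at herr
      have hVM : V * M = V * (const ℕ h * (1 - q) + q * const ℕ X) + J := by
        rw [hJ, ← mul_add, hM, hcoef, add_mul (const ℕ h), smul_mul_assoc, one_mul]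
        congr 1
        abel
      have hEq : seqMk D E =
          (∑ g, seqMk D (e g) * (seqMk D (const ℕ (β g u)) * seqMk D (const ℕ h) -
            seqMk D (const ℕ X))) +
          (∑ g, seqMk D (f g) * (seqMk D (const ℕ (β g u)) * seqMk D (const ℕ h) -
            seqMk D (const ℕ X))) * (1 - ∑ g, seqMk D (e g)) := by
        have h1 : ∀ g, seqMk D (const ℕ (β g (u * h - X))) =
            seqMk D (const ℕ (β g u)) * seqMk D (const ℕ h) - seqMk D (const ℕ X) := fun g => by
          rw [map_sub, map_mul, hβh, hβX]; rfl
        simp only [hE, map_add, map_mul (seqMk D), map_sub (seqMk D), map_one, hblock, hblock',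
          hPq, h1]
      rw [hVM, map_add, map_add _ _ J, map_add _ _ E, hEq, ← add_assoc, ← herr]
      simp only [map_add, map_sub, map_mul, map_one]
    have hEn : ‖E‖ ≤ n * (n + 2) * ‖u * h - X‖ := by
      have hx : ‖(const ℕ (u * h - X) : ℕ →ᵇ D)‖ ≤ ‖u * h - X‖ := norm_const_le _
      have h1 : ∀ p : ℕ →ᵇ D, ‖p‖ ≤ 1 →
          ‖orbitSum β (p * const ℕ (u * h - X))‖ ≤ n * ‖u * h - X‖ := fun p hp => by
        refine (norm_orbitSum_le β _).trans ?_
        gcongr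
        exact (norm_mul_le _ _).trans ((mul_le_of_le_one_left (norm_nonneg _) hp).trans hx)
      calc ‖E‖ ≤ n * ‖u * h - X‖ + n * ‖u * h - X‖ * (1 + n) := by
            rw [hE]
            refine (norm_add_le _ _).trans (add_le_add (h1 _ he1) ?_)
            exact (norm_mul_le _ _).trans (mul_le_mul (h1 _ hf1) hPn (norm_nonneg _)
              (by positivity))
        _ = n * (n + 2) * ‖u * h - X‖ := by ring
    filter_upwards [eventually_norm_sub_lt_of_seqMk_eq hq1 (sub_pos.2 hδ)] with k hk
    have e1 : X - V k * M k = -(((V * M) k - (const ℕ X + E + J) k) + (E k + J k)) := by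
      simp only [coe_add, coe_mul, Pi.add_apply, Pi.mul_apply, const_apply]
      abel
    rw [e1, norm_neg]
    have h1 := norm_add_le ((V * M) k - (const ℕ X + E + J) k) (E k + J k)
    have h2 := norm_add_le (E k) (J k)
    have h3 := E.norm_coe_le_norm k
    have h4 := J.norm_coe_le_norm k
    linarith
  obtain ⟨k, hk1, hk2⟩ := (hlow.and hclose).exists
  refine ⟨V k * M k, hk1, fun g => ?_, hk2⟩
  have h1 := DFunLike.congr_fun (hVi g) k
  have h2 := DFunLike.congr_fun (hMi g) k
  rw [seqMap_apply] at h1 h2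
  rw [map_mul, h1, h2]

end Perturbation

section TracialRokhlin

variable {A : Type*} [NonUnitalCStarAlgebra A]

theorem IsProjection.isStarProjection {p : A} (h : IsProjection p) : IsStarProjection p :=
  ⟨h.2, h.1⟩

theorem isStarProjection_sum {R ι : Type*} [NonUnitalRing R] [StarRing R] [Fintype ι] {p : ι → R}
    (hp : ∀ i, IsStarProjection (p i)) (ho : ∀ i j, i ≠ j → p i * p j = 0) :
    IsStarProjection (∑ i, p i) := by
  classical
  refine ⟨?_, ?_⟩
  · rw [IsIdempotentElem, Finset.sum_mul_sum]
    refine Finset.sum_congr rfl fun i _ => ?_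
    rw [Finset.sum_eq_single i (fun j _ hj => ho i j hj.symm) (by simp)]
    exact (hp i).isIdempotentElem
  · rw [IsSelfAdjoint, star_sum]
    exact Finset.sum_congr rfl fun i _ => (hp i).isSelfAdjoint

variable [PartialOrder A] [StarOrderedRing A]

/-- A positive element of norm larger than `θ` is bounded below on a nontrivial part. -/
theorem exists_local_inverse {x : A} (hx : 0 ≤ x) {θ : ℝ} (hθ : 0 < θ) (hxθ : θ < ‖x‖) :
    ∃ m z : A, ‖m‖ ≤ θ⁻¹ ∧ star z = z ∧ ‖z‖ = 1 ∧ x * m * z = z := by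
  have hsa := IsSelfAdjoint.of_nonneg hx
  set z : A := cfcₙ (fun t : ℝ => max (t - θ) 0) x with hz
  have hc1 : Continuous fun t : ℝ => max (t - θ) 0 := by fun_prop
  have hc2 : Continuous fun t : ℝ => t / max t θ ^ 2 :=
    continuous_id.div (by fun_prop) fun t => (by positivity)
  have h01 : max ((0 : ℝ) - θ) 0 = 0 := by simp [hθ.le]
  have hzs : star z = z := (cfcₙ_predicate (p := IsSelfAdjoint) _ x)
  have hz0 : z ≠ 0 := by
    intro h0
    have h1 : x = cfcₙ (fun t : ℝ => min t θ) x := by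
      conv_lhs => rw [← cfcₙ_id' ℝ x, ← sub_zero (cfcₙ _ x), ← h0, hz]
      rw [← cfcₙ_sub _ _ x (by fun_prop) (by simp) hc1.continuousOn h01]
      refine cfcₙ_congr fun t _ => ?_
      rcases le_total t θ with h | h <;> simp [h]
    have h2 : ‖x‖ ≤ θ := by
      rw [h1]
      refine norm_cfcₙ_le fun t ht => ?_
      have ht0 := quasispectrum_nonneg_of_nonneg x hx t ht
      rw [Real.norm_of_nonneg (le_min ht0 hθ.le)]
      exact min_le_right _ _
    linarith
  have hzn : 0 < ‖z‖ := norm_pos_iff.2 hz0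
  refine ⟨cfcₙ (fun t : ℝ => t / max t θ ^ 2) x, (‖z‖⁻¹ : ℂ) • z, ?_, ?_, ?_, ?_⟩
  · refine norm_cfcₙ_le fun t ht => ?_
    have ht0 := quasispectrum_nonneg_of_nonneg x hx t ht
    have hm : 0 < max t θ := lt_max_of_lt_right hθ
    rw [Real.norm_of_nonneg (by positivity), div_le_iff₀ (by positivity), pow_two, ← mul_assoc]
    have h1 : 1 ≤ θ⁻¹ * max t θ := by
      rw [inv_mul_eq_div, one_le_div hθ]; exact le_max_right _ _
    calc t ≤ 1 * max t θ := by rw [one_mul]; exact le_max_left _ _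
      _ ≤ _ := by gcongr
  · rw [star_smul, hzs]; simp
  · rw [norm_smul]; simp [hzn.ne']
  · rw [mul_smul_comm]
    congr 1
    conv_lhs => enter [1, 1]; rw [← cfcₙ_id' ℝ x]
    rw [hz, ← cfcₙ_mul _ _ x (by fun_prop) (by simp) hc2.continuousOn (by simp),
      ← cfcₙ_mul _ _ x (by fun_prop) (by simp) hc1.continuousOn h01]
    refine cfcₙ_congr fun t _ => ?_
    rcases le_total t θ with h | h
    · simp [h]
    · have : t ≠ 0 := (hθ.trans_le h).ne'
      simp only [max_eq_left h]
      field_simp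

theorem norm_cutPos_sub_le {c : A} (hc : 0 ≤ c) {ε : ℝ} (hε : 0 ≤ ε) : ‖cutPos c ε - c‖ ≤ ε := by
  have hsa := IsSelfAdjoint.of_nonneg hc
  have h0 : max ((0 : ℝ) - ε) 0 = 0 := by simp [hε]
  have h1 : cutPos c ε - c = cfcₙ (fun t : ℝ => max (t - ε) 0 - t) c := by
    conv_lhs => enter [2]; rw [← cfcₙ_id' ℝ c]
    rw [cutPos, ← cfcₙ_sub (fun t : ℝ => max (t - ε) 0) _ c (by fun_prop) h0]
  rw [h1]
  refine norm_cfcₙ_le fun t ht => ?_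
  have ht0 := quasispectrum_nonneg_of_nonneg c hc t ht
  rw [Real.norm_eq_abs, abs_le]
  rcases le_total t ε with h | h
  · rw [max_eq_right (by linarith)]; constructor <;> linarith
  · rw [max_eq_left (by linarith)]; constructor <;> linarith

variable {G : Type*} [Group G] [Fintype G] {α : G → A ≃⋆ₐ[ℂ] A}

/-- Under the tracial Rokhlin property, the first projection of a tower can be chosen to have a
norm-controlled intersection with a given invariant element. -/
theorem TracialRokhlinProperty.exists_tower (hTRP : TracialRokhlinProperty α) (F : Finset A)
    {d : A} (hd : star d = d) (hd1 : ‖d‖ = 1) (hαd : ∀ g, α g d = d) {τ : ℝ} (hτ : 0 < τ) :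
    ∃ e : G → A, (∀ g, IsStarProjection (e g)) ∧ (∀ g h, g ≠ h → e g * e h = 0) ∧
      (∀ a ∈ F, ∀ g, ‖e g * a - a * e g‖ ≤ τ) ∧ (∀ g h, ‖α g (e h) - e (g * h)‖ ≤ τ) ∧
      1 / (4 * (Fintype.card G : ℝ) ^ 2) ≤ ‖d * e 1 * d‖ := by
  set n : ℝ := (Fintype.card G : ℝ) with hn
  have hn1 : 1 ≤ n := by
    have : 1 ≤ Fintype.card G := Fintype.card_pos
    rw [hn]
    exact_mod_cast this
  obtain ⟨ε, hε0, hε1, hε2⟩ : ∃ ε : ℝ, 0 < ε ∧ ε ≤ τ ∧ (n + 1) * ε ≤ 1 / 2 := by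
    refine ⟨min τ (1 / (2 * (n + 1))), by positivity, min_le_left _ _, ?_⟩
    calc (n + 1) * min τ (1 / (2 * (n + 1))) ≤ (n + 1) * (1 / (2 * (n + 1))) := by
          gcongr; exact min_le_right _ _
      _ = 1 / 2 := by field_simp
  have hdd : ‖d * d‖ = 1 := by
    conv_lhs => enter [1, 1]; rw [← hd]
    rw [CStarRing.norm_star_mul_self, hd1, one_mul]
  obtain ⟨e, h1, h2, h3, h4, -, h6⟩ := hTRP F ε hε0 (d * d) 0
    (by conv_rhs => enter [1]; rw [← hd]
        exact star_mul_self_nonneg d) le_rfl hdd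
  have hp := fun g => (h1 g).isStarProjection
  refine ⟨e, hp, h2, fun a ha g => (h3 a ha g).le.trans hε1,
    fun g h => (h4 g h).le.trans hε1, ?_⟩
  have hP : ‖∑ g, e g‖ ≤ 1 := (isStarProjection_sum hp h2).norm_le
  have h7 : ∀ g, ‖e g * d‖ ≤ ‖e 1 * d‖ + ε := fun g => by
    have h8 : ‖α g (e 1) * d‖ = ‖e 1 * d‖ := by
      conv_lhs => rw [← hαd g, ← map_mul]
      exact NonUnitalStarAlgHom.norm_map (α g) (α g).injective _
    have h9 : ‖(α g (e 1) - e g) * d‖ ≤ ε := by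
      refine (norm_mul_le _ _).trans ?_
      rw [hd1, mul_one]
      simpa using (h4 g 1).le
    calc ‖e g * d‖ = ‖α g (e 1) * d - (α g (e 1) - e g) * d‖ := by
          rw [sub_mul, sub_sub_cancel]
      _ ≤ _ := (norm_sub_le _ _).trans (by rw [h8]; gcongr)
  have h8 : ‖(∑ g, e g) * (d * d) * ∑ g, e g‖ ≤ n * (‖e 1 * d‖ + ε) := calc
    _ = ‖((∑ g, e g) * d) * (d * ∑ g, e g)‖ := by simp only [mul_assoc]
    _ ≤ ‖(∑ g, e g) * d‖ * (‖d‖ * ‖∑ g, e g‖) :=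
      (norm_mul_le _ _).trans (by gcongr; exact norm_mul_le _ _)
    _ ≤ ‖(∑ g, e g) * d‖ * (1 * 1) := by rw [hd1]; gcongr
    _ ≤ ∑ g, ‖e g * d‖ := by rw [one_mul, mul_one, Finset.sum_mul]; exact norm_sum_le _ _
    _ ≤ ∑ _g : G, (‖e 1 * d‖ + ε) := Finset.sum_le_sum fun g _ => h7 g
    _ = n * (‖e 1 * d‖ + ε) := by simp [hn, mul_add]
  have h9 : 1 / (2 * n) ≤ ‖e 1 * d‖ := by
    rw [div_le_iff₀ (by positivity)]
    linarith
  have h10 : d * e 1 * d = star (e 1 * d) * (e 1 * d) := by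
    rw [star_mul, hd, (hp 1).isSelfAdjoint, mul_assoc, mul_assoc, ← mul_assoc (e 1),
      (hp 1).isIdempotentElem]
  rw [h10, CStarRing.norm_star_mul_self]
  calc 1 / (4 * n ^ 2) = 1 / (2 * n) * (1 / (2 * n)) := by field_simp; norm_num
    _ ≤ _ := by gcongr

theorem TracialRokhlinProperty.exists_double_tower (hTRP : TracialRokhlinProperty α)
    (F : Finset A) {d y : A} (hd : star d = d) (hd1 : ‖d‖ = 1) (hαd : ∀ g, α g d = d)
    (hy : 0 ≤ y) : ∃ C : ℝ, ∀ τ : ℝ, 0 < τ → ∃ (e f : G → A) (m v : A),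
      (∀ g, IsStarProjection (e g)) ∧ (∀ g, IsStarProjection (f g)) ∧
      (∀ g h, g ≠ h → e g * e h = 0) ∧ (∀ g h, g ≠ h → f g * f h = 0) ∧
      (∀ g h, ‖α g (e h) - e (g * h)‖ ≤ τ) ∧ (∀ g h, ‖α g (f h) - f (g * h)‖ ≤ τ) ∧
      (∀ g, ∀ a ∈ F, ‖e g * a - a * e g‖ ≤ τ) ∧ (∀ g, ∀ a ∈ F, ‖f g * a - a * f g‖ ≤ τ) ∧
      (∀ g h, ‖e g * f h - f h * e g‖ ≤ τ) ∧ ‖m‖ ≤ C ∧ ‖v‖ ≤ C ∧ v = d * e 1 * d * m * v ∧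
      ‖star v * v - (y * y - y * (∑ g, f g) * y)‖ ≤ τ := by
  classical
  set n : ℝ := (Fintype.card G : ℝ) with hn
  have hn1 : 1 ≤ n := by
    have : 1 ≤ Fintype.card G := Fintype.card_pos
    rw [hn]
    exact_mod_cast this
  have hys : star y = y := IsSelfAdjoint.of_nonneg hy
  refine ⟨max ((1 / (8 * n ^ 2))⁻¹) (1 + 2 * ‖y‖ ^ 2), fun τ hτ => ?_⟩
  obtain ⟨e, he1, he2, he3, he4, he5⟩ := hTRP.exists_tower F hd hd1 hαd hτ
  have hx0 : 0 ≤ d * e 1 * d := by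
    have := star_left_conjugate_nonneg (he1 1).nonneg d
    rwa [hd] at this
  obtain ⟨m, z, hm, hzs, hz1, hxmz⟩ := exists_local_inverse hx0 (θ := 1 / (8 * n ^ 2))
    (by positivity) (lt_of_lt_of_le (by gcongr; norm_num) he5)
  have hzz : ‖z * z‖ = 1 := by
    conv_lhs => enter [1, 1]; rw [← hzs]
    rw [CStarRing.norm_star_mul_self, hz1, one_mul]
  obtain ⟨ε, hε0, hε1, hε2⟩ : ∃ ε : ℝ, 0 < ε ∧ 2 * ε ≤ τ ∧ 2 * ε ≤ 1 :=
    ⟨min τ 1 / 2, by positivity, by linarith [min_le_left τ 1], by linarith [min_le_right τ 1]⟩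
  obtain ⟨f, hf1, hf2, hf3, hf4, ⟨v₀, hv₀⟩, -⟩ := hTRP (F ∪ Finset.univ.image e) ε hε0 (z * z) y
    (by conv_rhs => enter [1]; rw [← hzs]
        exact star_mul_self_nonneg z) hy hzz
  obtain ⟨k, hk⟩ := (hv₀.eventually_lt_const hε0).exists
  have hfp := fun g => (hf1 g).isStarProjection
  have hR := isStarProjection_sum hfp hf2
  set R := ∑ g, f g with hRdef
  have hετ : ε ≤ τ := by linarith
  have hc : 0 ≤ y * y - y * R * y := by
    have h1 : star (y - R * y) * (y - R * y) = y * y - y * R * y := by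
      rw [star_sub, star_mul, hys, hR.isSelfAdjoint, sub_mul, mul_sub, mul_sub, mul_assoc,
        mul_assoc, ← mul_assoc R R, hR.isIdempotentElem.eq]
      abel
    rw [← h1]
    exact star_mul_self_nonneg _
  have hvv : ‖star (z * star (v₀ k)) * (z * star (v₀ k)) - (y * y - y * R * y)‖ ≤ 2 * ε := by
    have h1 : star (z * star (v₀ k)) * (z * star (v₀ k)) = v₀ k * (z * z) * star (v₀ k) := by
      rw [star_mul, star_star, hzs]; simp only [mul_assoc]
    have h2 := norm_cutPos_sub_le hc hε0.le
    rw [h1]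
    calc _ = ‖(cutPos (y * y - y * R * y) ε - (y * y - y * R * y)) -
          (cutPos (y * y - y * R * y) ε - v₀ k * (z * z) * star (v₀ k))‖ := by congr 1; abel
      _ ≤ ε + ε := (norm_sub_le _ _).trans (add_le_add h2 hk.le)
      _ = 2 * ε := by ring
  refine ⟨e, f, m, z * star (v₀ k), he1, hfp, he2, hf2, he4, fun g h => (hf4 g h).le.trans hετ,
    fun g a ha => he3 a ha g,
    fun g a ha => (hf3 a (Finset.mem_union_left _ ha) g).le.trans hετ, fun g h => ?_,
    hm.trans (le_max_left _ _), le_trans ?_ (le_max_right _ _), ?_, hvv.trans hε1⟩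
  · rw [← norm_neg, neg_sub]
    exact (hf3 (e g) (Finset.mem_union_right _ (by simp)) h).le.trans hετ
  · have h1 : ‖z * star (v₀ k)‖ * ‖z * star (v₀ k)‖ ≤ 1 + 2 * ‖y‖ ^ 2 := by
      rw [← CStarRing.norm_star_mul_self]
      have h2 : ‖y * y - y * R * y‖ ≤ 2 * ‖y‖ ^ 2 := by
        have h3 : ‖y * R * y‖ ≤ ‖y‖ * 1 * ‖y‖ :=
          (norm_mul_le _ _).trans (by
            gcongr; exact (norm_mul_le _ _).trans (by gcongr; exact hR.norm_le))
        have := norm_sub_le (y * y) (y * R * y)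
        have := norm_mul_le y y
        nlinarith
      have h3 := norm_le_norm_add_norm_sub' (star (z * star (v₀ k)) * (z * star (v₀ k)))
        (y * y - y * R * y)
      linarith
    nlinarith [sq_nonneg ‖y‖, norm_nonneg (z * star (v₀ k))]
  · conv_lhs => rw [← hxmz]
    simp only [mul_assoc]

end TracialRokhlin

section Factor

variable {D : Type*} [CStarAlgebra D] [PartialOrder D] [StarOrderedRing D]

/-- A noninvertible element `X` of an algebra with dense invertibles is approximately `u h` with `u`
invertible and `h ≥ 0` annihilated by an element `d` of norm one. -/
theorem exists_approx_factor (hD : ∀ x : D, ∀ ε : ℝ, 0 < ε → ∃ y, IsUnit y ∧ ‖x - y‖ < ε)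
    {X : D} (hX : ¬ IsUnit X) {φ : D →⋆ₐ[ℂ] ℂ} (hφ : φ X = 1) {ε : ℝ} (hε : 0 < ε) :
    ∃ (h d : D) (u : Dˣ), 0 ≤ h ∧ star d = d ∧ ‖d‖ = 1 ∧ d * h = 0 ∧ φ d = 0 ∧
      ‖u * h - X‖ < ε ∧ ∀ ψ : D →⋆ₐ[ℂ] D, ψ X = X → ψ h = h ∧ ψ d = d := by
  have : Nontrivial D := RingHom.domain_nontrivial (φ : D →+* ℂ)
  obtain ⟨η, hη0, hη1, hηε⟩ : ∃ η : ℝ, 0 < η ∧ η ≤ 1 ∧ η ≤ (ε / 2) ^ 2 :=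
    ⟨min 1 ((ε / 2) ^ 2), by positivity, min_le_left _ _, min_le_right _ _⟩
  obtain ⟨c, hc⟩ : ∃ c, c = star X * X := ⟨_, rfl⟩
  have hc0 : 0 ≤ c := hc ▸ star_mul_self_nonneg X
  have hcs : IsSelfAdjoint c := IsSelfAdjoint.of_nonneg hc0
  have hspec : ∀ t ∈ spectrum ℝ c, 0 ≤ t := fun t ht => spectrum_nonneg_of_nonneg hc0 ht
  have h0 : (0 : ℝ) ∈ spectrum ℝ c := by
    rw [spectrum.zero_mem_iff]
    rintro ⟨w, hw⟩
    refine hX (isUnit_of_mul_boundedBelow hD (c := (‖(↑w⁻¹ : D) * star X‖ + 1)⁻¹)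
      (by positivity) fun a => ?_)
    rw [inv_mul_le_iff₀ (by positivity)]
    calc ‖a‖ = ‖(↑w⁻¹ : D) * star X * (X * a)‖ := by
          rw [mul_assoc, ← mul_assoc (star X), ← hc, ← hw, Units.inv_mul_cancel_left]
      _ ≤ ‖(↑w⁻¹ : D) * star X‖ * ‖X * a‖ := norm_mul_le _ _
      _ ≤ _ := by gcongr; linarith
  have hcont : Continuous fun t : ℝ => (max t η)⁻¹ :=
    Continuous.inv₀ (by fun_prop) fun t => (lt_max_of_lt_right hη0).ne'
  have hcont' : Continuous fun t : ℝ => (max t η)⁻¹ * max (t - η) 0 := hcont.mul (by fun_prop)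
  obtain ⟨h, hh⟩ : ∃ h, h = cfc (fun t : ℝ => max (t - η) 0) c := ⟨_, rfl⟩
  obtain ⟨d, hd⟩ : ∃ d, d = cfc (fun t : ℝ => max (1 - t / η) 0) c := ⟨_, rfl⟩
  obtain ⟨k, hk⟩ : ∃ k, k = cfc (fun t : ℝ => (max t η)⁻¹) c := ⟨_, rfl⟩
  have hku : IsUnit k := by
    have hm : ∀ t : ℝ, max t η ≠ 0 := fun t => (lt_max_of_lt_right hη0).ne'
    refine ⟨⟨k, cfc (fun t : ℝ => max t η) c, ?_, ?_⟩, rfl⟩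
    · rw [hk, ← cfc_mul _ _ c hcont.continuousOn (by fun_prop)]
      simp only [inv_mul_cancel₀ (hm _)]
      exact cfc_const_one ℝ c
    · rw [hk, ← cfc_mul _ _ c (by fun_prop) hcont.continuousOn]
      simp only [mul_inv_cancel₀ (hm _)]
      exact cfc_const_one ℝ c
  have hds : star d = d := by rw [hd]; exact cfc_predicate (p := IsSelfAdjoint) _ c
  have hkh : k * h = cfc (fun t : ℝ => (max t η)⁻¹ * max (t - η) 0) c := by
    rw [hk, hh, ← cfc_mul _ _ c hcont.continuousOn (by fun_prop)]
  have hkhn : ‖k * h‖ ≤ 1 := by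
    rw [hkh]
    refine norm_cfc_le zero_le_one fun t ht => ?_
    have hm : 0 < max t η := lt_max_of_lt_right hη0
    rw [Real.norm_of_nonneg (by positivity), inv_mul_le_iff₀ hm, mul_one]
    exact max_le_max (by linarith) hη0.le
  have herr : ‖X * (1 - k * h)‖ ≤ ε / 2 := by
    have h1 : 1 - k * h = cfc (fun t : ℝ => 1 - (max t η)⁻¹ * max (t - η) 0) c := by
      rw [hkh, cfc_sub (fun _ : ℝ => (1 : ℝ)) _ c continuousOn_const hcont'.continuousOn,
        cfc_const_one ℝ c]
    have hs : star (1 - k * h) = 1 - k * h := by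
      rw [h1]; exact cfc_predicate (p := IsSelfAdjoint) _ c
    have h2 : star (X * (1 - k * h)) * (X * (1 - k * h)) =
        cfc (fun t : ℝ => (1 - (max t η)⁻¹ * max (t - η) 0) * t *
          (1 - (max t η)⁻¹ * max (t - η) 0)) c := by
      have hg : Continuous fun t : ℝ => 1 - (max t η)⁻¹ * max (t - η) 0 :=
        continuous_const.sub hcont'
      have hgt : Continuous fun t : ℝ => (1 - (max t η)⁻¹ * max (t - η) 0) * t :=
        hg.mul continuous_id
      rw [cfc_mul _ _ c hgt.continuousOn hg.continuousOn,
        cfc_mul _ (fun t => t) c hg.continuousOn continuousOn_id, cfc_id' ℝ c, ← h1, star_mul, hs,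
        hc]
      simp only [mul_assoc]
    have h3 : ‖X * (1 - k * h)‖ * ‖X * (1 - k * h)‖ ≤ η := by
      rw [← CStarRing.norm_star_mul_self, h2]
      refine norm_cfc_le hη0.le fun t ht => ?_
      have ht0 := hspec t ht
      rw [mul_right_comm, Real.norm_of_nonneg (mul_nonneg (mul_self_nonneg _) ht0)]
      rcases le_total t η with h | h
      · simp [h]
      · have htp : 0 < t := hη0.trans_le h
        rw [max_eq_left h, max_eq_left (by linarith)]
        have : (1 - t⁻¹ * (t - η)) * (1 - t⁻¹ * (t - η)) * t = η * (η / t) := by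
          field_simp; ring
        rw [this]
        exact mul_le_of_le_one_right hη0.le ((div_le_one htp).2 h)
    nlinarith [norm_nonneg (X * (1 - k * h))]
  obtain ⟨z, hz, hzX⟩ := hD X (ε / 2) (by positivity)
  obtain ⟨u, hu⟩ := hz.mul hku
  refine ⟨h, d, u, ?_, hds, ?_, ?_, ?_, ?_, fun ψ hψ => ?_⟩
  · rw [hh]; exact cfc_nonneg fun t _ => le_max_right _ _
  · refine le_antisymm ?_ ?_
    · rw [hd]
      refine norm_cfc_le zero_le_one fun t ht => ?_
      rw [Real.norm_of_nonneg (le_max_right _ _)]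
      have : 0 ≤ t / η := div_nonneg (hspec t ht) hη0.le
      exact max_le (by linarith) zero_le_one
    · rw [hd]
      refine le_of_eq_of_le ?_ (norm_apply_le_norm_cfc (fun t : ℝ => max (1 - t / η) 0) c h0)
      simp
  · rw [hd, hh, ← cfc_mul _ _ c (by fun_prop) (by fun_prop), ← cfc_zero ℝ c]
    refine cfc_congr fun t _ => ?_
    rcases le_total t η with h | h
    · simp [h]
    · have : 1 ≤ t / η := (one_le_div hη0).2 h
      simp [this]
  · have h1 : φ c = 1 := by rw [hc, map_mul, map_star, hφ]; simp
    rw [hd, StarAlgHomClass.map_cfc φ _ c (by fun_prop) (hφa := hcs.map φ), h1, cfc_apply_one]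
    have : 1 ≤ 1 / η := (one_le_div hη0).2 hη1
    simp only [max_eq_right (sub_nonpos.2 this), map_zero]
  · rw [hu]
    calc ‖z * k * h - X‖ = ‖-((X - z) * (k * h)) - X * (1 - k * h)‖ := by
          congr 1; noncomm_ring
      _ ≤ ‖X - z‖ * 1 + ε / 2 := by
          refine (norm_sub_le _ _).trans (add_le_add ?_ herr)
          rw [norm_neg]
          exact (norm_mul_le _ _).trans (by gcongr)
      _ < ε := by linarith
  · have h1 : ψ c = c := by rw [hc, map_mul, map_star, hψ]
    constructor
    · rw [hh, StarAlgHomClass.map_cfc ψ _ c (by fun_prop) (hφa := hcs.map ψ), h1]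
    · rw [hd, StarAlgHomClass.map_cfc ψ _ c (by fun_prop) (hφa := hcs.map ψ), h1]

end Factor

section Extension

variable {A : Type*} [NonUnitalCStarAlgebra A]

/-- The extension of a *-automorphism to the minimal unitization. -/
noncomputable def unitizationMap (φ : A ≃⋆ₐ[ℂ] A) : Unitization ℂ A →⋆ₐ[ℂ] Unitization ℂ A :=
  Unitization.starMap (NonUnitalStarAlgHomClass.toNonUnitalStarAlgHom φ)

@[simp]
theorem unitizationMap_inr (φ : A ≃⋆ₐ[ℂ] A) (a : A) :
    unitizationMap φ (a : Unitization ℂ A) = (φ a : A) :=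
  Unitization.starMap_inr _ a

theorem unitizationMap_snd (φ : A ≃⋆ₐ[ℂ] A) (x : Unitization ℂ A) :
    (unitizationMap φ x).snd = φ x.snd := by
  induction x using Unitization.ind with
  | inl_add_inr r a => simp [unitizationMap, Unitization.algebraMap_eq_inl]

theorem unitizationMap_mul {G : Type*} [Group G] {α : G → A ≃⋆ₐ[ℂ] A}
    (hα : ∀ g h : G, ∀ a : A, α (g * h) a = α g (α h a)) (g h : G) (x : Unitization ℂ A) :
    unitizationMap (α (g * h)) x = unitizationMap (α g) (unitizationMap (α h) x) := by
  induction x using Unitization.ind with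
  | inl_add_inr r a => simp [unitizationMap, Unitization.algebraMap_eq_inl, hα]

theorem norm_inr_commutator_le {p : A} (x : Unitization ℂ A) {τ : ℝ}
    (h : ‖p * x.snd - x.snd * p‖ ≤ τ) :
    ‖(p : Unitization ℂ A) * x - x * p‖ ≤ τ := by
  have : (p : Unitization ℂ A) * x - x * p = ((p * x.snd - x.snd * p : A) : Unitization ℂ A) := by
    induction x using Unitization.ind with
    | inl_add_inr r a =>
      simp only [mul_add, add_mul, Unitization.inl_mul_inr, Unitization.inr_mul_inl,
        Unitization.snd_add, Unitization.snd_inl, Unitization.snd_inr, zero_add,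
        Unitization.inr_sub, Unitization.inr_mul, add_sub_add_left_eq_sub]
  rwa [this, Unitization.norm_inr]

/-- The inclusion of the unitization of the fixed point algebra. -/
noncomputable def fixedPointUnitizationMap {G : Type*} (α : G → A ≃⋆ₐ[ℂ] A) :
    Unitization ℂ (fixedPointAlgebra α) →⋆ₐ[ℂ] Unitization ℂ A :=
  Unitization.starMap (NonUnitalStarSubalgebraClass.subtype (fixedPointAlgebra α))

variable {G : Type*} {α : G → A ≃⋆ₐ[ℂ] A}

theorem fixedPointUnitizationMap_injective :
    Function.Injective (fixedPointUnitizationMap α) :=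
  Unitization.starMap_injective Subtype.val_injective

theorem exists_fixedPointUnitizationMap_eq {Y : Unitization ℂ A}
    (hY : ∀ g, unitizationMap (α g) Y = Y) : ∃ z, fixedPointUnitizationMap α z = Y := by
  have h : Y.snd ∈ fixedPointAlgebra α := fun g => by rw [← unitizationMap_snd, hY]
  refine ⟨Unitization.inl Y.fst + ((⟨Y.snd, h⟩ : fixedPointAlgebra α) : Unitization ℂ _), ?_⟩
  rw [fixedPointUnitizationMap, map_add, Unitization.starMap_inl, Unitization.starMap_inr,
    Unitization.algebraMap_eq_inl]
  exact Unitization.inl_fst_add_inr_snd_eq Y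

theorem isUnit_of_fixedPointUnitizationMap {z : Unitization ℂ (fixedPointAlgebra α)}
    {Y : Unitization ℂ A} (hz : fixedPointUnitizationMap α z = Y) (hYu : IsUnit Y)
    (hY : ∀ g, unitizationMap (α g) Y = Y) : IsUnit z := by
  obtain ⟨u, rfl⟩ := hYu
  have hinv : ∀ g, unitizationMap (α g) (↑u⁻¹ : Unitization ℂ A) = ↑u⁻¹ := fun g => by
    refine (Units.inv_eq_of_mul_eq_one_right ?_).symm
    conv_lhs => rw [← hY g]
    rw [← map_mul, Units.mul_inv, map_one]
  obtain ⟨w, hw⟩ := exists_fixedPointUnitizationMap_eq hinv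
  refine ⟨⟨z, w, fixedPointUnitizationMap_injective ?_, fixedPointUnitizationMap_injective ?_⟩, rfl⟩
  · rw [map_mul, hz, hw, map_one, Units.mul_inv]
  · rw [map_mul, hz, hw, map_one, Units.inv_mul]

end Extension

section Assembly

variable {A : Type*} [NonUnitalCStarAlgebra A] [PartialOrder A] [StarOrderedRing A]
  {G : Type*} [Group G] [Fintype G]
  {α : G → A ≃⋆ₐ[ℂ] A}

theorem TracialRokhlinProperty.exists_approxTower (hTRP : TracialRokhlinProperty α)
    {S : Set (Unitization ℂ A)} (hS : S.Finite) {d y : A} (hd : star d = d) (hd1 : ‖d‖ = 1)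
    (hαd : ∀ g, α g d = d) (hy : 0 ≤ y) : ∃ C : ℝ, ∀ τ : ℝ, 0 < τ →
      ∃ (e f : G → Unitization ℂ A) (m v : Unitization ℂ A),
        ApproxTower (fun g => unitizationMap (α g)) S d y C τ e f m v := by
  classical
  obtain ⟨C, hC⟩ := hTRP.exists_double_tower (hS.toFinset.image fun x => x.snd) hd hd1 hαd hy
  refine ⟨C, fun τ hτ => ?_⟩
  obtain ⟨e, f, m, v, h1, h2, h3, h4, h5, h6, h7, h8, h9, h10, h11, h12, h13⟩ := hC τ hτ
  have hS' : ∀ a ∈ S, a.snd ∈ hS.toFinset.image fun x => x.snd := fun a ha =>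
    Finset.mem_image_of_mem (fun x => x.snd) (hS.mem_toFinset.2 ha)
  refine ⟨fun g => e g, fun g => f g, m, v, fun g => (h1 g).inr, fun g => (h2 g).inr,
    fun g h hgh => ?_, fun g h hgh => ?_, fun g h => ?_, fun g h => ?_,
    fun g a ha => norm_inr_commutator_le a (h7 g _ (hS' a ha)),
    fun g a ha => norm_inr_commutator_le a (h8 g _ (hS' a ha)),
    fun g h => norm_inr_commutator_le _ (h9 g h), by rwa [Unitization.norm_inr],
    by rwa [Unitization.norm_inr], ?_, ?_⟩
  · rw [← Unitization.inr_mul, h3 g h hgh, Unitization.inr_zero]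
  · rw [← Unitization.inr_mul, h4 g h hgh, Unitization.inr_zero]
  · rw [unitizationMap_inr, ← Unitization.inr_sub, Unitization.norm_inr]; exact h5 g h
  · rw [unitizationMap_inr, ← Unitization.inr_sub, Unitization.norm_inr]; exact h6 g h
  · simp only [← Unitization.inr_mul, ← h12]
  · have : (∑ g, (f g : Unitization ℂ A)) = ((∑ g, f g : A) : Unitization ℂ A) :=
      (map_sum (Unitization.inrNonUnitalStarAlgHom ℂ A) f Finset.univ).symm
    rw [this, mul_sub, sub_mul, mul_one]
    simpa only [← Unitization.inr_mul, ← Unitization.inr_sub, ← Unitization.inr_star,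
      Unitization.norm_inr] using h13

theorem exists_isUnit_near_one_add (hSR : StableRankOne A)
    (hα : ∀ g h : G, ∀ a : A, α (g * h) a = α g (α h a)) (hTRP : TracialRokhlinProperty α)
    {b y : A} (hy : 0 ≤ y) (hαy : ∀ g, α g y = y) (hαb : ∀ g, α g b = b) {ε : ℝ} (hε : 0 < ε) :
    ∃ Y : Unitization ℂ A, IsUnit Y ∧ (∀ g, unitizationMap (α g) Y = Y) ∧
      ‖(1 + (y : Unitization ℂ A) * b * y) - Y‖ < ε := by
  let _ := CStarAlgebra.spectralOrder (Unitization ℂ A)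
  have := CStarAlgebra.spectralOrderedRing (Unitization ℂ A)
  obtain ⟨X, hX⟩ : ∃ X, X = 1 + (y : Unitization ℂ A) * b * y := ⟨_, rfl⟩
  have hβX : ∀ g, unitizationMap (α g) X = X := fun g => by
    rw [hX]; simp only [map_add, map_mul, map_one, unitizationMap_inr, hαy, hαb]
  rw [← hX]
  by_cases hXu : IsUnit X
  · exact ⟨X, hXu, hβX, by simpa using hε⟩
  obtain ⟨φ, hφ⟩ : ∃ φ : Unitization ℂ A →⋆ₐ[ℂ] ℂ, ∀ x, φ x = x.fst :=
    ⟨{ Unitization.fstHom ℂ A with map_star' := fun x => rfl }, fun x => rfl⟩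
  have hφX : φ X = 1 := by rw [hφ, hX]; simp
  have hn : (0 : ℝ) < Fintype.card G := by exact_mod_cast Fintype.card_pos
  obtain ⟨h, d, u, hh, hds, hd1, hdh, hφd, hu, hinv⟩ := exists_approx_factor hSR hXu hφX
    (ε := ε / ((Fintype.card G : ℝ) * (Fintype.card G + 2))) (by positivity)
  obtain ⟨d, rfl⟩ : ∃ d₀ : A, d = d₀ := ⟨d.snd, by
    ext
    · simpa [hφ] using hφd
    · simp⟩
  rw [← Unitization.inr_star, Unitization.inr_injective.eq_iff] at hds
  rw [Unitization.norm_inr] at hd1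
  have hαd : ∀ g, α g d = d := fun g => by
    have := (hinv _ (hβX g)).2
    rwa [unitizationMap_inr, Unitization.inr_injective.eq_iff] at this
  obtain ⟨C, hC⟩ := hTRP.exists_approxTower (S := {X, h, (y : Unitization ℂ A), ↑d} ∪
    Set.range fun g => unitizationMap (α g) u) (Set.toFinite _) hds hd1 hαd hy
  refine exists_isUnit_of_approxTower hSR (unitizationMap_mul hα) hX
    (by rw [← Unitization.inr_star, (IsSelfAdjoint.of_nonneg hy).star_eq]) hh hβX
    (fun g => by rw [unitizationMap_inr, hαy]) (fun g => (hinv _ (hβX g)).1)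
    (by rw [← Unitization.inr_star, hds]) hdh (by simp) (by simp) (by simp) (by simp)
    (fun g => Or.inr ⟨g, rfl⟩) hC ?_
  rwa [mul_comm, ← lt_div_iff₀ (by positivity)]

/-- Invariant positive elements act approximately as a unit on a given invariant element. -/
theorem exists_invariant_approx_unit (hα : ∀ g h : G, ∀ a : A, α (g * h) a = α g (α h a))
    {b : A} (hb : ∀ g, α g b = b) {ε : ℝ} (hε : 0 < ε) :
    ∃ y : A, 0 ≤ y ∧ (∀ g, α g y = y) ∧ ‖y * b * y - b‖ < ε := by
  have hl := CStarAlgebra.increasingApproximateUnit A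
  have h1 : ∀ᶠ x in CStarAlgebra.approximateUnit A, ‖x * b - b‖ < ε / 2 :=
    (tendsto_iff_norm_sub_tendsto_zero.1 (hl.tendsto_mul_right b)).eventually_lt_const
      (by positivity)
  have h2 : ∀ᶠ x in CStarAlgebra.approximateUnit A, ‖b * x - b‖ < ε / 2 :=
    (tendsto_iff_norm_sub_tendsto_zero.1 (hl.tendsto_mul_left b)).eventually_lt_const
      (by positivity)
  obtain ⟨e, he0, he1, he2, he3⟩ :=
    (hl.eventually_nonneg.and (hl.eventually_norm.and (h1.and h2))).exists
  set n : ℝ := (Fintype.card G : ℝ) with hn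
  have hnpos : 0 < n := by rw [hn]; exact_mod_cast Fintype.card_pos
  -- averages of elements of small norm
  have havg : ∀ c : A, ∀ r : ℝ, (∀ g, ‖α g c‖ ≤ r) → ‖n⁻¹ • ∑ g, α g c‖ ≤ r := by
    intro c r hr
    rw [norm_smul, Real.norm_of_nonneg (by positivity), inv_mul_le_iff₀ hnpos]
    calc ‖∑ g, α g c‖ ≤ ∑ _g : G, r := (norm_sum_le _ _).trans (Finset.sum_le_sum fun g _ => hr g)
      _ = n * r := by simp [hn]
  have hconst : n⁻¹ • ∑ _g : G, b = b := by
    rw [Finset.sum_const, Finset.card_univ, ← Nat.cast_smul_eq_nsmul ℝ, smul_smul, ← hn,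
      inv_mul_cancel₀ hnpos.ne', one_smul]
  have hnorm : ∀ g a, ‖α g a‖ = ‖a‖ := fun g a =>
    NonUnitalStarAlgHom.norm_map (α g) (α g).injective a
  obtain ⟨y, hy⟩ : ∃ y, y = n⁻¹ • ∑ g, α g e := ⟨_, rfl⟩
  have hy1 : ‖y‖ ≤ 1 := by rw [hy]; exact havg e 1 fun g => by rwa [hnorm]
  have hyb : ‖y * b - b‖ ≤ ‖e * b - b‖ := by
    have : y * b - b = n⁻¹ • ∑ g, α g (e * b - b) := by
      simp only [map_sub, map_mul, hb, Finset.sum_sub_distrib, smul_sub, hconst, hy,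
        smul_mul_assoc, Finset.sum_mul]
    rw [this]
    exact havg _ _ fun g => by rw [hnorm]
  have hby : ‖b * y - b‖ ≤ ‖b * e - b‖ := by
    have : b * y - b = n⁻¹ • ∑ g, α g (b * e - b) := by
      simp only [map_sub, map_mul, hb, Finset.sum_sub_distrib, smul_sub, hconst, hy,
        mul_smul_comm, Finset.mul_sum]
    rw [this]
    exact havg _ _ fun g => by rw [hnorm]
  refine ⟨y, ?_, fun g => ?_, ?_⟩
  · rw [hy]
    exact smul_nonneg (by positivity) (Finset.sum_nonneg fun g _ => map_nonneg (α g) he0)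
  · rw [hy, ← Complex.coe_smul, map_smul, map_sum]
    congr 1
    exact Fintype.sum_equiv (Equiv.mulLeft g) _ _ fun k => (hα g k e).symm
  · calc ‖y * b * y - b‖ = ‖y * (b * y - b) + (y * b - b)‖ := by
          congr 1; rw [mul_sub, mul_assoc]; abel
      _ ≤ 1 * ‖b * y - b‖ + ‖y * b - b‖ :=
          (norm_add_le _ _).trans (by gcongr; exact (norm_mul_le _ _).trans (by gcongr))
      _ < ε := by linarith

/-- Under the hypotheses of the theorem, the invariant invertibles are dense in the invariant
elements of the unitization. -/
theorem exists_invariant_isUnit_near (hSR : StableRankOne A)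
    (hα : ∀ g h : G, ∀ a : A, α (g * h) a = α g (α h a)) (hTRP : TracialRokhlinProperty α)
    (r : ℂ) {b : A} (hb : ∀ g, α g b = b) {ε : ℝ} (hε : 0 < ε) :
    ∃ Y : Unitization ℂ A, IsUnit Y ∧ (∀ g, unitizationMap (α g) Y = Y) ∧
      ‖(algebraMap ℂ (Unitization ℂ A) r + b) - Y‖ < ε := by
  obtain ⟨l, hl0, hl⟩ : ∃ l : ℂ, l ≠ 0 ∧ ‖r - l‖ < ε / 3 := by
    by_cases hr : r = 0
    · refine ⟨((ε / 4 : ℝ) : ℂ), by simpa using hε.ne', ?_⟩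
      rw [hr, zero_sub, norm_neg, Complex.norm_real, Real.norm_of_nonneg (by positivity)]
      linarith
    · exact ⟨r, hr, by simpa using hε⟩
  obtain ⟨y, hy0, hαy, hyb⟩ := exists_invariant_approx_unit hα hb (ε := ε / 3) (by positivity)
  obtain ⟨Y, hYu, hYi, hY⟩ := exists_isUnit_near_one_add hSR hα hTRP (b := l⁻¹ • b) hy0 hαy
    (fun g => by rw [map_smul, hb]) (ε := ε / 3 / ‖l‖) (by positivity)
  refine ⟨l • Y, ?_, fun g => by rw [map_smul, hYi], ?_⟩
  · have := hYu.smul (Units.mk0 l hl0)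
    exact this
  have e1 : algebraMap ℂ (Unitization ℂ A) r + b - l • Y =
      algebraMap ℂ (Unitization ℂ A) (r - l) - ((y * b * y - b : A) : Unitization ℂ A) +
        l • ((1 + (y : Unitization ℂ A) * ((l⁻¹ • b : A) : Unitization ℂ A) * y) - Y) := by
    rw [Unitization.inr_smul, mul_smul_comm, smul_mul_assoc, smul_sub, smul_add, smul_smul,
      mul_inv_cancel₀ hl0, one_smul, map_sub, Algebra.algebraMap_eq_smul_one l,
      Unitization.inr_sub, Unitization.inr_mul, Unitization.inr_mul]
    abel
  rw [e1]
  have h1 : ‖algebraMap ℂ (Unitization ℂ A) (r - l)‖ < ε / 3 := by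
    rwa [norm_algebraMap']
  have h2 : ‖((y * b * y - b : A) : Unitization ℂ A)‖ < ε / 3 := by rwa [Unitization.norm_inr]
  have h3 : ‖l • ((1 + (y : Unitization ℂ A) * ((l⁻¹ • b : A) : Unitization ℂ A) * y) - Y)‖ <
      ε / 3 := by
    rw [norm_smul, mul_comm]
    exact (lt_div_iff₀ (norm_pos_iff.2 hl0)).1 hY
  refine (norm_add_le _ _).trans_lt ?_
  have := norm_sub_le (algebraMap ℂ (Unitization ℂ A) (r - l))
    ((y * b * y - b : A) : Unitization ℂ A)
  linarith

end Assembly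

/-- Theorem A(1) (fixed point algebra part): if `A` is a simple σ-unital C*-algebra with stable
rank one and `α` is an action of a finite group `G` on `A` with the tracial Rokhlin property,
then the fixed point algebra `A^α` has stable rank one. -/
theorem stableRankOne_fixedPointAlgebra
    {A : Type*} [NonUnitalCStarAlgebra A] [PartialOrder A] [StarOrderedRing A]
    {G : Type*} [Group G] [Fintype G]
    (hA : IsSimpleCStarAlgebra A) (hσ : SigmaUnital A) (hSR : StableRankOne A)
    (α : G → A ≃⋆ₐ[ℂ] A) (hα : ∀ g h : G, ∀ a : A, α (g * h) a = α g (α h a))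
    (hTRP : TracialRokhlinProperty α) :
    StableRankOne ↥(fixedPointAlgebra α) := by
  intro x ε hε
  obtain ⟨Y, hYu, hYi, hY⟩ := exists_invariant_isUnit_near hSR hα hTRP x.fst
    (b := (x.snd : A)) x.snd.2 hε
  obtain ⟨z, hz⟩ := exists_fixedPointUnitizationMap_eq hYi
  refine ⟨z, isUnit_of_fixedPointUnitizationMap hz hYu hYi, ?_⟩
  have hx : fixedPointUnitizationMap α x =
      algebraMap ℂ (Unitization ℂ A) x.fst + ((x.snd : A) : Unitization ℂ A) := by
    conv_lhs => rw [← Unitization.inl_fst_add_inr_snd_eq x]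
    rw [fixedPointUnitizationMap, map_add, Unitization.starMap_inl, Unitization.starMap_inr]
    rfl
  rw [← hx, ← hz, ← map_sub] at hY
  rwa [NonUnitalStarAlgHom.norm_map (fixedPointUnitizationMap α)
    fixedPointUnitizationMap_injective] at hY
end

section
/- Let A be a simple separable C*-algebra and let α : G → Aut(A) be an action of a finite group G on A with the weak tracial Rokhlin property. If the relative commutant A′ ∩ A_ω has real rank zero for some free ultrafilter ω on ℕ, then α has the tracial Rokhlin property. -/
open Filter Topology
open scoped ENNReal

/-- The weak tracial Rokhlin property: as the tracial Rokhlin property, but with mutually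
orthogonal positive contractions in place of mutually orthogonal projections. -/
def WeakTracialRokhlinProperty {A : Type*} [NonUnitalCStarAlgebra A] [PartialOrder A]
    [StarOrderedRing A] {G : Type*} [Group G] [Fintype G]
    (α : G → A ≃⋆ₐ[ℂ] A) : Prop :=
  ∀ (F : Finset A) (ε : ℝ), 0 < ε → ∀ x y : A, 0 ≤ x → 0 ≤ y → ‖x‖ = 1 →
    ∃ p : G → A,
      (∀ g, 0 ≤ p g ∧ ‖p g‖ ≤ 1) ∧
      (∀ g h, g ≠ h → p g * p h = 0) ∧
      (∀ a ∈ F, ∀ g, ‖p g * a - a * p g‖ < ε) ∧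
      (∀ g h, ‖α g (p h) - p (g * h)‖ < ε) ∧
      CuntzSubeq (cutPos (y * y - y * (∑ g, p g) * y) ε) x ∧
      ‖(∑ g, p g) * x * (∑ g, p g)‖ > 1 - ε

/-- A C*-algebra `B` has real rank zero if the invertible self-adjoint elements of its minimal
unitization are dense in the self-adjoint elements of the unitization. -/
def RealRankZero (B : Type*) [NonUnitalCStarAlgebra B] : Prop :=
  ∀ x : Unitization ℂ B, IsSelfAdjoint x → ∀ ε : ℝ, 0 < ε →
    ∃ y : Unitization ℂ B, IsSelfAdjoint y ∧ IsUnit y ∧ ‖x - y‖ < ε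

/-- The constant sequence at `a`, as an element of `ℓ∞(A)`. -/
noncomputable def constSeq {A : Type*} [NonUnitalCStarAlgebra A] (a : A) :
    lp (fun _ : ℕ => A) ∞ :=
  ⟨fun _ => a, memℓp_infty ⟨‖a‖, by rintro r ⟨n, rfl⟩; exact le_rfl⟩⟩

/-- The relative commutant `A' ∩ B` of (the image under `π : ℓ∞(A) → B` of) the constant
sequences inside `B`.  When `B = A_ω = ℓ∞(A)/c_ω(A)` and `π` is the quotient map, this is
`A' ∩ A_ω`. -/
noncomputable def relCommutant (A : Type*) {B : Type*} [NonUnitalCStarAlgebra A]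
    [NonUnitalCStarAlgebra B] (π : lp (fun _ : ℕ => A) ∞ →⋆ₙₐ[ℂ] B) :
    NonUnitalStarSubalgebra ℂ B where
  carrier := {b : B | ∀ a : A, b * π (constSeq a) = π (constSeq a) * b}
  add_mem' := fun {x y} hx hy a => by rw [add_mul, mul_add, hx a, hy a]
  zero_mem' := fun a => by rw [zero_mul, mul_zero]
  mul_mem' := fun {x y} hx hy a => by rw [mul_assoc, hy a, ← mul_assoc, hx a, mul_assoc]
  smul_mem' := fun c x hx a => by rw [smul_mul_assoc, hx a, mul_smul_comm]
  star_mem' := fun {x} hx a => by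
    have hconst : ∀ z : A, star (constSeq (A := A) z) = constSeq (star z) := fun z =>
      lp.ext (by funext n; simp [constSeq, lp.coeFn_star])
    have key : ∀ z : A, star (π (constSeq z)) = π (constSeq (star z)) := fun z => by
      rw [← map_star, hconst]
    calc star x * π (constSeq a)
        = star (star (π (constSeq a)) * x) := by rw [star_mul, star_star]
      _ = star (π (constSeq (star a)) * x) := by rw [key]
      _ = star (x * π (constSeq (star a))) := by rw [hx (star a)]
      _ = star (π (constSeq (star a))) * star x := by rw [star_mul]
      _ = π (constSeq (star (star a))) * star x := by rw [key]
      _ = π (constSeq a) * star x := by rw [star_star]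

instance relCommutant_isClosed (A : Type*) {B : Type*} [NonUnitalCStarAlgebra A]
    [NonUnitalCStarAlgebra B] (π : lp (fun _ : ℕ => A) ∞ →⋆ₙₐ[ℂ] B) :
    IsClosed ((relCommutant A π : NonUnitalStarSubalgebra ℂ B) : Set B) := by
  have h : ((relCommutant A π : NonUnitalStarSubalgebra ℂ B) : Set B) =
      ⋂ a : A, {b : B | b * π (constSeq a) = π (constSeq a) * b} := by
    ext b
    simp only [Set.mem_iInter, Set.mem_setOf_eq]
    rfl
  rw [h]
  exact isClosed_iInter fun a =>
    isClosed_eq (continuous_id.mul continuous_const) (continuous_const.mul continuous_id)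

section SelfAdjointCalculus

variable {A : Type*} [NonUnitalCStarAlgebra A]

/-- A continuous function equal to `0` on `(-∞, 1/4]` and to `1` on `[3/4, ∞)`. -/
noncomputable def ramp (t : ℝ) : ℝ := max 0 (min 1 (2 * t - 1 / 2))

lemma continuous_ramp : Continuous ramp := by unfold ramp; fun_prop

lemma ramp_eq_zero {t : ℝ} (ht : t ≤ 1 / 4) : ramp t = 0 := by
  unfold ramp
  exact max_eq_left ((min_le_right _ _).trans (by linarith))

lemma ramp_eq_one {t : ℝ} (ht : 3 / 4 ≤ t) : ramp t = 1 := by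
  unfold ramp
  rw [min_eq_left (by linarith)]
  norm_num

lemma mul_ramp_div (t : ℝ) : t * (ramp t / max t (1 / 4)) = ramp t := by
  rcases le_total t (1 / 4) with h | h
  · simp [ramp_eq_zero h]
  · rw [max_eq_left h]
    field_simp

lemma continuous_ramp_div : Continuous fun t : ℝ => ramp t / max t (1 / 4) :=
  continuous_ramp.div (by fun_prop) fun t =>
    (lt_of_lt_of_le (by norm_num) (le_max_right t (1 / 4))).ne'

lemma cfcₙ_ramp_eq_mul {a : A} (ha : IsSelfAdjoint a) :
    cfcₙ ramp a = a * cfcₙ (fun t : ℝ => ramp t / max t (1 / 4)) a := by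
  have h0 : ramp 0 / max 0 (1 / 4) = 0 := by simp [ramp_eq_zero]
  conv_rhs => enter [1]; rw [← cfcₙ_id' ℝ a]
  rw [← cfcₙ_mul _ _ a (by fun_prop) rfl continuous_ramp_div.continuousOn h0]
  simp_rw [mul_ramp_div]

lemma cfcₙ_ramp_mul_eq_zero {a b : A} (ha : IsSelfAdjoint a) (hab : a * b = 0) :
    cfcₙ ramp a * b = 0 := by
  have h : Commute a (cfcₙ (fun t : ℝ => ramp t / max t (1 / 4)) a) :=
    ((Commute.refl a).cfcₙ_real _).symm
  rw [cfcₙ_ramp_eq_mul ha, h.eq, mul_assoc, hab, mul_zero]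

lemma mul_cfcₙ_ramp_eq_zero {a b : A} (ha : IsSelfAdjoint a) (hab : b * a = 0) :
    b * cfcₙ ramp a = 0 := by
  rw [cfcₙ_ramp_eq_mul ha, ← mul_assoc, hab, zero_mul]

lemma abs_mul_self_sub_le_norm {a : A} (ha : IsSelfAdjoint a) {t : ℝ}
    (ht : t ∈ quasispectrum ℝ a) : |t * t - t| ≤ ‖a * a - a‖ := by
  have h : a * a - a = cfcₙ (fun t : ℝ => t * t - t) a := by
    rw [cfcₙ_sub _ _ a, cfcₙ_mul _ _ a, cfcₙ_id' ℝ a]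
  rw [h]
  exact norm_apply_le_norm_cfcₙ (fun t : ℝ => t * t - t) a ht

lemma le_quarter_or_le_of_mul_self_sub {t : ℝ} (h : |t * t - t| < 3 / 16) :
    t ≤ 1 / 4 ∨ 3 / 4 ≤ t := by
  by_contra! hc
  have := abs_lt.mp h
  nlinarith [mul_pos (sub_pos.2 hc.1) (sub_pos.2 hc.2)]

lemma isProjection_cfcₙ_ramp {a : A} (ha : IsSelfAdjoint a) (h : ‖a * a - a‖ < 3 / 16) :
    IsProjection (cfcₙ ramp a) := by
  refine ⟨cfcₙ_predicate _ _, ?_⟩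
  have h0 : ramp 0 = 0 := ramp_eq_zero (by norm_num)
  rw [← cfcₙ_mul _ _ a continuous_ramp.continuousOn h0 continuous_ramp.continuousOn h0]
  refine cfcₙ_congr fun t ht => ?_
  rcases le_quarter_or_le_of_mul_self_sub ((abs_mul_self_sub_le_norm ha ht).trans_lt h) with h' | h'
  · simp [ramp_eq_zero h']
  · simp [ramp_eq_one h']

lemma norm_cfcₙ_ramp_sub_le {a : A} (ha : IsSelfAdjoint a) (h : ‖a * a - a‖ < 3 / 16) :
    ‖cfcₙ ramp a - a‖ ≤ 2 * ‖a * a - a‖ := by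
  have h0 : ramp 0 = 0 := ramp_eq_zero (by norm_num)
  have e : cfcₙ ramp a - a = cfcₙ (fun t => ramp t - t) a := by
    rw [cfcₙ_sub _ _ a continuous_ramp.continuousOn h0, cfcₙ_id' ℝ a]
  rw [e]
  refine norm_cfcₙ_le fun t ht => ?_
  have hb := abs_mul_self_sub_le_norm ha ht
  have habs : |t * t - t| = |t| * |t - 1| := by rw [← abs_mul]; ring_nf
  rcases le_quarter_or_le_of_mul_self_sub (hb.trans_lt h) with h' | h'
  · rw [ramp_eq_zero h', zero_sub, norm_neg, Real.norm_eq_abs]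
    have : 1 / 2 ≤ |t - 1| := by rw [abs_of_neg] <;> linarith
    nlinarith [abs_nonneg t]
  · rw [ramp_eq_one h', Real.norm_eq_abs, abs_sub_comm]
    have : 1 / 2 ≤ |t| := by rw [abs_of_pos] <;> linarith
    nlinarith [abs_nonneg (t - 1)]

end SelfAdjointCalculus

section CuntzComparison

variable {A : Type*} [NonUnitalCStarAlgebra A]

lemma cuntzSubeq_iff {a b : A} :
    CuntzSubeq a b ↔ ∀ η : ℝ, 0 < η → ∃ v : A, ‖a - v * b * star v‖ < η := by
  constructor
  · rintro ⟨v, hv⟩ η hη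
    obtain ⟨n, hn⟩ := (hv.eventually (gt_mem_nhds hη)).exists
    exact ⟨v n, hn⟩
  · intro h
    choose v hv using fun n : ℕ => h (1 / ((n : ℝ) + 1)) Nat.one_div_pos_of_nat
    exact ⟨v, squeeze_zero (fun _ => norm_nonneg _) (fun n => (hv n).le)
      tendsto_one_div_add_atTop_nhds_zero_nat⟩

lemma CuntzSubeq.trans {a b c : A} (hab : CuntzSubeq a b) (hbc : CuntzSubeq b c) :
    CuntzSubeq a c := by
  rw [cuntzSubeq_iff] at *
  intro η hη
  obtain ⟨v, hv⟩ := hab (η / 2) (half_pos hη)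
  have hpos : 0 < ‖v‖ * ‖v‖ + 1 := by positivity
  obtain ⟨w, hw⟩ := hbc (η / 2 / (‖v‖ * ‖v‖ + 1)) (by positivity)
  refine ⟨v * w, ?_⟩
  have e : a - v * w * c * star (v * w)
      = (a - v * b * star v) + v * (b - w * c * star w) * star v := by
    rw [star_mul]; noncomm_ring
  have h1 : ‖v * (b - w * c * star w) * star v‖ ≤ ‖v‖ * ‖b - w * c * star w‖ * ‖v‖ := by
    simpa using norm_mul₃_le (a := v) (b := b - w * c * star w) (c := star v)
  have h2 : ‖v‖ * ‖b - w * c * star w‖ * ‖v‖ ≤ η / 2 := by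
    have h3 := (lt_div_iff₀ hpos).mp hw
    nlinarith [norm_nonneg (b - w * c * star w)]
  rw [e]
  refine (norm_add_le _ _).trans_lt ?_
  linarith

lemma cuntzSubeq_conj_self_mul (u d : A) : CuntzSubeq (star u * d * u) d :=
  ⟨fun _ => star u, by simp⟩

variable [PartialOrder A] [StarOrderedRing A]

lemma CuntzSubeq.of_le {m b : A} (hm : 0 ≤ m) (hmb : m ≤ b) : CuntzSubeq m b := by
  rw [cuntzSubeq_iff]
  intro η hη
  have hb : 0 ≤ b := hm.trans hmb
  have hbs : IsSelfAdjoint b := .of_nonneg hb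
  set s := CFC.sqrt m with hs
  have hss : s * s = m := CFC.sqrt_mul_sqrt_self m
  have hsa : star s = s := (IsSelfAdjoint.of_nonneg (CFC.sqrt_nonneg m)).star_eq
  obtain ⟨σ, hσ, hση⟩ : ∃ σ : ℝ, 0 < σ ∧ 2 * (σ * ‖s‖) < η := by
    refine ⟨η / (2 * (‖s‖ + 1)), by positivity, ?_⟩
    have : 2 * (η / (2 * (‖s‖ + 1)) * ‖s‖) = η * (‖s‖ / (‖s‖ + 1)) := by field_simp
    rw [this]
    refine mul_lt_of_lt_one_right hη ((div_lt_one (by positivity)).2 (by linarith))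
  have hden : ∀ t : ℝ, max t 0 + σ ^ 2 ≠ 0 := fun t =>
    (add_pos_of_nonneg_of_pos (le_max_right _ _) (by positivity)).ne'
  have hkc : Continuous fun t : ℝ => √t / (max t 0 + σ ^ 2) :=
    Real.continuous_sqrt.div (by fun_prop) hden
  have hec : Continuous fun t : ℝ => t / (max t 0 + σ ^ 2) :=
    continuous_id.div (by fun_prop) hden
  set k := cfcₙ (fun t : ℝ => √t / (max t 0 + σ ^ 2)) b with hk
  set e := cfcₙ (fun t : ℝ => t / (max t 0 + σ ^ 2)) b with he
  have hksa : star k = k := (cfcₙ_predicate _ b : IsSelfAdjoint k).star_eq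
  have hesa : star e = e := (cfcₙ_predicate _ b : IsSelfAdjoint e).star_eq
  have hnn : ∀ t ∈ quasispectrum ℝ b, 0 ≤ t := quasispectrum_nonneg_of_nonneg b hb
  have hkbk : k * b * k = e * e := by
    have h1 : k * b * k = cfcₙ (fun t : ℝ => √t / (max t 0 + σ ^ 2) * t *
        (√t / (max t 0 + σ ^ 2))) b := by
      rw [cfcₙ_mul _ _ b (by fun_prop (disch := simpa using hden)) (by simp) hkc.continuousOn
        (by simp),
        cfcₙ_mul _ _ b hkc.continuousOn (by simp) (by fun_prop) rfl, cfcₙ_id' ℝ b]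
    rw [h1, he, ← cfcₙ_mul _ _ b hec.continuousOn (by simp) hec.continuousOn (by simp)]
    refine cfcₙ_congr fun t ht => ?_
    have := Real.mul_self_sqrt (hnn t ht)
    have hd := hden t
    field_simp
    nlinarith
  have hen : ‖e‖ ≤ 1 := by
    refine norm_cfcₙ_le fun t ht => ?_
    have h0 := hnn t ht
    rw [max_eq_left h0, Real.norm_eq_abs, abs_of_nonneg (by positivity),
      div_le_one (by positivity)]
    nlinarith
  have hcorner : ‖b - e * b - b * e + e * b * e‖ ≤ σ ^ 2 := by
    have h1 : b - e * b - b * e + e * b * e = cfcₙ (fun t : ℝ =>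
        t - t / (max t 0 + σ ^ 2) * t - t * (t / (max t 0 + σ ^ 2)) +
          t / (max t 0 + σ ^ 2) * t * (t / (max t 0 + σ ^ 2))) b := by
      rw [cfcₙ_add _ _ b (by fun_prop) (by simp) (by fun_prop) (by simp),
        cfcₙ_sub _ _ b (by fun_prop) (by simp) (by fun_prop) (by simp),
        cfcₙ_sub _ _ b (by fun_prop) (by simp) (by fun_prop) (by simp),
        cfcₙ_mul _ _ b hec.continuousOn (by simp) (by fun_prop) rfl,
        cfcₙ_mul _ _ b (by fun_prop) rfl hec.continuousOn (by simp),
        cfcₙ_mul _ _ b (by fun_prop (disch := simpa using hden)) (by simp)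
          hec.continuousOn (by simp),
        cfcₙ_mul _ _ b hec.continuousOn (by simp) (by fun_prop) rfl,
        cfcₙ_id' ℝ b]
    rw [h1]
    refine norm_cfcₙ_le fun t ht => ?_
    have h0 := hnn t ht
    have hd := hden t
    rw [max_eq_left h0] at hd ⊢
    have : t - t / (t + σ ^ 2) * t - t * (t / (t + σ ^ 2)) +
          t / (t + σ ^ 2) * t * (t / (t + σ ^ 2)) = σ ^ 2 * (t * σ ^ 2 / (t + σ ^ 2) ^ 2) := by
      field_simp
      ring
    rw [this, Real.norm_eq_abs, abs_of_nonneg (by positivity)]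
    refine mul_le_of_le_one_right (by positivity) ((div_le_one (by positivity)).2 ?_)
    nlinarith [sq_nonneg t, sq_nonneg (σ ^ 2), mul_nonneg h0 (sq_nonneg σ)]
  have hse : ‖s - e * s‖ ≤ σ := by
    set r := CFC.sqrt (b - m) with hr
    have hrr : r * r = b - m := CFC.sqrt_mul_sqrt_self (b - m) (sub_nonneg.2 hmb)
    have hrsa : star r = r := (IsSelfAdjoint.of_nonneg (CFC.sqrt_nonneg (b - m))).star_eq
    have h1 : (s - e * s) * star (s - e * s) = m - e * m - m * e + e * m * e := by
      rw [star_sub, star_mul, hsa, hesa, ← hss]; noncomm_ring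
    have h2 : (r - e * r) * star (r - e * r)
        = (b - e * b - b * e + e * b * e) - (m - e * m - m * e + e * m * e) := by
      rw [star_sub, star_mul, hrsa, hesa]
      have : b = r * r + m := by rw [hrr]; abel
      rw [this]; noncomm_ring
    have h3 : m - e * m - m * e + e * m * e ≤ b - e * b - b * e + e * b * e :=
      sub_nonneg.1 (h2 ▸ mul_star_self_nonneg (r - e * r))
    have h4 := CStarAlgebra.norm_le_norm_of_nonneg_of_le
      (h1 ▸ mul_star_self_nonneg (s - e * s)) h3
    rw [← h1, CStarRing.norm_self_mul_star] at h4
    exact abs_le_of_sq_le_sq' (by nlinarith) hσ.le |>.2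
  have hes : ‖s - s * e‖ ≤ σ := by
    rw [← norm_star, star_sub, star_mul, hsa, hesa]; exact hse
  refine ⟨s * k, ?_⟩
  have h1 : m - s * k * b * star (s * k) = (s - s * e) * s + s * (e * (s - e * s)) := by
    rw [star_mul, hsa, hksa]
    have : s * k * b * (k * s) = s * (k * b * k) * s := by noncomm_ring
    rw [this, hkbk, ← hss]; noncomm_ring
  rw [h1]
  calc _ ≤ ‖s - s * e‖ * ‖s‖ + ‖s‖ * (‖e‖ * ‖s - e * s‖) :=
        (norm_add_le _ _).trans (add_le_add (norm_mul_le _ _)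
          ((norm_mul_le _ _).trans (by gcongr; exact norm_mul_le _ _)))
    _ ≤ σ * ‖s‖ + ‖s‖ * (1 * σ) := by gcongr
    _ = 2 * (σ * ‖s‖) := by ring
    _ < η := hση

lemma self_le_cutPos_add {c : A} (hc : IsSelfAdjoint c) {ε : ℝ} (hε : 0 ≤ ε) :
    ∃ r : A, IsSelfAdjoint r ∧ ‖r‖ ≤ ε ∧ c ≤ cutPos c ε + r := by
  refine ⟨cfcₙ (fun t : ℝ => min (max t 0) ε) c, cfcₙ_predicate _ _, ?_, ?_⟩
  · refine norm_cfcₙ_le fun t _ => ?_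
    rw [Real.norm_eq_abs, abs_of_nonneg (le_min (le_max_right _ _) hε)]
    exact min_le_right _ _
  · have h0 : max (0 - ε) 0 = 0 := max_eq_right (by linarith)
    have h0' : min (max (0 : ℝ) 0) ε = 0 := by simpa using hε
    rw [cutPos, ← cfcₙ_add _ _ c (by fun_prop) (by exact h0) (by fun_prop) (by exact h0')]
    conv_lhs => rw [← cfcₙ_id' ℝ c]
    refine cfcₙ_mono (fun t _ => ?_) (by fun_prop) (by fun_prop) rfl
      (by rw [h0, h0', add_zero])
    rcases le_total t ε with h | h
    · rw [max_eq_right (by linarith : t - ε ≤ 0), min_eq_left (max_le h hε)]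
      simp
    · rw [max_eq_left (by linarith : 0 ≤ t - ε), min_eq_right (le_max_of_le_left h)]
      linarith

/-- A self-adjoint perturbation of norm at most `ε - ε'` preserves Cuntz subequivalence
of the cut-downs. -/
lemma cuntzSubeq_cutPos_of_le_add {c c' z x : A} {ε ε' : ℝ} (hc : IsSelfAdjoint c)
    (hc' : IsSelfAdjoint c') (hz : IsSelfAdjoint z) (hε' : 0 ≤ ε') (hε : 0 < ε)
    (hle : c ≤ c' + z) (hzε : ‖z‖ + ε' ≤ ε) (hx : CuntzSubeq (cutPos c' ε') x) :
    CuntzSubeq (cutPos c ε) x := by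
  rw [cuntzSubeq_iff]
  intro η hη
  obtain ⟨r, hr, hrε, hcr⟩ := self_le_cutPos_add hc' hε'
  set d := cutPos c' ε'
  set k : ℝ → ℝ := fun t => min 1 (max (t - ε) 0 / (η / 2)) with hk
  have hkc : Continuous k := by rw [hk]; fun_prop
  have hk0 : k 0 = 0 := by simp [hk, hε.le]
  set u := cfcₙ k c
  have hu : IsSelfAdjoint u := cfcₙ_predicate _ _
  have hm : cfcₙ (fun t => k t * t * k t - ε * (k t * k t)) c = u * c * u - ε • (u * u) := by
    rw [cfcₙ_sub _ _ c (by fun_prop) (by simp) (by fun_prop) (by simp [hk0]),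
      cfcₙ_const_mul _ _ c (by fun_prop) (by simp [hk0]),
      cfcₙ_mul _ _ c (by fun_prop) (by simp) (by fun_prop) hk0,
      cfcₙ_mul _ _ c (by fun_prop) hk0 (by fun_prop) rfl,
      cfcₙ_mul _ _ c (by fun_prop) hk0 (by fun_prop) hk0, cfcₙ_id' ℝ c]
  have hm0 : 0 ≤ u * c * u - ε • (u * u) := by
    rw [← hm]
    refine cfcₙ_nonneg fun t _ => ?_
    rcases le_total t ε with h | h
    · simp [hk, h]
    · have : k t * t * k t - ε * (k t * k t) = k t * k t * (t - ε) := by ring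
      rw [this]
      exact mul_nonneg (mul_self_nonneg _) (sub_nonneg.2 h)
  have hmd : u * c * u - ε • (u * u) ≤ star u * d * u := by
    have h1 : star u * c * u ≤ star u * (d + r + z) * u :=
      star_left_conjugate_le_conjugate (hle.trans (add_le_add_left hcr z)) u
    have h2 := CStarAlgebra.star_left_conjugate_le_norm_smul (a := u) (b := r) hr
    have h3 := CStarAlgebra.star_left_conjugate_le_norm_smul (a := u) (b := z) hz
    have h4 : (‖r‖ + ‖z‖) • (star u * u) ≤ ε • (star u * u) :=
      smul_le_smul_of_nonneg_right (by linarith) (star_mul_self_nonneg u)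
    rw [add_smul] at h4
    have h5 : star u * (d + r + z) * u
        = star u * d * u + (star u * r * u + star u * z * u) := by noncomm_ring
    rw [h5] at h1
    rw [sub_le_iff_le_add]
    calc u * c * u = star u * c * u := by rw [hu.star_eq]
      _ ≤ _ := h1.trans (add_le_add_right ((add_le_add h2 h3).trans h4) _)
      _ = _ := by rw [hu.star_eq]
  obtain ⟨v, hv⟩ := cuntzSubeq_iff.1
    (((CuntzSubeq.of_le hm0 hmd).trans (cuntzSubeq_conj_self_mul u d)).trans hx) (η / 2)
    (half_pos hη)
  refine ⟨v, ?_⟩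
  have hclose : ‖cutPos c ε - (u * c * u - ε • (u * u))‖ ≤ η / 2 := by
    have h0 : max (0 - ε) 0 = 0 := max_eq_right (by linarith)
    rw [← hm, cutPos, ← cfcₙ_sub _ _ c (by fun_prop) (by exact h0) (by fun_prop) (by simp [hk0])]
    refine norm_cfcₙ_le fun t _ => ?_
    rcases le_total t ε with h | h
    · simpa [hk, h] using (half_pos hη).le
    · have e : max (t - ε) 0 - (k t * t * k t - ε * (k t * k t))
          = (1 - k t ^ 2) * (t - ε) := by
        rw [max_eq_left (by linarith)]; ring
      have hkt : k t = min 1 ((t - ε) / (η / 2)) := by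
        simp only [hk]; rw [max_eq_left (by linarith : 0 ≤ t - ε)]
      rw [e, Real.norm_eq_abs]
      have h0 : 0 ≤ t - ε := by linarith
      rcases le_total (η / 2) (t - ε) with h' | h'
      · rw [hkt, min_eq_left ((one_le_div (half_pos hη)).2 h')]
        simpa using (half_pos hη).le
      · have h1 : (t - ε) / (η / 2) ≤ 1 := (div_le_one (half_pos hη)).2 h'
        have h2 : 0 ≤ (t - ε) / (η / 2) := by positivity
        rw [hkt, min_eq_right h1, abs_of_nonneg (mul_nonneg (by nlinarith) h0)]
        nlinarith [sq_nonneg ((t - ε) / (η / 2))]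
  calc _ = ‖(cutPos c ε - (u * c * u - ε • (u * u))) +
        ((u * c * u - ε • (u * u)) - v * x * star v)‖ := by rw [sub_add_sub_cancel]
    _ < η / 2 + η / 2 := (norm_add_le _ _).trans_lt (add_lt_add_of_le_of_lt hclose hv)
    _ = η := add_halves η

end CuntzComparison

section RealRankZeroProjections

/-- A self-adjoint invertible element close to `E ^ 2 - δ` yields, through its positive spectral
projection `q`, a projection of the form `E * W * E` which is an approximate unit for `E`. -/
lemma exists_compression_of_isUnit_near {U : Type*} [CStarAlgebra U] [PartialOrder U]
    [StarOrderedRing U] {E y : U} (hE : IsSelfAdjoint E) (hy : IsSelfAdjoint y) (hyu : IsUnit y)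
    {δ : ℝ} (hδ : 0 < δ) (hδ1 : δ ≤ 1) (hn : ‖E * E - δ • (1 : U) - y‖ < δ / 2) :
    ∃ q W : U, IsSelfAdjoint W ∧ q * W = W ∧ W * E * E * q = q ∧
      ‖E * W * E * E - E‖ ^ 2 ≤ 6 * δ := by
  set χ : ℝ → ℝ := fun t => (1 + t / |t|) / 2 with hχ
  have hspec : ∀ t ∈ spectrum ℝ y, t ≠ 0 := by
    rintro t ht rfl
    exact spectrum.zero_notMem ℝ hyu ht
  have hχc : ContinuousOn χ (spectrum ℝ y) := by
    intro t ht
    have := abs_pos.2 (hspec t ht)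
    refine ContinuousAt.continuousWithinAt ?_
    rw [hχ]
    fun_prop (disch := exact this.ne')
  have hχval : ∀ t ∈ spectrum ℝ y, (t < 0 ∧ χ t = 0) ∨ (0 < t ∧ χ t = 1) := by
    intro t ht
    rcases lt_or_gt_of_ne (hspec t ht) with h | h
    · exact .inl ⟨h, by simp [hχ, abs_of_neg h, div_neg, div_self h.ne]⟩
    · exact .inr ⟨h, by simp only [hχ]; rw [abs_of_pos h, div_self h.ne']; norm_num⟩
  set q := cfc χ y with hq
  have hqs : star q = q := (cfc_predicate χ y : IsSelfAdjoint q).star_eq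
  have hqq : q * q = q := by
    rw [hq, ← cfc_mul χ χ y]
    refine cfc_congr fun t ht => ?_
    rcases hχval t ht with h | h <;> simp [h.2]
  have hr : 1 - q = cfc (fun t => 1 - χ t) y := by
    rw [cfc_sub (fun _ => 1) χ y, cfc_const_one ℝ y]
  set r := 1 - q with hrdef
  have hrs : star r = r := by rw [hrdef, star_sub, star_one, hqs]
  have hrr : r * r = r := (IsIdempotentElem.one_sub hqq : _)
  have hqyq : 0 ≤ q * y * q := by
    have h1 : q * y * q = cfc (fun t => χ t * t * χ t) y := by
      rw [cfc_mul _ _ y, cfc_mul _ _ y, cfc_id' ℝ y]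
    rw [h1]
    refine cfc_nonneg fun t ht => ?_
    rcases hχval t ht with h | h <;> simp [h.2, h.1.le]
  have hryr : r * y * r ≤ 0 := by
    have h1 : r * y * r = cfc (fun t => (1 - χ t) * t * (1 - χ t)) y := by
      rw [cfc_mul _ _ y, cfc_mul _ _ y, cfc_id' ℝ y, ← hr]
    rw [h1]
    refine cfc_nonpos _ _ fun t ht => ?_
    rcases hχval t ht with h | h <;> simp [h.2, h.1.le]
  set z := E * E - δ • (1 : U) - y with hz
  have hEE : E * E = y + z + δ • (1 : U) := by rw [hz]; abel
  have hzs : IsSelfAdjoint z := by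
    rw [hz, IsSelfAdjoint, star_sub, star_sub, star_mul, hE.star_eq, hy.star_eq, star_smul,
      star_one, star_trivial]
  have hconj : ∀ (p w : U), IsSelfAdjoint w → ‖w‖ < δ / 2 → star p = p → p * p = p →
      p * w * p ≤ (δ / 2) • p := by
    intro p w hw hwn hps hpp
    have h1 := CStarAlgebra.star_left_conjugate_le_norm_smul (a := p) (b := w) hw
    rw [hps, hpp] at h1
    refine h1.trans (smul_le_smul_of_nonneg_right hwn.le ?_)
    rw [← hpp]
    nth_rw 1 [← hps]
    exact star_mul_self_nonneg p
  have hrnorm : ‖r‖ ≤ 1 := IsStarProjection.norm_le r ⟨hrr, hrs⟩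
  have hEr : ‖E * r‖ ^ 2 ≤ 3 / 2 * δ := by
    have h1 : star (E * r) * (E * r) = r * y * r + r * z * r + δ • r := by
      have : star (E * r) * (E * r) = r * (E * E) * r := by
        rw [star_mul, hrs, hE.star_eq]; noncomm_ring
      rw [this, hEE]
      simp only [mul_add, add_mul, mul_smul_comm, smul_mul_assoc, mul_one, hrr]
    have h2 : star (E * r) * (E * r) ≤ (3 / 2 * δ) • r := by
      rw [h1]
      have h3 := add_le_add_left (add_le_add hryr (hconj r z hzs hn hrs hrr)) (δ • r)
      refine h3.trans (le_of_eq ?_)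
      rw [zero_add, ← add_smul]
      ring_nf
    have h3 := CStarAlgebra.norm_le_norm_of_nonneg_of_le (star_mul_self_nonneg (E * r)) h2
    rw [CStarRing.norm_star_mul_self, norm_smul, Real.norm_of_nonneg (by positivity)] at h3
    nlinarith
  have hqEq : (δ / 2) • q ≤ q * (E * E) * q := by
    have h1 : q * (E * E) * q = q * y * q - q * (-z) * q + δ • q := by
      rw [hEE]
      simp only [mul_add, add_mul, mul_smul_comm, smul_mul_assoc, mul_one, hqq, mul_neg,
        neg_mul, sub_neg_eq_add]
    have h2 := hconj q (-z) hzs.neg (by rwa [norm_neg]) hqs hqq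
    have h3 : (δ / 2) • q = 0 - (δ / 2) • q + δ • q := by
      rw [zero_sub, ← neg_smul, ← add_smul]; ring_nf
    rw [h1, h3]
    exact add_le_add_left (sub_le_sub hqyq h2) _
  set T := q * (E * E) * q + r with hT
  have hTs : star T = T := by
    simp only [hT, star_add, star_mul, hqs, hrs, hE.star_eq, mul_assoc]
  have hTu : IsUnit T := by
    refine CStarAlgebra.isUnit_of_le ((δ / 2) • (1 : U)) ?_
      (IsStrictlyPositive.smul (half_pos hδ) isStrictlyPositive_one)
    have h1 : (δ / 2) • r ≤ r := by
      have h0 : 0 ≤ r := by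
        rw [← hrr]; nth_rw 1 [← hrs]; exact star_mul_self_nonneg r
      calc (δ / 2) • r ≤ (1 : ℝ) • r := smul_le_smul_of_nonneg_right (by linarith) h0
        _ = r := one_smul _ _
    have h2 : (δ / 2) • (1 : U) = (δ / 2) • q + (δ / 2) • r := by
      rw [← smul_add, hrdef, add_sub_cancel]
    rw [h2]
    exact add_le_add hqEq h1
  obtain ⟨t, ht⟩ := hTu
  set b : U := ↑t⁻¹ with hb
  have hbT : b * T = 1 := by rw [← ht]; exact t.inv_mul
  have hTb : T * b = 1 := by rw [← ht]; exact t.mul_inv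
  have hbs : star b = b := by
    have h1 : T * star b = 1 := by rw [← star_one U, ← hbT, star_mul, hTs]
    calc star b = b * T * star b := by rw [hbT, one_mul]
      _ = b := by rw [mul_assoc, h1, mul_one]
  have hrq : r * q = 0 := by rw [hrdef, sub_mul, one_mul, hqq, sub_self]
  have hTq : T * q = q * (E * E) * q := by
    rw [hT, add_mul, hrq, add_zero, mul_assoc _ q q, hqq]
  have hWq : q * b * q * E * E * q = q := by
    calc q * b * q * E * E * q = q * b * (q * (E * E) * q) := by noncomm_ring
      _ = q * (b * T) * q := by rw [← hTq]; noncomm_ring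
      _ = q := by rw [hbT, mul_one, hqq]
  have hqW : q * (q * b * q) = q * b * q := by rw [← mul_assoc, ← mul_assoc, hqq]
  refine ⟨q, q * b * q, ?_, hqW, hWq, ?_⟩
  · rw [IsSelfAdjoint, star_mul, star_mul, hqs, hbs, mul_assoc]
  set W := q * b * q with hW
  have hWs : star W = W := by rw [hW, star_mul, star_mul, hqs, hbs, mul_assoc]
  clear_value W
  have hPP : E * W * E * (E * W * E) = E * W * E := by
    calc E * W * E * (E * W * E) = E * (W * E * E) * (q * W) * E := by rw [hqW]; noncomm_ring
      _ = E * (W * E * E * q) * W * E := by noncomm_ring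
      _ = E * W * E := by rw [hWq, mul_assoc E q W, hqW]
  have hPn : ‖E * W * E‖ ≤ 1 := by
    refine IsStarProjection.norm_le _ ⟨hPP, ?_⟩
    rw [IsSelfAdjoint, star_mul, star_mul, hE.star_eq, hWs, mul_assoc]
  have h1 : E * W * E * E - E = E * W * E * (E * r) - E * r := by
    have : E * W * E * (E * r) = E * W * E * E - E * (W * E * E * q) := by
      rw [hrdef]; noncomm_ring
    rw [this, hWq, hrdef]; noncomm_ring
  have h2 : ‖E * W * E * E - E‖ ≤ 2 * ‖E * r‖ := by
    rw [h1]
    refine (norm_sub_le _ _).trans ?_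
    have := norm_mul_le (E * W * E) (E * r)
    nlinarith [norm_nonneg (E * r)]
  calc _ ≤ (2 * ‖E * r‖) ^ 2 := by gcongr
    _ ≤ 6 * δ := by rw [mul_pow]; linarith

/-- In a C*-algebra of real rank zero, every self-adjoint element `e` is almost fixed by a
projection of the form `e * w * e`. -/
lemma RealRankZero.exists_projection {D : Type*} [NonUnitalCStarAlgebra D] (hD : RealRankZero D)
    {e : D} (he : IsSelfAdjoint e) {κ : ℝ} (hκ : 0 < κ) :
    ∃ w : D, IsSelfAdjoint w ∧ e * w * e * (e * w * e) = e * w * e ∧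
      ‖e * w * e * e - e‖ < κ := by
  let _ := CStarAlgebra.spectralOrder (Unitization ℂ D)
  have _ := CStarAlgebra.spectralOrderedRing (Unitization ℂ D)
  set δ : ℝ := min 1 (κ ^ 2 / 7) with hδ
  have hδ0 : 0 < δ := lt_min one_pos (by positivity)
  have hE : IsSelfAdjoint (e : Unitization ℂ D) := he.inr ℂ
  have hh : IsSelfAdjoint ((e : Unitization ℂ D) * e - δ • (1 : Unitization ℂ D)) := by
    rw [IsSelfAdjoint, star_sub, star_mul, hE.star_eq, star_smul, star_one, star_trivial]
  obtain ⟨y, hy, hyu, hyn⟩ := hD _ hh (δ / 2) (half_pos hδ0)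
  obtain ⟨q, W, hW, hqW, hWq, hn⟩ :=
    exists_compression_of_isUnit_near hE hy hyu hδ0 (min_le_left _ _) hyn
  have hq0 : q.fst = 0 := by
    rw [← hWq]; simp
  have hW0 : W.fst = 0 := by
    rw [← hqW]; simp [hq0]
  obtain ⟨w, rfl⟩ : ∃ w : D, W = (w : Unitization ℂ D) := ⟨W.snd, by ext <;> simp [hW0]⟩
  refine ⟨w, Unitization.isSelfAdjoint_inr.1 hW, ?_, ?_⟩
  · apply Unitization.inr_injective (R := ℂ)
    simp only [Unitization.inr_mul]
    calc (e * w * e * (e * w * e) : Unitization ℂ D)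
        = e * (w * e * e) * (q * w) * e := by rw [hqW]; noncomm_ring
      _ = e * (w * e * e * q) * w * e := by noncomm_ring
      _ = e * w * e := by rw [hWq, mul_assoc (e : Unitization ℂ D) q w, hqW]
  · rw [← Unitization.norm_inr (𝕜 := ℂ)]
    simp only [Unitization.inr_sub, Unitization.inr_mul]
    refine lt_of_pow_lt_pow_left₀ 2 hκ.le (hn.trans_lt ?_)
    have : δ ≤ κ ^ 2 / 7 := min_le_right _ _
    nlinarith [sq_pos_of_pos hκ]

end RealRankZeroProjections

section Ultraproduct

variable {A : Type*} [NonUnitalCStarAlgebra A]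

/-- Evaluation of bounded sequences at `n`. -/
noncomputable def lpEval (A : Type*) [NonUnitalCStarAlgebra A] (n : ℕ) :
    lp (fun _ : ℕ => A) ∞ →⋆ₙₐ[ℂ] A where
  toFun s := s n
  map_smul' _ _ := rfl
  map_zero' := rfl
  map_add' _ _ := rfl
  map_mul' _ _ := rfl
  map_star' _ := rfl

lemma lpEval_apply (n : ℕ) (s : lp (fun _ : ℕ => A) ∞) : lpEval A n s = s n := rfl

lemma norm_lpEval_le (n : ℕ) (s : lp (fun _ : ℕ => A) ∞) : ‖lpEval A n s‖ ≤ ‖s‖ :=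
  lp.norm_apply_le_norm ENNReal.top_ne_zero s n

lemma norm_le_of_mem_quasispectrum {a : A} (ha : IsSelfAdjoint a) {t : ℝ}
    (ht : t ∈ quasispectrum ℝ a) : |t| ≤ ‖a‖ := by
  have h := norm_apply_le_norm_cfcₙ (fun t : ℝ => t) a ht
  rwa [cfcₙ_id' ℝ a] at h

lemma cutPos_eq_zero {a : A} (ha : IsSelfAdjoint a) {c : ℝ} (hc : ‖a‖ ≤ c) : cutPos a c = 0 := by
  refine norm_le_zero_iff.1 (norm_cfcₙ_le fun t ht => ?_)
  have := (le_abs_self t).trans ((norm_le_of_mem_quasispectrum ha ht).trans hc)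
  simp [this]

lemma map_cutPos {B F : Type*} [NonUnitalCStarAlgebra B] [FunLike F A B]
    [NonUnitalAlgHomClass F ℂ A B] [StarHomClass F A B] (φ : F) {a : A} (ha : IsSelfAdjoint a)
    {c : ℝ} (hc : 0 ≤ c) : φ (cutPos a c) = cutPos (φ a) c := by
  have hφ : Continuous φ :=
    AddMonoidHomClass.continuous_of_bound φ 1 fun x => by
      simpa using NonUnitalStarAlgHom.norm_apply_le φ x
  exact NonUnitalStarAlgHomClass.map_cfcₙ (S := ℂ) φ _ a (by fun_prop) (by simpa using hc) hφ ha
    (ha.map φ)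

lemma norm_le_add_norm_cutPos [PartialOrder A] [StarOrderedRing A] {a : A} (ha : 0 ≤ a) {c : ℝ}
    (hc : 0 ≤ c) : ‖a‖ ≤ c + ‖cutPos a c‖ := by
  obtain ⟨r, -, hr, har⟩ := self_le_cutPos_add (IsSelfAdjoint.of_nonneg ha) hc
  have := (CStarAlgebra.norm_le_norm_of_nonneg_of_le ha har).trans (norm_add_le _ _)
  linarith

lemma eventually_norm_lt_of_norm_map_lt [PartialOrder A] [StarOrderedRing A]
    {B : Type*} [NonUnitalCStarAlgebra B] {l : Filter ℕ} {π : lp (fun _ : ℕ => A) ∞ →⋆ₙₐ[ℂ] B}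
    (hker : ∀ f : lp (fun _ : ℕ => A) ∞, π f = 0 ↔ Tendsto (fun n => ‖f n‖) l (nhds 0))
    {s : lp (fun _ : ℕ => A) ∞} {c : ℝ} (hs : ‖π s‖ < c) : ∀ᶠ n in l, ‖s n‖ < c := by
  set t := star s * s
  have ht : IsSelfAdjoint t := .star_mul_self s
  have h0 : π (cutPos t (‖π s‖ ^ 2)) = 0 := by
    rw [map_cutPos π ht (sq_nonneg _)]
    refine cutPos_eq_zero (ht.map π) ?_
    rw [map_mul, map_star, CStarRing.norm_star_mul_self, sq]
  have hlt : 0 < c ^ 2 - ‖π s‖ ^ 2 := by nlinarith [norm_nonneg (π s)]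
  filter_upwards [((hker _).1 h0).eventually (gt_mem_nhds hlt)] with n hn
  rw [← lpEval_apply, map_cutPos (lpEval A n) ht (sq_nonneg _), map_mul, map_star,
    lpEval_apply] at hn
  have := norm_le_add_norm_cutPos (star_mul_self_nonneg (s n)) (sq_nonneg ‖π s‖)
  rw [CStarRing.norm_star_mul_self] at this
  exact lt_of_pow_lt_pow_left₀ 2 ((norm_nonneg _).trans hs.le) (by nlinarith)

end Ultraproduct

section Comparison

variable {A : Type*} [NonUnitalCStarAlgebra A]

lemma IsProjection.norm_le_one {p : A} (hp : IsProjection p) : ‖p‖ ≤ 1 :=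
  IsStarProjection.norm_le p ⟨hp.2, hp.1⟩

lemma IsProjection.sum {G : Type*} [Fintype G] {p : G → A} (hp : ∀ g, IsProjection (p g))
    (hpp : ∀ g h, g ≠ h → p g * p h = 0) : IsProjection (∑ g, p g) := by
  refine ⟨isSelfAdjoint_sum _ fun g _ => (hp g).1, ?_⟩
  rw [Finset.sum_mul_sum]
  refine Finset.sum_congr rfl fun g _ => ?_
  rw [Finset.sum_eq_single g (fun h _ hgh => hpp g h hgh.symm) (by simp), (hp g).2]

variable [PartialOrder A] [StarOrderedRing A]

lemma compare_of_projections_near {G : Type*} [Fintype G] {f p : G → A} {x y : A}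
    {κ ε ε' : ℝ} (hf : ∀ g, 0 ≤ f g ∧ ‖f g‖ ≤ 1) (hp : ∀ g, IsProjection (p g))
    (hpp : ∀ g h, g ≠ h → p g * p h = 0) (hκ : ∀ g, ‖p g * f g - f g‖ ≤ κ)
    (hy : 0 ≤ y) (hx : ‖x‖ = 1) (hε' : 0 ≤ ε') (hε : 0 < ε)
    (h₁ : Fintype.card G * (2 * κ) * (2 + Fintype.card G * (2 * κ)) + ε' ≤ ε)
    (h₂ : Fintype.card G * (2 * κ) * ‖y‖ ^ 2 + ε' ≤ ε)
    (hsub : CuntzSubeq (cutPos (y * y - y * (∑ g, f g) * y) ε') x)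
    (hnorm : ‖(∑ g, f g) * x * (∑ g, f g)‖ > 1 - ε') :
    CuntzSubeq (cutPos (y * y - y * (∑ g, p g) * y) ε) x ∧
      ‖(∑ g, p g) * x * (∑ g, p g)‖ > 1 - ε := by
  set P := ∑ g, p g
  set k := ∑ g, f g
  set k' := ∑ g, p g * f g * p g with hk'
  set θ : ℝ := Fintype.card G * (2 * κ)
  have hP : IsProjection P := .sum hp hpp
  have hys : star y = y := (IsSelfAdjoint.of_nonneg hy).star_eq
  have hk : IsSelfAdjoint k := isSelfAdjoint_sum _ fun g _ => .of_nonneg (hf g).1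
  have hpfp0 : ∀ g, 0 ≤ p g * f g * p g := fun g => by
    have := star_left_conjugate_nonneg (hf g).1 (p g)
    rwa [(hp g).1.star_eq] at this
  have hk'0 : 0 ≤ k' := Finset.sum_nonneg fun g _ => hpfp0 g
  have hk's : IsSelfAdjoint k' := .of_nonneg hk'0
  have hk'P : k' ≤ P := by
    refine Finset.sum_le_sum fun g _ => ?_
    have h1 := CStarAlgebra.star_left_conjugate_le_norm_smul (a := p g) (b := f g)
      (.of_nonneg (hf g).1)
    have h0 : 0 ≤ star (p g) * p g := star_mul_self_nonneg _
    have h2 := h1.trans (smul_le_smul_of_nonneg_right (hf g).2 h0)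
    rwa [(hp g).1.star_eq, (hp g).2, one_smul] at h2
  have hk'n : ‖k'‖ ≤ 1 :=
    (CStarAlgebra.norm_le_norm_of_nonneg_of_le hk'0 hk'P).trans hP.norm_le_one
  have hPp : ∀ g, P * p g = p g := fun g => by
    simp only [P, Finset.sum_mul]
    rw [Finset.sum_eq_single g (fun h _ hgh => hpp h g hgh) (by simp), (hp g).2]
  have hPk' : P * k' = k' := by
    rw [hk', Finset.mul_sum]
    exact Finset.sum_congr rfl fun g _ => by rw [← mul_assoc, ← mul_assoc, hPp]
  have hk'Pr : k' * P = k' := by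
    have := congrArg star hPk'
    rwa [star_mul, hk's.star_eq, hP.1.star_eq] at this
  have hdist : ‖k - k'‖ ≤ θ := by
    rw [hk', ← Finset.sum_sub_distrib]
    refine (norm_sum_le_of_le (n := fun _ => 2 * κ) _ fun g _ => ?_).trans
      (le_of_eq (by simp [θ]))
    have h1 : f g - p g * f g * p g = -(p g * f g - f g) - p g * star (p g * f g - f g) := by
      rw [star_sub, star_mul, (hp g).1.star_eq, (IsSelfAdjoint.of_nonneg (hf g).1).star_eq]
      noncomm_ring
    rw [h1]
    refine (norm_sub_le _ _).trans ?_
    have h2 := (norm_mul_le (p g) (star (p g * f g - f g))).trans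
      (mul_le_of_le_one_left (norm_nonneg _) (hp g).norm_le_one)
    rw [norm_star] at h2
    rw [norm_neg]
    linarith [hκ g]
  have hθ : 0 ≤ θ := (norm_nonneg _).trans hdist
  have hsa : ∀ b : A, IsSelfAdjoint b → IsSelfAdjoint (y * b * y) := fun b hb => by
    rw [IsSelfAdjoint, star_mul, star_mul, hys, hb.star_eq, mul_assoc]
  have hyy : IsSelfAdjoint (y * y) := by rw [IsSelfAdjoint, star_mul, hys]
  constructor
  · refine cuntzSubeq_cutPos_of_le_add (z := y * (k - k') * y) (hyy.sub (hsa P hP.1))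
      (hyy.sub (hsa k hk)) (hsa _ (hk.sub hk's)) hε' hε ?_ ?_ hsub
    · have h1 := star_left_conjugate_le_conjugate hk'P y
      rw [hys] at h1
      have h2 : y * y - y * k * y + y * (k - k') * y = y * y - y * k' * y := by noncomm_ring
      rw [h2]
      exact sub_le_sub_left h1 _
    · have h1 : ‖y * (k - k') * y‖ ≤ ‖y‖ * ‖k - k'‖ * ‖y‖ := norm_mul₃_le
      nlinarith [mul_le_mul_of_nonneg_right hdist (sq_nonneg ‖y‖)]
  · have h1 : k * x * k = k' * (P * x * P) * k' + ((k - k') * x * k + k' * x * (k - k')) := by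
      have : k' * (P * x * P) * k' = (k' * P) * x * (P * k') := by noncomm_ring
      rw [this, hPk', hk'Pr]; noncomm_ring
    have hkn : ‖k‖ ≤ 1 + θ := by
      have := norm_add_le k' (k - k')
      rw [add_sub_cancel] at this
      linarith
    have h2 : ‖k' * (P * x * P) * k'‖ ≤ ‖P * x * P‖ := by
      calc _ ≤ ‖k'‖ * ‖P * x * P‖ * ‖k'‖ := norm_mul₃_le
        _ ≤ 1 * ‖P * x * P‖ * 1 := by gcongr
        _ = _ := by ring
    have h3 : ‖(k - k') * x * k‖ ≤ θ * (1 + θ) := by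
      calc _ ≤ ‖k - k'‖ * ‖x‖ * ‖k‖ := norm_mul₃_le
        _ ≤ θ * 1 * (1 + θ) := by gcongr; exact hx.le
        _ = _ := by ring
    have h4 : ‖k' * x * (k - k')‖ ≤ θ := by
      calc _ ≤ ‖k'‖ * ‖x‖ * ‖k - k'‖ := norm_mul₃_le
        _ ≤ 1 * 1 * θ := by gcongr; exact hx.le
        _ = _ := by ring
    have h5 := (congrArg norm h1).le.trans ((norm_add_le _ _).trans
      (add_le_add h2 ((norm_add_le _ _).trans (add_le_add h3 h4))))
    nlinarith

end Comparison

section CentralSequences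

variable {A : Type*} [NonUnitalCStarAlgebra A]

lemma tendsto_mul_sub_mul_of_dense {d f : ℕ → A} (hd : DenseRange d) (hf : ∀ n, ‖f n‖ ≤ 1)
    (h : ∀ n, ∀ k ≤ n, ‖f n * d k - d k * f n‖ < 1 / ((n : ℝ) + 1)) (b : A) :
    Tendsto (fun n => f n * b - b * f n) atTop (nhds 0) := by
  rw [Metric.tendsto_atTop]
  intro η hη
  obtain ⟨k, hk⟩ := hd.exists_dist_lt b (show 0 < η / 4 by positivity)
  obtain ⟨m, hm⟩ := exists_nat_one_div_lt (show 0 < η / 2 by positivity)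
  refine ⟨max k m, fun n hn => ?_⟩
  have h1 := h n k ((le_max_left _ _).trans hn)
  have h2 : 1 / ((n : ℝ) + 1) ≤ 1 / ((m : ℝ) + 1) :=
    Nat.one_div_le_one_div ((le_max_right _ _).trans hn)
  have e : f n * b - b * f n
      = (f n * d k - d k * f n) + (f n * (b - d k) - (b - d k) * f n) := by noncomm_ring
  rw [dist_eq_norm] at hk
  rw [dist_zero_right, e]
  have h3 : ‖f n * (b - d k)‖ ≤ ‖b - d k‖ :=
    (norm_mul_le _ _).trans (mul_le_of_le_one_left (norm_nonneg _) (hf n))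
  have h4 : ‖(b - d k) * f n‖ ≤ ‖b - d k‖ :=
    (norm_mul_le _ _).trans (mul_le_of_le_one_right (norm_nonneg _) (hf n))
  linarith [norm_add_le (f n * d k - d k * f n) (f n * (b - d k) - (b - d k) * f n),
    norm_sub_le (f n * (b - d k)) ((b - d k) * f n)]

lemma tendsto_mul_zero_of_norm_le {l : Filter ℕ} {u v : ℕ → A} {M : ℝ} (hu : ∀ n, ‖u n‖ ≤ M)
    (hv : Tendsto v l (nhds 0)) : Tendsto (fun n => u n * v n) l (nhds 0) :=
  isBoundedUnder_le_mul_tendsto_zero (isBoundedUnder_of ⟨M, hu⟩) hv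

lemma tendsto_zero_mul_of_norm_le {l : Filter ℕ} {u v : ℕ → A} {M : ℝ} (hu : ∀ n, ‖u n‖ ≤ M)
    (hv : Tendsto v l (nhds 0)) : Tendsto (fun n => v n * u n) l (nhds 0) :=
  hv.zero_mul_isBoundedUnder_le (isBoundedUnder_of ⟨M, hu⟩)

lemma WeakTracialRokhlinProperty.exists_seq [PartialOrder A] [StarOrderedRing A]
    [TopologicalSpace.SeparableSpace A] {G : Type*} [Group G] [Fintype G] {α : G → A ≃⋆ₐ[ℂ] A}
    (hα : WeakTracialRokhlinProperty α) {x y : A} (hx : 0 ≤ x) (hy : 0 ≤ y) (hx1 : ‖x‖ = 1) :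
    ∃ f : ℕ → G → A, (∀ n g, 0 ≤ f n g ∧ ‖f n g‖ ≤ 1) ∧
      (∀ n g h, g ≠ h → f n g * f n h = 0) ∧
      (∀ g b, Tendsto (fun n => f n g * b - b * f n g) atTop (nhds 0)) ∧
      (∀ g h, Tendsto (fun n => α g (f n h) - f n (g * h)) atTop (nhds 0)) ∧
      ∀ n : ℕ, CuntzSubeq (cutPos (y * y - y * (∑ g, f n g) * y) (1 / ((n : ℝ) + 1))) x ∧
        ‖(∑ g, f n g) * x * (∑ g, f n g)‖ > 1 - 1 / ((n : ℝ) + 1) := by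
  classical
  have : Nonempty A := ⟨0⟩
  choose f hf hff hcomm hact hsub hnorm using fun n : ℕ =>
    hα ((Finset.range (n + 1)).image (TopologicalSpace.denseSeq A)) (1 / ((n : ℝ) + 1))
      Nat.one_div_pos_of_nat x y hx hy hx1
  refine ⟨f, hf, hff, fun g b => ?_, fun g h => ?_, fun n => ⟨hsub n, hnorm n⟩⟩
  · refine tendsto_mul_sub_mul_of_dense (TopologicalSpace.denseRange_denseSeq A)
      (fun n => (hf n g).2) (fun n k hk => hcomm n _ ?_ g) b
    exact Finset.mem_image_of_mem _ (Finset.mem_range.2 (Nat.lt_succ_of_le hk))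
  · exact squeeze_zero_norm (fun n => (hact n g h).le) tendsto_one_div_add_atTop_nhds_zero_nat

lemma tendsto_norm_coe_iff {l : Filter ℕ} {s : lp (fun _ : ℕ => A) ∞} :
    Tendsto (fun n => ‖s n‖) l (nhds 0) ↔ Tendsto (fun n => s n) l (nhds 0) :=
  tendsto_zero_iff_norm_tendsto_zero.symm

lemma exists_compression_seq [PartialOrder A] [StarOrderedRing A]
    {B : Type*} [NonUnitalCStarAlgebra B] {l : Filter ℕ} {π : lp (fun _ : ℕ => A) ∞ →⋆ₙₐ[ℂ] B}
    (hπ : Function.Surjective π)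
    (hker : ∀ f : lp (fun _ : ℕ => A) ∞, π f = 0 ↔ Tendsto (fun n => ‖f n‖) l (nhds 0))
    (hRR : RealRankZero ↥(relCommutant A π)) {e : ℕ → A} (he : ∀ n, IsSelfAdjoint (e n))
    (he1 : ∀ n, ‖e n‖ ≤ 1) (hec : ∀ b, Tendsto (fun n => e n * b - b * e n) l (nhds 0))
    {κ : ℝ} (hκ : 0 < κ) :
    ∃ (w : ℕ → A) (M : ℝ), (∀ n, IsSelfAdjoint (w n)) ∧ (∀ n, ‖w n‖ ≤ M) ∧
      Tendsto (fun n => e n * w n * e n * (e n * w n * e n) - e n * w n * e n) l (nhds 0) ∧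
      (∀ b, Tendsto (fun n => e n * w n * e n * b - b * (e n * w n * e n)) l (nhds 0)) ∧
      ∀ᶠ n in l, ‖e n * w n * e n * e n - e n‖ < κ := by
  let E : lp (fun _ : ℕ => A) ∞ := ⟨e, memℓp_infty ⟨1, by rintro r ⟨n, rfl⟩; exact he1 n⟩⟩
  have hmem : ∀ t : lp (fun _ : ℕ => A) ∞, π t ∈ relCommutant A π ↔
      ∀ b, Tendsto (fun n => t n * b - b * t n) l (nhds 0) := by
    intro t
    refine forall_congr' fun b => ?_
    rw [← sub_eq_zero, ← map_mul, ← map_mul, ← map_sub, hker, tendsto_norm_coe_iff]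
    rfl
  have hEs : IsSelfAdjoint E := lp.ext (funext fun n => (he n).star_eq)
  have hE : π E ∈ relCommutant A π := (hmem E).2 hec
  obtain ⟨w, hw, hwp, hwκ⟩ := hRR.exists_projection (e := ⟨π E, hE⟩)
    (Subtype.ext (hEs.map π).star_eq) hκ
  obtain ⟨s, hs⟩ := hπ w
  have hws : IsSelfAdjoint (w : B) := congrArg Subtype.val hw.star_eq
  let r : lp (fun _ : ℕ => A) ∞ := (2⁻¹ : ℂ) • (s + star s)
  have hrs : IsSelfAdjoint r := by
    refine IsSelfAdjoint.smul ?_ (.add_star_self s)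
    simp [isSelfAdjoint_iff]
  have hr : π r = w := by
    have : π r = (2⁻¹ : ℂ) • ((w : B) + w) := by
      rw [map_smul, map_add, map_star, hs, hws.star_eq]
    rw [this, ← two_smul ℂ (w : B), smul_smul, inv_mul_cancel₀ two_ne_zero, one_smul]
  have hπc : π (E * r * E) = π E * w * π E := by rw [map_mul, map_mul, hr]
  refine ⟨fun n => r n, ‖r‖, fun n => ?_, fun n => norm_lpEval_le n r, ?_, ?_, ?_⟩
  · exact hrs.map (lpEval A n)
  · have : π (E * r * E * (E * r * E) - E * r * E) = 0 := by
      rw [map_sub, map_mul, hπc, sub_eq_zero]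
      exact congrArg Subtype.val hwp
    rw [hker, tendsto_norm_coe_iff] at this
    exact this
  · refine (hmem (E * r * E)).1 ?_
    rw [hπc]
    exact mul_mem (mul_mem hE w.2) hE
  · have : ‖π (E * r * E * E - E)‖ < κ := by
      rw [map_sub, map_mul, hπc]
      exact hwκ
    exact eventually_norm_lt_of_norm_map_lt hker this

end CentralSequences

section Translates

variable {A : Type*} [NonUnitalCStarAlgebra A] {G : Type*} [Group G] [Fintype G]
  {α : G → A ≃⋆ₐ[ℂ] A} {l : Filter ℕ}

lemma tendsto_map_zero_of_tendsto_zero (φ : A ≃⋆ₐ[ℂ] A) {u : ℕ → A}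
    (hu : Tendsto u l (nhds 0)) : Tendsto (fun n => φ (u n)) l (nhds 0) := by
  have h := ((StarAlgEquiv.isometry φ).continuous.tendsto 0).comp hu
  rwa [map_zero] at h

lemma tendsto_cfcₙ_ramp_sub {a : ℕ → A} (ha : ∀ n, IsSelfAdjoint (a n))
    (h : Tendsto (fun n => a n * a n - a n) l (nhds 0)) :
    (∀ᶠ n in l, IsProjection (cfcₙ ramp (a n))) ∧
      Tendsto (fun n => cfcₙ ramp (a n) - a n) l (nhds 0) := by
  have h0 := tendsto_zero_iff_norm_tendsto_zero.1 h
  have hs : ∀ᶠ n in l, ‖a n * a n - a n‖ < 3 / 16 := h0.eventually (gt_mem_nhds (by norm_num))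
  refine ⟨hs.mono fun n hn => isProjection_cfcₙ_ramp (ha n) hn, ?_⟩
  refine squeeze_zero_norm' (hs.mono fun n hn => norm_cfcₙ_ramp_sub_le (ha n) hn) ?_
  simpa using h0.const_mul 2

lemma exists_translated_projections (hα : ∀ g h : G, ∀ a : A, α (g * h) a = α g (α h a))
    {f : ℕ → G → A} (hf : ∀ n g, IsSelfAdjoint (f n g)) (hf1 : ∀ n g, ‖f n g‖ ≤ 1)
    (hff : ∀ n g h, g ≠ h → f n g * f n h = 0)
    (hact : ∀ g h, Tendsto (fun n => α g (f n h) - f n (g * h)) l (nhds 0))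
    {w : ℕ → A} {M κ : ℝ} (hw : ∀ n, IsSelfAdjoint (w n)) (hwM : ∀ n, ‖w n‖ ≤ M)
    (hidem : Tendsto (fun n =>
      f n 1 * w n * f n 1 * (f n 1 * w n * f n 1) - f n 1 * w n * f n 1) l (nhds 0))
    (hcomm : ∀ b, Tendsto (fun n =>
      f n 1 * w n * f n 1 * b - b * (f n 1 * w n * f n 1)) l (nhds 0))
    (hκ : ∀ᶠ n in l, ‖f n 1 * w n * f n 1 * f n 1 - f n 1‖ < κ / 2) (hκ0 : 0 < κ) :
    ∃ p : ℕ → G → A, (∀ᶠ n in l, ∀ g, IsProjection (p n g)) ∧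
      (∀ n g h, g ≠ h → p n g * p n h = 0) ∧
      (∀ g b, Tendsto (fun n => p n g * b - b * p n g) l (nhds 0)) ∧
      (∀ g h, Tendsto (fun n => α g (p n h) - p n (g * h)) l (nhds 0)) ∧
      ∀ᶠ n in l, ∀ g, ‖p n g * f n g - f n g‖ ≤ κ := by
  set c : ℕ → A := fun n => f n 1 * w n * f n 1 with hc
  set a : ℕ → G → A := fun n g => f n g * α g (w n) * f n g with ha
  have hidem_c : Tendsto (fun n => c n * c n - c n) l (nhds 0) := hidem
  have hcomm_c : ∀ b, Tendsto (fun n => c n * b - b * c n) l (nhds 0) := hcomm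
  have hαw : ∀ g n, ‖α g (w n)‖ ≤ M := fun g n => (StarAlgEquiv.norm_map _ _).trans_le (hwM n)
  have has : ∀ n g, IsSelfAdjoint (a n g) := fun n g => by
    have := ((hw n).map (α g)).conjugate_self (hf n g)
    exact this
  have hM : 0 ≤ M := (norm_nonneg _).trans (hwM 0)
  have hcM : ∀ n, ‖c n‖ ≤ M := fun n => by
    have h1 := (norm_mul₃_le (a := f n 1) (b := w n) (c := f n 1))
    have h2 : ‖f n 1‖ * ‖w n‖ * ‖f n 1‖ ≤ 1 * M * 1 := by
      gcongr <;> first | exact hf1 _ _ | exact hwM _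
    linarith
  have hαc : ∀ g n, ‖α g (c n)‖ ≤ M := fun g n => (StarAlgEquiv.norm_map _ _).trans_le (hcM n)
  have haM : ∀ g n, ‖a n g‖ ≤ M := fun g n => by
    have h1 := (norm_mul₃_le (a := f n g) (b := α g (w n)) (c := f n g))
    have h2 : ‖f n g‖ * ‖α g (w n)‖ * ‖f n g‖ ≤ 1 * M * 1 := by
      gcongr <;> first | exact hf1 _ _ | exact hαw _ _
    linarith
  have hact1 : ∀ g, Tendsto (fun n => α g (f n 1) - f n g) l (nhds 0) := fun g => by
    simpa using hact g 1
  have hac : ∀ g, Tendsto (fun n => a n g - α g (c n)) l (nhds 0) := fun g => by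
    have h1 := tendsto_zero_mul_of_norm_le (M := M) (u := fun n => α g (w n) * α g (f n 1))
      (fun n => by
        have := norm_mul_le (α g (w n)) (α g (f n 1))
        have h2 : ‖α g (w n)‖ * ‖α g (f n 1)‖ ≤ M * 1 := by
          gcongr
          · exact hαw _ _
          · exact (StarAlgEquiv.norm_map _ _).trans_le (hf1 _ _)
        linarith) (hact1 g)
    have h2 := tendsto_mul_zero_of_norm_le (M := M) (u := fun n => f n g * α g (w n))
      (fun n => by
        have := norm_mul_le (f n g) (α g (w n))
        have h2 : ‖f n g‖ * ‖α g (w n)‖ ≤ 1 * M := by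
          gcongr <;> first | exact hf1 _ _ | exact hαw _ _
        linarith) (hact1 g)
    have h3 := (h1.add h2).neg
    simp only [add_zero, neg_zero] at h3
    refine h3.congr fun n => ?_
    simp only [ha, hc, map_mul]
    noncomm_ring
  have hidem' : ∀ g, Tendsto (fun n => a n g * a n g - a n g) l (nhds 0) := fun g => by
    have h1 := tendsto_map_zero_of_tendsto_zero (α g) hidem_c
    have h2 := tendsto_mul_zero_of_norm_le (haM g) (hac g)
    have h3 := tendsto_zero_mul_of_norm_le (hαc g) (hac g)
    have h4 := ((h1.add h2).add h3).sub (hac g)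
    simp only [add_zero, sub_zero] at h4
    refine h4.congr fun n => ?_
    rw [map_sub, map_mul]
    noncomm_ring
  have hra := fun g => tendsto_cfcₙ_ramp_sub (fun n => has n g) (hidem' g)
  set p : ℕ → G → A := fun n g => cfcₙ ramp (a n g) with hp
  have hpc : ∀ g, Tendsto (fun n => p n g - α g (c n)) l (nhds 0) := fun g => by
    have := (hra g).2.add (hac g)
    simpa using this
  have haa : ∀ n g h, g ≠ h → a n g * a n h = 0 := fun n g h hgh => by
    calc a n g * a n h = f n g * α g (w n) * (f n g * f n h) * α h (w n) * f n h := by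
          simp only [ha]; noncomm_ring
      _ = 0 := by rw [hff n g h hgh]; simp
  refine ⟨p, eventually_all.2 fun g => (hra g).1, fun n g h hgh => ?_, fun g b => ?_,
    fun g h => ?_, ?_⟩
  · exact cfcₙ_ramp_mul_eq_zero (has n g) (mul_cfcₙ_ramp_eq_zero (has n h) (haa n g h hgh))
  · have h1 := tendsto_zero_mul_of_norm_le (M := ‖b‖) (u := fun _ => b) (fun _ => le_rfl) (hpc g)
    have h2 := tendsto_mul_zero_of_norm_le (M := ‖b‖) (u := fun _ => b) (fun _ => le_rfl) (hpc g)
    have h3 := tendsto_map_zero_of_tendsto_zero (α g) (hcomm_c ((α g).symm b))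
    have h4 := (h1.sub h2).add h3
    simp only [add_zero, sub_zero] at h4
    refine h4.congr fun n => ?_
    simp only [map_sub, map_mul (α g) (c n), map_mul (α g) _ (c n), StarAlgEquiv.apply_symm_apply]
    noncomm_ring
  · have h1 := (tendsto_map_zero_of_tendsto_zero (α g) (hpc h)).sub (hpc (g * h))
    rw [sub_zero] at h1
    refine h1.congr fun n => ?_
    rw [map_sub, hα]
    abel
  · refine eventually_all.2 fun g => ?_
    have h1 := tendsto_zero_mul_of_norm_le (fun n => hf1 n g) (hpc g)
    have h2 := tendsto_mul_zero_of_norm_le (hαc g) (hact1 g)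
    have h3 := ((h1.sub h2).add (hact1 g)).norm
    simp only [add_zero, sub_zero, norm_zero] at h3
    filter_upwards [hκ, h3.eventually (gt_mem_nhds (half_pos hκ0))] with n hn hn'
    have e : p n g * f n g - f n g = α g (c n * f n 1 - f n 1)
        + ((p n g - α g (c n)) * f n g - α g (c n) * (α g (f n 1) - f n g)
          + (α g (f n 1) - f n g)) := by
      rw [map_sub, map_mul]
      noncomm_ring
    rw [e]
    refine (norm_add_le _ _).trans ?_
    rw [StarAlgEquiv.norm_map]
    linarith

end Translates

open Filter in
/-- Theorem B: if `A` is a simple separable C*-algebra, `α` is an action of a finite group `G`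
on `A` with the weak tracial Rokhlin property, and the relative commutant `A' ∩ A_ω` has real
rank zero for some free ultrafilter `ω` on `ℕ` (where `A_ω = ℓ∞(A)/c_ω(A)` is realized as any
C*-algebra `B` which is the image of `ℓ∞(A)` under a star homomorphism with kernel `c_ω(A)`),
then `α` has the tracial Rokhlin property. -/
theorem tracialRokhlin_of_weakTracialRokhlin_of_realRankZero_commutant
    {A : Type*} [NonUnitalCStarAlgebra A] [PartialOrder A] [StarOrderedRing A]
    [TopologicalSpace.SeparableSpace A]
    {G : Type*} [Group G] [Fintype G]
    (hA : IsSimpleCStarAlgebra A)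
    (α : G → A ≃⋆ₐ[ℂ] A) (hα : ∀ g h : G, ∀ a : A, α (g * h) a = α g (α h a))
    (hwTRP : WeakTracialRokhlinProperty α)
    (ω : Ultrafilter ℕ) (hω : (ω : Filter ℕ) ≤ Filter.cofinite)
    (B : Type*) [NonUnitalCStarAlgebra B]
    (π : lp (fun _ : ℕ => A) ∞ →⋆ₙₐ[ℂ] B)
    (hπ : Function.Surjective π)
    (hker : ∀ f : lp (fun _ : ℕ => A) ∞,
      π f = 0 ↔ Tendsto (fun n => ‖f n‖) (ω : Filter ℕ) (nhds 0))
    (hRR : RealRankZero ↥(relCommutant A π)) :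
    TracialRokhlinProperty α := by
  intro F ε hε x y hx hy hx1
  obtain ⟨f, hf, hff, hfc, hfact, hfx⟩ := hwTRP.exists_seq hx hy hx1
  have hωtop : (ω : Filter ℕ) ≤ atTop := Nat.cofinite_eq_atTop ▸ hω
  have hN : (0 : ℝ) < Fintype.card G := by exact_mod_cast Fintype.card_pos
  have hY : 0 < 1 + ‖y‖ ^ 2 := by positivity
  obtain ⟨θ, hθ0, hθ1, hθy⟩ : ∃ θ : ℝ, 0 < θ ∧ θ ≤ 1 ∧ θ * (1 + ‖y‖ ^ 2) ≤ ε / 8 :=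
    ⟨min 1 (ε / 8 / (1 + ‖y‖ ^ 2)), by positivity, min_le_left _ _,
      (le_div_iff₀ hY).1 (min_le_right _ _)⟩
  obtain ⟨κ, hκ0, hκ⟩ : ∃ κ : ℝ, 0 < κ ∧ Fintype.card G * (2 * κ) = θ :=
    ⟨θ / (2 * Fintype.card G), by positivity, by field_simp⟩
  obtain ⟨w, M, hw, hwM, hidem, hcomm, hwκ⟩ := exists_compression_seq hπ hker hRR
    (fun n => IsSelfAdjoint.of_nonneg (hf n 1).1) (fun n => (hf n 1).2)
    (fun b => (hfc 1 b).mono_left hωtop) (half_pos hκ0)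
  obtain ⟨p, hp, hpp, hpc, hpact, hpf⟩ := exists_translated_projections hα
    (fun n g => IsSelfAdjoint.of_nonneg (hf n g).1) (fun n g => (hf n g).2) hff
    (fun g h => (hfact g h).mono_left hωtop) hw hwM hidem hcomm hwκ hκ0
  have hsmall : ∀ {u : ℕ → A}, Tendsto u ω (nhds 0) → ∀ᶠ n in (ω : Filter ℕ), ‖u n‖ < ε :=
    fun hu => (tendsto_zero_iff_norm_tendsto_zero.1 hu).eventually (gt_mem_nhds hε)
  have hε' : ∀ᶠ n : ℕ in (ω : Filter ℕ), 1 / ((n : ℝ) + 1) < ε / 2 :=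
    (tendsto_one_div_add_atTop_nhds_zero_nat.mono_left hωtop).eventually
      (gt_mem_nhds (half_pos hε))
  have hpc' : ∀ᶠ n in (ω : Filter ℕ), ∀ b ∈ F, ∀ g, ‖p n g * b - b * p n g‖ < ε :=
    F.eventually_all.2 fun b _ => eventually_all.2 fun g => hsmall (hpc g b)
  have hpact' : ∀ᶠ n in (ω : Filter ℕ), ∀ g h, ‖α g (p n h) - p n (g * h)‖ < ε :=
    eventually_all.2 fun g => eventually_all.2 fun h => hsmall (hpact g h)
  obtain ⟨n, hn, hnf, hnε, hnc, hnact⟩ :=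
    (hp.and (hpf.and (hε'.and (hpc'.and hpact')))).exists
  have hθθ : θ * ‖y‖ ^ 2 ≤ ε / 8 := by linarith
  have hθε : θ * (2 + θ) ≤ 3 * ε / 8 := by nlinarith [mul_nonneg hθ0.le (sq_nonneg ‖y‖)]
  exact ⟨p n, hn, hpp n, hnc, hnact, compare_of_projections_near (hf n) hn (hpp n) hnf hy hx1
    Nat.one_div_pos_of_nat.le hε (by rw [hκ]; linarith) (by rw [hκ]; linarith)
    (hfx n).1 (hfx n).2⟩
end

section
/- Let A be a unital C*-algebra, let e₁ and p be projections in A with e₁p = 0 and e₁ + p ≤ 1, let μ ∈ A be a partial isometry with μμ* = 1 − e₁ − p and μ*μ ≤ e₁, and let y ∈ A be self-adjoint with y = (1 − e₁ − p) y (1 − e₁ − p). For ε > 0, put z = y + (ε/2)μ + (ε/2)μ* + (ε/2)(e₁ − μ*μ). Then z is a self-adjoint element of the corner (1 − p)A(1 − p) which is invertible in (1 − p)A(1 − p), with inverse z⁻¹ = (2/ε)(e₁ − μ*μ) − (4/ε²)μ* y μ + (2/ε)μ* + (2/ε)μ. -/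
/-- An element `μ` is fixed on the right by `star μ * μ` when the latter is idempotent. -/
lemma IsProjection.mul_star_self_mul {A : Type*} [CStarAlgebra A] {μ : A}
    (hμ : IsProjection (star μ * μ)) : μ * star μ * μ = μ := by
  have h : star (μ * star μ * μ - μ) * (μ * star μ * μ - μ) = 0 := by
    have h2 := hμ.2
    simp only [← mul_assoc] at h2
    simp only [star_sub, star_mul, star_star, sub_mul, mul_sub, ← mul_assoc, h2]
    abel
  exact sub_eq_zero.1 (CStarRing.star_mul_self_eq_zero_iff _ |>.1 h)

/-- If `star μ * μ` is dominated by a projection `e`, then `μ` is supported on `e`. -/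
lemma IsProjection.mul_eq_of_star_mul_self_le {A : Type*} [CStarAlgebra A] [PartialOrder A]
    [StarOrderedRing A] {e μ : A} (he : IsProjection e) (h : star μ * μ ≤ e) : μ * e = μ := by
  have hc := star_left_conjugate_le_conjugate h (1 - e)
  have h0 : star (1 - e) * e * (1 - e) = 0 := by
    simp only [star_sub, star_one, he.1.star_eq, sub_mul, mul_sub, one_mul, mul_one, he.2]
    abel
  have h1 : star (1 - e) * (star μ * μ) * (1 - e) = star (μ * (1 - e)) * (μ * (1 - e)) := by
    simp only [star_mul, mul_assoc]
  rw [h0, h1] at hc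
  have h2 := (CStarRing.star_mul_self_eq_zero_iff _).1 (le_antisymm hc (star_mul_self_nonneg _))
  rw [mul_sub, mul_one, sub_eq_zero] at h2
  exact h2.symm

/-- The invertibility computation in the proof of Theorem 3.4: with `e₁, p` orthogonal
projections, `μ` a partial isometry with `μμ* = 1 − e₁ − p` and `μ*μ ≤ e₁`, and `y` self-adjoint
supported in the corner `(1 − e₁ − p)A(1 − e₁ − p)`, the element
`z = y + (ε/2)μ + (ε/2)μ* + (ε/2)(e₁ − μ*μ)` is a self-adjoint element of the corner
`(1 − p)A(1 − p)` which is invertible there, with inverse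
`z⁻¹ = (2/ε)(e₁ − μ*μ) − (4/ε²)μ* y μ + (2/ε)μ* + (2/ε)μ`. -/
theorem corner_selfAdjoint_invertible
    {A : Type*} [CStarAlgebra A] [PartialOrder A] [StarOrderedRing A]
    (e₁ p μ y : A)
    (he₁ : IsProjection e₁) (hp : IsProjection p)
    (he₁p : e₁ * p = 0) (hle : e₁ + p ≤ 1)
    (hμ : IsProjection (star μ * μ))
    (hμμ : μ * star μ = 1 - e₁ - p) (hμe₁ : star μ * μ ≤ e₁)
    (hy : IsSelfAdjoint y) (hy' : y = (1 - e₁ - p) * y * (1 - e₁ - p))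
    (ε : ℝ) (hε : 0 < ε) :
    IsSelfAdjoint
        (y + (ε / 2) • μ + (ε / 2) • star μ + (ε / 2) • (e₁ - star μ * μ)) ∧
    (1 - p) * (y + (ε / 2) • μ + (ε / 2) • star μ + (ε / 2) • (e₁ - star μ * μ)) * (1 - p) =
        y + (ε / 2) • μ + (ε / 2) • star μ + (ε / 2) • (e₁ - star μ * μ) ∧
    (1 - p) * ((2 / ε) • (e₁ - star μ * μ) - (4 / ε ^ 2) • (star μ * y * μ) +
          (2 / ε) • star μ + (2 / ε) • μ) * (1 - p) =
        (2 / ε) • (e₁ - star μ * μ) - (4 / ε ^ 2) • (star μ * y * μ) +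
          (2 / ε) • star μ + (2 / ε) • μ ∧
    (y + (ε / 2) • μ + (ε / 2) • star μ + (ε / 2) • (e₁ - star μ * μ)) *
        ((2 / ε) • (e₁ - star μ * μ) - (4 / ε ^ 2) • (star μ * y * μ) +
          (2 / ε) • star μ + (2 / ε) • μ) = 1 - p ∧
    ((2 / ε) • (e₁ - star μ * μ) - (4 / ε ^ 2) • (star μ * y * μ) +
          (2 / ε) • star μ + (2 / ε) • μ) *
        (y + (ε / 2) • μ + (ε / 2) • star μ + (ε / 2) • (e₁ - star μ * μ)) = 1 - p := by
  have hpe : p * e₁ = 0 := by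
    simpa [he₁.1.star_eq, hp.1.star_eq] using congrArg star he₁p
  have hμ3 : μ * star μ * μ = μ := hμ.mul_star_self_mul
  have hμe : μ * e₁ = μ := he₁.mul_eq_of_star_mul_self_le hμe₁
  have hef : e₁ * (1 - e₁ - p) = 0 := by simp [mul_sub, he₁.2, he₁p]
  have hpf : p * (1 - e₁ - p) = 0 := by simp [mul_sub, hp.2, hpe]
  have heμ : e₁ * μ = 0 := by
    rw [← hμ3, hμμ, ← mul_assoc, hef, zero_mul]
  have hpμ : p * μ = 0 := by
    rw [← hμ3, hμμ, ← mul_assoc, hpf, zero_mul]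
  have hμp : μ * p = 0 := by rw [← hμe, mul_assoc, he₁p, mul_zero]
  have hey : e₁ * y = 0 := by rw [hy', ← mul_assoc, ← mul_assoc, hef, zero_mul, zero_mul]
  have hpy : p * y = 0 := by rw [hy', ← mul_assoc, ← mul_assoc, hpf, zero_mul, zero_mul]
  have hye : y * e₁ = 0 := by simpa [he₁.1.star_eq, hy.star_eq] using congrArg star hey
  have hyp : y * p = 0 := by simpa [hp.1.star_eq, hy.star_eq] using congrArg star hpy
  have heμ' : e₁ * star μ = star μ := by simpa [he₁.1.star_eq] using congrArg star hμe
  have hμe' : star μ * e₁ = 0 := by simpa [he₁.1.star_eq] using congrArg star heμ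
  have hμp' : star μ * p = 0 := by simpa [hp.1.star_eq] using congrArg star hpμ
  have hpμ' : p * star μ = 0 := by simpa [hp.1.star_eq] using congrArg star hμp
  have hμ2 : μ * μ = 0 := by rw [← hμe, mul_assoc, ← mul_assoc e₁, heμ, zero_mul, mul_zero]
  have hμ2' : star μ * star μ = 0 := by simpa using congrArg star hμ2
  have hyμ' : y * star μ = 0 := by rw [← heμ', ← mul_assoc, hye, zero_mul]
  have hz : IsSelfAdjoint
      (y + (ε / 2) • μ + (ε / 2) • star μ + (ε / 2) • (e₁ - star μ * μ)) := by
    rw [isSelfAdjoint_iff]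
    simp only [star_add, star_sub, star_smul, star_mul, star_star, star_trivial, hy.star_eq,
      he₁.1.star_eq]
    abel
  have hw : IsSelfAdjoint ((2 / ε) • (e₁ - star μ * μ) - (4 / ε ^ 2) • (star μ * y * μ) +
      (2 / ε) • star μ + (2 / ε) • μ) := by
    rw [isSelfAdjoint_iff]
    simp only [star_add, star_sub, star_smul, star_mul, star_star, star_trivial, hy.star_eq,
      he₁.1.star_eq, mul_assoc]
    abel
  have hzw : (y + (ε / 2) • μ + (ε / 2) • star μ + (ε / 2) • (e₁ - star μ * μ)) *
      ((2 / ε) • (e₁ - star μ * μ) - (4 / ε ^ 2) • (star μ * y * μ) +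
        (2 / ε) • star μ + (2 / ε) • μ) = 1 - p := by
    have hab : ε / 2 * (2 / ε) = 1 := by field_simp
    have hab2 : ε / 2 * (4 / ε ^ 2) = 2 / ε := by field_simp; norm_num
    have hyw : y * ((2 / ε) • (e₁ - star μ * μ) - (4 / ε ^ 2) • (star μ * y * μ) +
        (2 / ε) • star μ + (2 / ε) • μ) = (2 / ε) • (y * μ) := by
      simp only [mul_add, mul_sub, mul_smul_comm, ← mul_assoc, hye, hyμ', zero_mul, sub_zero,
        smul_zero, zero_add]
    have hμw : μ * ((2 / ε) • (e₁ - star μ * μ) - (4 / ε ^ 2) • (star μ * y * μ) +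
        (2 / ε) • star μ + (2 / ε) • μ) =
        (2 / ε) • (1 - e₁ - p) - (4 / ε ^ 2) • (y * μ) := by
      simp only [mul_add, mul_sub, mul_smul_comm, ← mul_assoc, hμe, hμ2, hμμ, sub_mul,
        one_mul, hey, hpy, sub_zero, smul_zero, add_zero, heμ, hpμ, sub_self]
      abel
    have hμw' : star μ * ((2 / ε) • (e₁ - star μ * μ) - (4 / ε ^ 2) • (star μ * y * μ) +
        (2 / ε) • star μ + (2 / ε) • μ) = (2 / ε) • (star μ * μ) := by
      simp only [mul_add, mul_sub, mul_smul_comm, ← mul_assoc, hμe', hμ2', zero_mul, sub_zero,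
        smul_zero, zero_add]
    have hew : (e₁ - star μ * μ) * ((2 / ε) • (e₁ - star μ * μ) -
        (4 / ε ^ 2) • (star μ * y * μ) + (2 / ε) • star μ + (2 / ε) • μ) =
        (2 / ε) • (e₁ - star μ * μ) := by
      rw [sub_mul, mul_assoc (star μ) μ, hμw]
      simp only [mul_add, mul_sub, mul_smul_comm, ← mul_assoc, he₁.2, heμ', heμ, hμe', hμp',
        mul_one, sub_zero, smul_zero, smul_sub]
      abel
    rw [add_mul, add_mul, add_mul, smul_mul_assoc, smul_mul_assoc, smul_mul_assoc, hyw, hμw,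
      hμw', hew]
    simp only [smul_sub, smul_smul, hab, hab2, one_smul]
    abel
  refine ⟨hz, ?_, ?_, hzw, ?_⟩
  · simp only [sub_mul, mul_sub, mul_add, add_mul, one_mul, mul_one, mul_smul_comm,
      smul_mul_assoc, ← mul_assoc, hpy, hpμ, hpμ', hpe, sub_zero]
    simp only [mul_assoc, hyp, hμp, hμp', he₁p, mul_zero, smul_zero, sub_zero, add_zero]
  · simp only [sub_mul, mul_sub, mul_add, add_mul, one_mul, mul_one, mul_smul_comm,
      smul_mul_assoc, ← mul_assoc, hpμ, hpμ', hpe, sub_zero]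
    simp only [mul_assoc, hμp, hμp', he₁p, mul_zero, smul_zero, sub_zero, add_zero]
  · simpa only [star_mul, hz.star_eq, hw.star_eq, star_sub, star_one, hp.1.star_eq] using
      congrArg star hzw
end
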